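/- Fix a triangulation T of an (n+3)-gon and two nonadjacent boundary vertices a, b such that the arc (a,b) crosses every internal diagonal of T, and equip T with the default orientation relative to (a,b). Then the λ-length of the arc (a,b), obtained from the initial λ-lengths and μ-invariants by any sequence of super Ptolemy flips producing a triangulation containing (a,b), equals the sum over all super T-paths t from a to b of the weights wt(t): λ_{a,b} = Σ_{t ∈ 𝒯_{a,b}} wt(t). -/

import Mathlib

namespace SuperTeich

open Sum

/-!  Decorated super-Teichmüller theory of a marked disk (polygon), after
Penner–Zeitlin, following Musiker–Ovenhouse–Zhang.

The polygon has `N` vertices `0, 1, …, N-1` (type `Fin N`) in counterclockwise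
convex position.  Edges/arcs are unordered pairs `Sym2 (Fin N)`; for an oriented
diagonal `u → v` with `u < v`, its left side consists of the vertices strictly
between `u` and `v`.  A state consists of a triangulation (its set of internal
diagonals), an orientation of the edges (`true` on `s(u,v)`, `u < v`, means
`u → v`), a `λ`-length for each edge and a `μ`-invariant for each triangle.
`Flip` is the super Ptolemy transformation of states.

The odd quantities live in an ambient `ℚ`-algebra `A` together with a positive
cone `Pos` of central invertible even elements and a coherent multiplicative
choice of square roots `sqrt` on it (encoding the distinguished square roots
with positive body). -/

/-- Arcs/edges of the `N`-gon: unordered pairs of vertices. -/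
abbrev Edg (N : ℕ) := Sym2 (Fin N)

/-- Boundary edges of the polygon: pairs of cyclically consecutive vertices. -/
def isBnd {N : ℕ} [NeZero N] (e : Edg N) : Prop := ∃ i : Fin N, e = s(i, i + 1)

/-- Two arcs of the convex polygon cross (in their interiors). -/
def crossE {N : ℕ} (e f : Edg N) : Prop :=
  ∃ p q r t : Fin N, p < q ∧ q < r ∧ r < t ∧
    ((e = s(p, r) ∧ f = s(q, t)) ∨ (f = s(p, r) ∧ e = s(q, t)))

/-- `e` is an edge of the triangulation with set of internal diagonals `D`. -/
def isEdgeOf {N : ℕ} [NeZero N] (D : Finset (Edg N)) (e : Edg N) : Prop :=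
  isBnd e ∨ e ∈ D

/-- `D` is the set of internal diagonals of a triangulation of the `N`-gon:
`N - 3` pairwise noncrossing diagonals. -/
def IsTriangulation {N : ℕ} [NeZero N] (D : Finset (Edg N)) : Prop :=
  D.card + 3 = N ∧ (∀ e ∈ D, ¬ isBnd e ∧ ¬ e.IsDiag) ∧
    ∀ e ∈ D, ∀ f ∈ D, ¬ crossE e f

/-- `t` is (the vertex set of) a triangle of the triangulation `D`. -/
def IsTri {N : ℕ} [NeZero N] (D : Finset (Edg N)) (t : Finset (Fin N)) : Prop :=
  t.card = 3 ∧ ∀ u ∈ t, ∀ v ∈ t, u ≠ v → isEdgeOf D s(u, v)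

/-- A state of the polygon: a triangulation with a spin structure representative
(an orientation of the edges) and the associated `λ`-lengths (even, attached to
edges) and `μ`-invariants (odd, attached to triangles). -/
structure PState (A : Type*) (N : ℕ) where
  diag : Finset (Edg N)
  ori : Edg N → Bool
  lam : Edg N → A
  mu : Finset (Fin N) → A

/-- The super Ptolemy transformation (flip) of states.  The flipped diagonal is
`s(p,r)`; the apexes of its two adjacent triangles are `j` (between `p` and `r`)
and `l` (outside).  With respect to the orientation of `s(p,r)`, `θ` is the
`μ`-invariant of the triangle on its left and `σ` of the triangle on its right,
and the quadrilateral's sides are `aa, bb, cc, dd` in counterclockwise order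
starting at the tail of the oriented diagonal.  The relations imposed are
`e·f = ac + bd + √(abcd)·σθ`, `θ'·√(ac+bd) = θ√(bd) + σ√(ac)`,
`σ'·√(ac+bd) = σ√(bd) − θ√(ac)`, where `θ'` (resp. `σ'`) is the triangle on the
left (resp. right) of the new oriented diagonal, which goes from the `σ`-side
apex to the `θ`-side apex; the side `bb` (joining the `θ`-apex to the head of
the old diagonal) has its orientation reversed, and all other data are
unchanged. -/
def Flip {A : Type*} [Ring A] {N : ℕ} [NeZero N] (Pos : Set A) (sqrt : A → A)
    (st st' : PState A N) : Prop :=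
  ∃ p j r l : Fin N, p < j ∧ j < r ∧ (l < p ∨ r < l) ∧
    s(p, r) ∈ st.diag ∧
    IsTri st.diag {p, j, r} ∧ IsTri st.diag {p, r, l} ∧
    st'.diag = insert s(j, l) (st.diag.erase s(p, r)) ∧
    (let ori := st.ori s(p, r)
     let θ := if ori then st.mu {p, j, r} else st.mu {p, r, l}
     let σ := if ori then st.mu {p, r, l} else st.mu {p, j, r}
     let θT : Finset (Fin N) := if ori then {p, j, l} else {j, r, l}
     let σT : Finset (Fin N) := if ori then {j, r, l} else {p, j, l}
     let aa := if ori then st.lam s(p, j) else st.lam s(r, l)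
     let bb := if ori then st.lam s(j, r) else st.lam s(l, p)
     let cc := if ori then st.lam s(r, l) else st.lam s(p, j)
     let dd := if ori then st.lam s(l, p) else st.lam s(j, r)
     let bEdge : Edg N := if ori then s(j, r) else s(l, p)
     st.lam s(p, r) * st'.lam s(j, l)
         = aa * cc + bb * dd + sqrt (aa * bb * cc * dd) * (σ * θ) ∧
     st'.lam s(j, l) ∈ Pos ∧
     st'.mu θT * sqrt (aa * cc + bb * dd) = θ * sqrt (bb * dd) + σ * sqrt (aa * cc) ∧
     st'.mu σT * sqrt (aa * cc + bb * dd) = σ * sqrt (bb * dd) - θ * sqrt (aa * cc) ∧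
     (∀ e : Edg N, e ≠ s(j, l) → st'.lam e = st.lam e) ∧
     (∀ t : Finset (Fin N), t ≠ θT → t ≠ σT → st'.mu t = st.mu t) ∧
     (∀ e : Edg N, e ≠ s(j, l) → e ≠ bEdge → st'.ori e = st.ori e) ∧
     st'.ori bEdge = ! st.ori bEdge ∧
     st'.ori s(j, l) = (if ori then decide (l < j) else decide (j < l)))

/-!  The auxiliary graph and super `T`-paths.

We fix an arc `(a, b)` crossing all `n` internal diagonals of the initial
triangulation `D₀` of the `(n+3)`-gon.  The combinatorial structure of the
triangulation along the arc is recorded by the data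
* `tri k` (`k : Fin (n+1)`) — the triangles met by the arc, in order from `a`
  to `b`;
* `dsp k` (`k : Fin n`) — the (ordered) endpoints of the diagonal separating
  `tri k` and `tri (k+1)`, the crossings being in order from `a` to `b`;
* `ctr k` — the center of the fan segment containing `tri k` (the endpoint of
  the `σ`-edge of the face `tri k`);
* `oth k` — the two vertices of `tri k` other than `ctr k`. -/

/-- Vertices of the auxiliary graph: polygon vertices and one internal vertex
per face. -/
abbrev VV (n : ℕ) := Fin (n + 3) ⊕ Fin (n + 1)

/-- Adjacency in the auxiliary graph: edges of the triangulation, `σ`-edges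
joining the internal vertex of a face to its fan center, and `τ`-edges joining
two internal vertices. -/
def jn {n : ℕ} (D0 : Finset (Edg (n + 3))) (ctr : Fin (n + 1) → Fin (n + 3)) :
    VV n → VV n → Prop
  | inl u, inl v => u ≠ v ∧ isEdgeOf D0 s(u, v)
  | inl u, inr k => u = ctr k
  | inr k, inl u => u = ctr k
  | inr k, inr k' => k ≠ k'

/-- `cpos dsp e m` : the auxiliary edge with endpoint pair `e` crosses the arc
`(a,b)`, at linear position `m` along the arc (the diagonal `dsp k` at position
`2k+2`, the `σ`-edge of the face `tri k` at position `2k+1`; `τ`-edges and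
non-crossing edges of the triangulation do not cross). -/
def cpos {n : ℕ} (dsp : Fin n → Fin (n + 3) × Fin (n + 3)) :
    VV n × VV n → ℕ → Prop
  | (inl u, inl v), m =>
      ∃ k : Fin n, s(u, v) = s((dsp k).1, (dsp k).2) ∧ m = 2 * k.val + 2
  | (inl _, inr k), m => m = 2 * k.val + 1
  | (inr k, inl _), m => m = 2 * k.val + 1
  | (inr _, inr _), _ => False

/-- The endpoint pair is a `σ`-edge. -/
def isSig {n : ℕ} : VV n × VV n → Prop
  | (inl _, inr _) => True
  | (inr _, inl _) => True
  | _ => False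

/-- The endpoint pair is a `τ`-edge. -/
def isTau {n : ℕ} : VV n × VV n → Prop
  | (inr _, inr _) => True
  | _ => False

/-- Equality of auxiliary edges, as unordered pairs of endpoints. -/
def pairEqV {n : ℕ} (p q : VV n × VV n) : Prop :=
  (p.1 = q.1 ∧ p.2 = q.2) ∨ (p.1 = q.2 ∧ p.2 = q.1)

/-- A super `T`-path from `a` to `b` (Definition 5.3 of the paper): a sequence
of vertices of the auxiliary graph joined by pairwise distinct edges, of odd
length, such that even-numbered edges cross the arc (`σ`-edges counting as
crossing), `σ`-edges occur only at even and `τ`-edges only at odd positions,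
and the crossings occur in order from `a` to `b`. -/
structure SuperTPath (n : ℕ) (a b : Fin (n + 3)) (D0 : Finset (Edg (n + 3)))
    (ctr : Fin (n + 1) → Fin (n + 3)) (dsp : Fin n → Fin (n + 3) × Fin (n + 3)) where
  len : ℕ
  vert : Fin (len + 1) → VV n
  odd_len : Odd len
  first_eq : vert 0 = inl a
  last_eq : vert (Fin.last len) = inl b
  joins : ∀ i : Fin len, jn D0 ctr (vert i.castSucc) (vert i.succ)
  edges_distinct : ∀ i i' : Fin len, i ≠ i' →
    ¬ pairEqV (vert i.castSucc, vert i.succ) (vert i'.castSucc, vert i'.succ)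
  even_cross : ∀ i : Fin len, Odd i.val →
    ∃ m, cpos dsp (vert i.castSucc, vert i.succ) m
  sig_even : ∀ i : Fin len, isSig (vert i.castSucc, vert i.succ) → Odd i.val
  tau_odd : ∀ i : Fin len, isTau (vert i.castSucc, vert i.succ) → Even i.val
  cross_mono : ∀ i i' : Fin len, i < i' → ∀ m m',
    cpos dsp (vert i.castSucc, vert i.succ) m →
    cpos dsp (vert i'.castSucc, vert i'.succ) m' → m < m'

/-- `θ_k` is to the right of the diagonal `dsp k` with respect to the
orientation `o` (the side of `dsp k` containing the triangle `tri k` is the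
side containing `a`). -/
def rOf {n : ℕ} (o : Edg (n + 3) → Bool) (dsp : Fin n → Fin (n + 3) × Fin (n + 3))
    (a : Fin (n + 3)) (k : Fin n) : Bool :=
  if o s((dsp k).1, (dsp k).2)
    then ! decide ((dsp k).1 < a ∧ a < (dsp k).2)
    else decide ((dsp k).1 < a ∧ a < (dsp k).2)

/-- The positive ordering of the faces, as a `Bool`-valued "comes before"
relation (Remark 5.9 of the paper): for `k < k'`, the face `θ_k` comes before
`θ_{k'}` iff `θ_k` is to the right of the oriented diagonal separating `θ_k`
from `θ_{k+1}`. -/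
def posB {n : ℕ} (o : Edg (n + 3) → Bool) (dsp : Fin n → Fin (n + 3) × Fin (n + 3))
    (a : Fin (n + 3)) (k k' : Fin (n + 1)) : Bool :=
  if h : k.val < k'.val then
    rOf o dsp a ⟨k.val, by have := k'.isLt; omega⟩
  else if h' : k'.val < k.val then
    ! rOf o dsp a ⟨k'.val, by have := k.isLt; omega⟩
  else true

/-- Insertion into a sorted list. -/
def insB {α : Type*} (le : α → α → Bool) (x : α) : List α → List α
  | [] => [x]
  | y :: t => if le x y then x :: y :: t else y :: insB le x t

/-- Insertion sort along a `Bool`-valued "comes before" relation (used to put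
the odd factors of a weight into the positive ordering). -/
def sortB {α : Type*} (le : α → α → Bool) : List α → List α
  | [] => []
  | x :: t => insB le x (sortB le t)

/-- The even (scalar) part of the weight of the `m`-th step of a super `T`-path
(steps numbered from `0`; the step is an odd step of the path iff `m` is even):
an edge of the triangulation contributes its `λ`-length at odd steps and the
inverse of its `λ`-length at even steps; the `σ`-edge of the face `tri k`
contributes `√(x_j/(x_k x_l))` where `x_j` is the `λ`-length of the side of the
face opposite to the fan center and `x_k, x_l` those of the two adjacent sides;
`τ`-edges contribute `1`. -/
noncomputable def stepWt {A : Type*} [Ring A] {n : ℕ}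
    (lam0 : Edg (n + 3) → A) (sqrt : A → A)
    (ctr : Fin (n + 1) → Fin (n + 3)) (oth : Fin (n + 1) → Fin (n + 3) × Fin (n + 3))
    (m : ℕ) : VV n × VV n → A
  | (inl u, inl v) =>
      if m % 2 = 0 then lam0 s(u, v) else Ring.inverse (lam0 s(u, v))
  | (inl _, inr k) =>
      sqrt (lam0 s((oth k).1, (oth k).2) *
        Ring.inverse (lam0 s(ctr k, (oth k).1) * lam0 s(ctr k, (oth k).2)))
  | (inr k, inl _) =>
      sqrt (lam0 s((oth k).1, (oth k).2) *
        Ring.inverse (lam0 s(ctr k, (oth k).1) * lam0 s(ctr k, (oth k).2)))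
  | (inr _, inr _) => 1

/-- The index of the face whose `σ`-edge is used at a given step, if any. -/
def sigIdx {n : ℕ} : VV n × VV n → Option (Fin (n + 1))
  | (inl _, inr k) => some k
  | (inr k, inl _) => some k
  | _ => none

/-- The weight of a super `T`-path (Definition 5.8 of the paper): the ordered
product of the even parts of the step weights, times the product of the odd
`μ`-invariants of the faces whose `σ`-edges are used, taken in the positive
ordering. -/
noncomputable def wt {A : Type*} [Ring A] {n : ℕ}
    (lam0 : Edg (n + 3) → A) (mu0 : Finset (Fin (n + 3)) → A) (sqrt : A → A)
    (o : Edg (n + 3) → Bool)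
    (tri : Fin (n + 1) → Finset (Fin (n + 3)))
    (ctr : Fin (n + 1) → Fin (n + 3)) (oth : Fin (n + 1) → Fin (n + 3) × Fin (n + 3))
    {a b : Fin (n + 3)} {D0 : Finset (Edg (n + 3))}
    {dsp : Fin n → Fin (n + 3) × Fin (n + 3)}
    (t : SuperTPath n a b D0 ctr dsp) : A :=
  ((List.finRange t.len).map
      (fun i => stepWt lam0 sqrt ctr oth i.val (t.vert i.castSucc, t.vert i.succ))).prod *
  ((sortB (posB o dsp a)
      ((List.finRange t.len).filterMap
        (fun i => sigIdx (t.vert i.castSucc, t.vert i.succ)))).map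
      (fun k => mu0 (tri k))).prod

section SuperPlane

variable {E O : Type*} [CommRing E] [AddCommGroup O] [Module E O]

/-- A vector of the super plane: two even coordinates and an odd one. -/
@[ext] structure SuperVec (E O : Type*) where
  x : E
  y : E
  o : O

/-- The orthosymplectic form on even vectors. -/
def osp (β : O →ₗ[E] O →ₗ[E] E) (u v : SuperVec E O) : E :=
  u.x * v.y - u.y * v.x + β u.o v.o

/-- The odd invariant of a triple of vectors. -/
def oddDet (β : O →ₗ[E] O →ₗ[E] E) (u v w : SuperVec E O) : O :=
  osp β v w • u.o + osp β w u • v.o + osp β u v • w.o - β u.o v.o • w.o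

variable {β : O →ₗ[E] O →ₗ[E] E} (hβ : ∀ x, β x x = 0)
  (hβc : ∀ x y z, β x y • z = β y z • x)

include hβ

lemma pairing_swap (x y : O) : β y x = - β x y := by
  have h := hβ (x + y)
  simp only [map_add, LinearMap.add_apply, hβ] at h
  linear_combination h

lemma osp_swap (u v : SuperVec E O) : osp β v u = - osp β u v := by
  simp only [osp, pairing_swap hβ u.o v.o]; ring

include hβc

lemma pairing_smul_left (x z : O) : β x z • x = 0 := by
  rw [← hβc x x z, hβ, zero_smul]

lemma pairing_smul_right (x z : O) : β x z • z = 0 := by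
  rw [pairing_swap hβ z x, neg_smul, pairing_smul_left hβ hβc, neg_zero]

omit hβ in
lemma pairing_mul (x y z t : O) : β x y * β z t = β y z * β x t := by
  have := congrArg (fun s => β s t) (hβc x y z)
  simpa using this

lemma pairing_mul_self (x z t : O) : β x z * β x t = 0 := by
  have := congrArg (fun s => β s t) (pairing_smul_left hβ hβc x z)
  simpa using this

omit hβc in
lemma oddDet_swap_left (u v w : SuperVec E O) : oddDet β v u w = - oddDet β u v w := by
  simp only [oddDet, osp, pairing_swap hβ u.o v.o, pairing_swap hβ w.o v.o, pairing_swap hβ u.o w.o]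
  module

lemma oddDet_swap_right (u v w : SuperVec E O) : oddDet β u w v = - oddDet β u v w := by
  have h1 := hβc u.o v.o w.o
  have h2 := hβc v.o w.o u.o
  simp only [oddDet, osp, pairing_swap hβ u.o v.o, pairing_swap hβ v.o w.o,
    pairing_swap hβ u.o w.o] at *
  linear_combination (norm := module) - h1 - h2

lemma oddDet_plucker (p j r l : SuperVec E O) :
    osp β p r • oddDet β p j l = osp β p l • oddDet β p j r + osp β p j • oddDet β p r l := by
  simp only [oddDet, osp, pairing_swap hβ p.o r.o, pairing_swap hβ p.o l.o]
  linear_combination (norm := module) (- p.x*r.y + p.y*r.x) • hβc p.o j.o l.o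
    + (β j.o l.o + j.x*l.y - j.y*l.x) • pairing_smul_left hβ hβc p.o r.o
    + (- l.x*p.y + l.y*p.x) • hβc p.o j.o r.o
    + (- β j.o r.o - j.x*r.y + j.y*r.x) • pairing_smul_left hβ hβc p.o l.o
    + (- j.x*p.y + j.y*p.x) • hβc p.o r.o l.o
    + (- β r.o l.o + l.x*r.y - l.y*r.x) • pairing_smul_left hβ hβc p.o j.o
    + congrArg (· • r.o) (pairing_mul_self hβ hβc p.o j.o l.o)

lemma osp_ptolemy (p j r l : SuperVec E O) :
    osp β p r * (osp β p r * osp β j l) =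
      osp β p r * (osp β p j * osp β r l + osp β p l * osp β j r) -
        β (oddDet β p j r) (oddDet β p r l) := by
  have h13 : β p.o r.o * β j.o l.o + β p.o j.o * β r.o l.o = 0 := by
    linear_combination - pairing_mul hβc r.o p.o j.o l.o + β j.o l.o * pairing_swap hβ p.o r.o
  have h14 : β p.o l.o * β j.o r.o - β p.o j.o * β r.o l.o = 0 := by
    linear_combination - pairing_mul hβc p.o j.o r.o l.o
  have hz1 : β p.o r.o * β r.o l.o = 0 := by
    linear_combination - pairing_mul_self hβ hβc r.o p.o l.o
      + β r.o l.o * pairing_swap hβ p.o r.o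
  have hz2 : β p.o r.o * β j.o r.o = 0 := by
    linear_combination pairing_mul_self hβ hβc r.o p.o j.o
      - β r.o j.o * pairing_swap hβ p.o r.o + β p.o r.o * pairing_swap hβ r.o j.o
  simp only [oddDet, osp, map_add, map_sub, map_smul, LinearMap.add_apply, LinearMap.sub_apply,
    LinearMap.smul_apply, smul_eq_mul, hβ]
  simp only [pairing_swap hβ p.o j.o, pairing_swap hβ p.o r.o, pairing_swap hβ p.o l.o]
  linear_combination (p.x*r.y - p.y*r.x) * h13
    + (β j.o l.o + j.x*l.y - j.y*l.x) * pairing_mul_self hβ hβc p.o r.o r.o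
    + (p.x*r.y - p.y*r.x) * h14
    + (2*j.x*p.y - 2*j.y*p.x) * hz1
    + (- β p.o l.o + l.x*p.y - l.y*p.x) * hz2
    + (- 2*j.x*r.y + 2*j.y*r.x) * pairing_mul_self hβ hβc p.o r.o l.o

/-- A vector is determined at will by its pairings with two given vectors spanning a
nondegenerate plane, together with the odd invariant of the three. -/
lemma exists_superVec (u w : SuperVec E O) (huw : IsUnit (osp β u w)) (s t : E) (d : O) :
    ∃ v, osp β u v = s ∧ osp β w v = t ∧ oddDet β u w v = d := by
  obtain ⟨c, hc⟩ := huw.exists_left_inv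
  have h1 : β u.o u.o = 0 := hβ _
  have h2 : β w.o w.o = 0 := hβ _
  have h3 := pairing_swap hβ u.o w.o
  have h4 := pairing_smul_left hβ hβc u.o w.o
  have h5 := pairing_smul_right hβ hβc u.o w.o
  have h4d : β u.o w.o * β u.o d = 0 := by simpa using congrArg (fun z => β z d) h4
  have h5d : β u.o w.o * β w.o d = 0 := by simpa using congrArg (fun z => β z d) h5
  have h6 : β u.o w.o * β u.o w.o = 0 := pairing_mul_self hβ hβc _ _ _
  have hu : osp β u w = u.x * w.y - u.y * w.x + β u.o w.o := rfl
  let z : O := (c * c) • d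
  let v : SuperVec E O := ⟨(-c * t) * u.x + (c * s) * w.x - β (w.x • u.o - u.x • w.o) z,
    (-c * t) * u.y + (c * s) * w.y - β (w.y • u.o - u.y • w.o) z,
    (-c * t) • u.o + (c * s) • w.o + (u.x * w.y - u.y * w.x + 2 * β u.o w.o) • z⟩
  have huv : osp β u v = s := by
    simp only [osp, v, map_add, map_sub, map_smul, LinearMap.sub_apply,
      LinearMap.smul_apply, smul_eq_mul, h1, z]
    rw [hu] at hc
    linear_combination s * hc + 2 * c ^ 2 * h4d
  have hwv : osp β w v = t := by
    simp only [osp, v, map_add, map_sub, map_smul, LinearMap.sub_apply,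
      LinearMap.smul_apply, smul_eq_mul, h2, h3, z]
    rw [hu] at hc
    linear_combination t * hc + 2 * c ^ 2 * h5d
  refine ⟨v, huv, hwv, ?_⟩
  have hc2 : c * c * ((u.x * w.y - u.y * w.x) * (u.x * w.y - u.y * w.x + 2 * β u.o w.o)) = 1 := by
    rw [hu] at hc
    linear_combination (c * (u.x * w.y - u.y * w.x + β u.o w.o) + 1) * hc - c ^ 2 * h6
  rw [hu] at hc
  rw [oddDet, osp_swap hβ u v, huv, hwv, hu]
  simp only [v, z]
  linear_combination (norm := module) - t • congrArg (· • u.o) hc + s • congrArg (· • w.o) hc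
    + congrArg (· • d) hc2 + (c * t) • h4 - (c * s) • h5

/-- An alternating form on odd elements, with values in the even ones, which behaves like the
multiplication of a supercommutative algebra. -/
structure OddPairing (E O : Type*) [CommRing E] [AddCommGroup O] [Module E O] where
  β : O →ₗ[E] O →ₗ[E] E
  alt : ∀ x, β x x = 0
  assoc : ∀ x y z, β x y • z = β y z • x

/-- Skew pairings together with odd invariants of triples, satisfying the Plücker relations of
a configuration of vectors in the super plane. -/
structure SuperFrame (V : Type*) {E O : Type*} [CommRing E] [AddCommGroup O] [Module E O]
    (P : OddPairing E O) where
  ν : V → V → E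
  D : V → V → V → O
  ν_swap : ∀ u v, ν v u = - ν u v
  D_swap_left : ∀ u v w, D v u w = - D u v w
  D_swap_right : ∀ u v w, D u w v = - D u v w
  plucker : ∀ p j r l, ν p r • D p j l = ν p l • D p j r + ν p j • D p r l
  ptolemy : ∀ p j r l, ν p r * (ν p r * ν j l) =
    ν p r * (ν p j * ν r l + ν p l * ν j r) - P.β (D p j r) (D p r l)

omit hβ hβc in
/-- The frame of a family of vectors of the super plane. -/
def SuperFrame.ofVec {V : Type*} (P : OddPairing E O) (x : V → SuperVec E O) :
    SuperFrame V P where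
  ν u v := osp P.β (x u) (x v)
  D u v w := oddDet P.β (x u) (x v) (x w)
  ν_swap _ _ := osp_swap P.alt _ _
  D_swap_left _ _ _ := oddDet_swap_left P.alt _ _ _
  D_swap_right _ _ _ := oddDet_swap_right P.alt P.assoc _ _ _
  plucker _ _ _ _ := oddDet_plucker P.alt P.assoc _ _ _ _
  ptolemy _ _ _ _ := osp_ptolemy P.alt P.assoc _ _ _ _

end SuperPlane

/-- A realisation of an odd pairing inside a (noncommutative) ring, whose even part contains
the centre. -/
structure SuperHull (A : Type*) [Ring A] {E O : Type*} [CommRing E] [AddCommGroup O]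
    [Module E O] (P : OddPairing E O) where
  ι : E →+* A
  κ : O →+ A
  ι_inj : Function.Injective ι
  κ_inj : Function.Injective κ
  smul_left : ∀ e x, κ (e • x) = ι e * κ x
  smul_right : ∀ e x, κ (e • x) = κ x * ι e
  mul_odd : ∀ x y, κ x * κ y = ι (P.β x y)
  center : ∀ z : A, (∀ x, z * x = x * z) → ∃ e, ι e = z

section Hull

variable {A : Type*} [Ring A] (Θ : Set A)

/-- The even part of the hull of a set of odd elements. -/
abbrev evenPart : Subring (Subring.centralizer Θ) := Subring.center _

/-- The odd part of the hull of a set of odd elements. -/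
abbrev oddPart : Submodule (evenPart Θ) A := Submodule.span _ Θ

lemma evenPart_smul (e : evenPart Θ) (x : A) : e • x = (e : A) * x := rfl

lemma evenPart_comm_odd (e : evenPart Θ) {x : A} (hx : x ∈ oddPart Θ) :
    x * (e : A) = (e : A) * x := by
  induction hx using Submodule.span_induction with
  | mem x hx => exact (Subring.mem_centralizer_iff.1 e.1.2) x hx
  | zero => simp
  | add x y _ _ h1 h2 => rw [add_mul, mul_add, h1, h2]
  | smul f x _ h =>
    rw [evenPart_smul, mul_assoc, h, ← mul_assoc, ← mul_assoc]
    congr 1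
    have := congrArg (fun z : Subring.centralizer Θ => (z : A))
      ((Subring.mem_center_iff.1 e.2) f.1)
    simpa using this

variable {Θ} (hΘ : ∀ x ∈ Θ, ∀ y ∈ Θ, x * y = - (y * x))
include hΘ

lemma oddPart_anticomm {x y : A} (hx : x ∈ oddPart Θ) (hy : y ∈ oddPart Θ) :
    x * y = - (y * x) := by
  have key : ∀ x ∈ Θ, ∀ y ∈ oddPart Θ, x * y = - (y * x) := by
    intro x hx y hy
    induction hy using Submodule.span_induction with
    | mem y hy => exact hΘ x hx y hy
    | zero => simp
    | add y z _ _ h1 h2 => rw [add_mul, mul_add, h1, h2]; abel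
    | smul f y _ h =>
      rw [evenPart_smul, ← mul_assoc, evenPart_comm_odd Θ f (Submodule.subset_span hx),
        mul_assoc, h, mul_assoc, mul_neg]
  induction hx using Submodule.span_induction with
  | mem x hx => exact key x hx y hy
  | zero => simp
  | add x z _ _ h1 h2 => rw [add_mul, mul_add, h1, h2]; abel
  | smul f x _ h =>
    rw [evenPart_smul, ← mul_assoc y, evenPart_comm_odd Θ f hy, mul_assoc, h, mul_assoc, mul_neg]

lemma mul_mem_evenPart {x y : A} (hx : x ∈ oddPart Θ) (hy : y ∈ oddPart Θ) :
    ∃ e : evenPart Θ, (e : A) = x * y := by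
  have h1 : x * y ∈ Subring.centralizer Θ := by
    rw [Subring.mem_centralizer_iff]
    intro g hg
    have hg := Submodule.subset_span (R := evenPart Θ) hg
    rw [← mul_assoc, oddPart_anticomm hΘ hg hx, neg_mul, mul_assoc, oddPart_anticomm hΘ hg hy,
      mul_neg, neg_neg, mul_assoc]
  refine ⟨⟨⟨_, h1⟩, ?_⟩, rfl⟩
  rw [Subring.mem_center_iff]
  intro g
  have hg : ∀ z ∈ oddPart Θ, z * (g : A) = (g : A) * z := by
    intro z hz
    induction hz using Submodule.span_induction with
    | mem z hz => exact (Subring.mem_centralizer_iff.1 g.2) z hz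
    | zero => simp
    | add x y _ _ h1 h2 => rw [add_mul, mul_add, h1, h2]
    | smul f x _ h =>
      rw [evenPart_smul, mul_assoc, h, ← mul_assoc, ← mul_assoc]
      congr 1
      have := congrArg (fun z : Subring.centralizer Θ => (z : A))
        ((Subring.mem_center_iff.1 f.2) g)
      simpa using this.symm
  apply Subtype.ext
  simp only [Subring.coe_mul]
  rw [mul_assoc, hg y hy, ← mul_assoc, ← mul_assoc, hg x hx]

omit hΘ in
lemma exists_superHull.{u} {A : Type u} [Ring A] [Algebra ℚ A] {Θ : Set A}
    (hΘ : ∀ x ∈ Θ, ∀ y ∈ Θ, x * y = - (y * x)) : ∃ (E O : Type u) (_ : CommRing E) (_ : AddCommGroup O)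
    (_ : Module E O) (P : OddPairing E O) (H : SuperHull A P), ∀ θ ∈ Θ, ∃ x, H.κ x = θ := by
  choose f hf using fun (x y : oddPart Θ) => mul_mem_evenPart hΘ x.2 y.2
  have inj : ∀ e e' : evenPart Θ, (e : A) = (e' : A) → e = e' := fun e e' h =>
    Subtype.ext (Subtype.ext h)
  have sq : ∀ x : oddPart Θ, (x : A) * x = 0 := fun x => by
    have h := oddPart_anticomm hΘ x.2 x.2
    have h2 : (2 : ℚ) • ((x : A) * x) = 0 := by
      rw [two_smul]; nth_rewrite 1 [h]; simp
    simpa using h2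
  let β : oddPart Θ →ₗ[evenPart Θ] oddPart Θ →ₗ[evenPart Θ] evenPart Θ :=
    LinearMap.mk₂ _ f
      (fun x y z => inj _ _ (by simp [hf, add_mul]))
      (fun e x y => inj _ _ (by simp [hf, evenPart_smul, mul_assoc]))
      (fun x y z => inj _ _ (by simp [hf, mul_add]))
      (fun e x y => inj _ _ (by
        simp only [hf, evenPart_smul, SetLike.val_smul, smul_eq_mul, Subring.coe_mul]
        rw [← mul_assoc, evenPart_comm_odd Θ e x.2, mul_assoc]))
  have hβ : ∀ x y, ((β x y : evenPart Θ) : A) = (x : A) * y := hf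
  refine ⟨evenPart Θ, oddPart Θ, inferInstance, inferInstance, inferInstance,
    ⟨β, fun x => inj _ _ (by simp [hβ, sq]), fun x y z => Subtype.ext ?_⟩,
    ⟨(Subring.subtype _).comp (Subring.subtype _), (oddPart Θ).subtype.toAddMonoidHom, ?_, ?_,
      ?_, ?_, ?_, ?_⟩, ?_⟩
  · simp only [SetLike.val_smul, evenPart_smul, hβ]
    rw [← hβ y z, ← evenPart_comm_odd Θ _ x.2, hβ, mul_assoc]
  · exact fun e e' h => inj _ _ h
  · exact Subtype.val_injective
  · exact fun e x => rfl
  · exact fun e x => (evenPart_comm_odd Θ e x.2).symm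
  · exact fun x y => (hβ x y).symm
  · intro z hz
    refine ⟨⟨⟨z, Subring.mem_centralizer_iff.2 fun g _ => (hz g).symm⟩, ?_⟩, rfl⟩
    exact Subring.mem_center_iff.2 fun g => Subtype.ext (hz g).symm
  · exact fun θ hθ => ⟨⟨θ, Submodule.subset_span hθ⟩, rfl⟩

end Hull

section Cyclic

variable {N : ℕ}

/-- The three vertices occur in this cyclic (counterclockwise) order. -/
def Cyc (p j r : Fin N) : Prop :=
  (p.val < j.val ∧ j.val < r.val) ∨ (j.val < r.val ∧ r.val < p.val) ∨
    (r.val < p.val ∧ p.val < j.val)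

/-- The sign comparing two labels. -/
def χ (u v : Fin N) : ℤ := if u < v then 1 else -1

lemma Cyc.rot {p j r : Fin N} (h : Cyc p j r) : Cyc j r p := by
  unfold Cyc at *; omega

lemma Cyc.ne {p j r : Fin N} (h : Cyc p j r) : p ≠ j ∧ j ≠ r ∧ p ≠ r := by
  unfold Cyc at h; simp only [ne_eq, Fin.ext_iff]; omega

lemma Cyc.not_swap {p j r : Fin N} (h : Cyc p j r) : ¬ Cyc p r j := by
  unfold Cyc at *; omega

lemma cyc_or {p j r : Fin N} (h1 : p ≠ j) (h2 : j ≠ r) (h3 : p ≠ r) :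
    Cyc p j r ∨ Cyc p r j := by
  simp only [ne_eq, Fin.ext_iff] at *; unfold Cyc; omega

lemma crossE_iff {x y u v : Fin N} :
    crossE s(x, y) s(u, v) ↔ (Cyc x u y ∧ Cyc y v x) ∨ (Cyc x v y ∧ Cyc y u x) := by
  constructor
  · rintro ⟨p, q, r, t, h1, h2, h3, h | h⟩ <;>
    · simp only [Sym2.eq_iff] at h
      rw [Fin.lt_def] at h1 h2 h3
      obtain ⟨⟨rfl, rfl⟩ | ⟨rfl, rfl⟩, ⟨rfl, rfl⟩ | ⟨rfl, rfl⟩⟩ := h <;>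
      · unfold Cyc; omega
  · intro h
    have key : ∀ p q r t : Fin N, Cyc p q r → Cyc r t p → crossE s(p, r) s(q, t) := by
      intro p q r t h1 h2
      unfold Cyc at h1 h2
      rcases h1 with h1 | h1 | h1
      · rcases h2 with h2 | h2 | h2
        · omega
        · exact ⟨t, p, q, r, by rw [Fin.lt_def]; omega, by rw [Fin.lt_def]; omega,
            by rw [Fin.lt_def]; omega, Or.inr ⟨Sym2.eq_swap, rfl⟩⟩
        · exact ⟨p, q, r, t, by rw [Fin.lt_def]; omega, by rw [Fin.lt_def]; omega,
            by rw [Fin.lt_def]; omega, Or.inl ⟨rfl, rfl⟩⟩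
      · exact ⟨q, r, t, p, by rw [Fin.lt_def]; omega, by rw [Fin.lt_def]; omega,
            by rw [Fin.lt_def]; omega, Or.inr ⟨rfl, Sym2.eq_swap⟩⟩
      · exact ⟨r, t, p, q, by rw [Fin.lt_def]; omega, by rw [Fin.lt_def]; omega,
            by rw [Fin.lt_def]; omega, Or.inl ⟨Sym2.eq_swap, Sym2.eq_swap⟩⟩
    rcases h with ⟨h1, h2⟩ | ⟨h1, h2⟩
    · exact key _ _ _ _ h1 h2
    · rw [Sym2.eq_swap (a := u)]; exact key _ _ _ _ h1 h2

lemma crossE_comm {e f : Edg N} : crossE e f ↔ crossE f e := by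
  constructor <;>
  · rintro ⟨p, q, r, t, h1, h2, h3, h⟩
    exact ⟨p, q, r, t, h1, h2, h3, h.symm⟩

lemma χ_swap {u v : Fin N} (h : u ≠ v) : χ v u = - χ u v := by
  rcases lt_or_gt_of_ne h with h | h <;> simp [χ, h, not_lt.2 h.le]

lemma χ_sq (u v : Fin N) : χ u v * χ u v = 1 := by unfold χ; split_ifs <;> rfl

lemma χ_cases (u v : Fin N) : (u.val < v.val ∧ χ u v = 1) ∨ (v.val ≤ u.val ∧ χ u v = -1) := by
  by_cases h : u < v
  · exact Or.inl ⟨h, by simp [χ, h]⟩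
  · exact Or.inr ⟨not_lt.1 h, by simp [χ, h]⟩

lemma Cyc.χ_mul {p j r : Fin N} (h : Cyc p j r) : χ p j * χ j r * χ r p = -1 := by
  unfold Cyc at h
  rcases χ_cases p j with ⟨h1, e1⟩ | ⟨h1, e1⟩ <;> rcases χ_cases j r with ⟨h2, e2⟩ | ⟨h2, e2⟩ <;>
  rcases χ_cases r p with ⟨h3, e3⟩ | ⟨h3, e3⟩ <;> rw [e1, e2, e3] <;> first | rfl | omega

lemma Cyc.χ_left {p j r l : Fin N} (h : Cyc p j r) (h' : Cyc p r l) :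
    χ j l = χ p j * χ p l := by
  have h1 := h.rot.χ_mul
  unfold Cyc at h h'
  rcases χ_cases p j with ⟨h1, e1⟩ | ⟨h1, e1⟩ <;> rcases χ_cases j l with ⟨h2, e2⟩ | ⟨h2, e2⟩ <;>
  rcases χ_cases p l with ⟨h3, e3⟩ | ⟨h3, e3⟩ <;> rw [e1, e2, e3] <;> first | rfl | omega

variable [NeZero N]

lemma not_crossE_of_isBnd {e f : Edg N} (he : isBnd e) : ¬ crossE e f := by
  obtain ⟨i, rfl⟩ := he
  induction f using Sym2.ind with | _ u v
  rw [crossE_iff]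
  have hi : (i + 1 : Fin N).val = i.val + 1 ∨ (i.val + 1 = N ∧ (i + 1 : Fin N).val = 0) := by
    have h0 := i.isLt
    have h1 : (i + 1 : Fin N).val = (i.val + 1 % N) % N := rfl
    rw [h1, Nat.add_mod_mod]
    rcases Nat.lt_or_ge (i.val + 1) N with h2 | h2
    · exact Or.inl (Nat.mod_eq_of_lt h2)
    · have h3 : i.val + 1 = N := by omega
      exact Or.inr ⟨h3, by rw [h3, Nat.mod_self]⟩
  have := u.isLt
  have := v.isLt
  unfold Cyc
  omega

lemma isEdgeOf.not_crossE {D : Finset (Edg N)} (hD : ∀ e ∈ D, ∀ f ∈ D, ¬ crossE e f)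
    {e f : Edg N} (he : isEdgeOf D e) (hf : isEdgeOf D f) : ¬ crossE e f := by
  rcases he with he | he
  · exact not_crossE_of_isBnd he
  rcases hf with hf | hf
  · rw [crossE_comm]; exact not_crossE_of_isBnd hf
  · exact hD e he f hf

lemma isTri_insert {D : Finset (Edg N)} {x y z : Fin N} (hxy : x ≠ y) (hyz : y ≠ z) (hxz : x ≠ z) :
    IsTri D {x, y, z} ↔ isEdgeOf D s(x, y) ∧ isEdgeOf D s(y, z) ∧ isEdgeOf D s(x, z) := by
  have hc : ({x, y, z} : Finset (Fin N)).card = 3 := Finset.card_eq_three.2 ⟨x, y, z, hxy, hxz, hyz, rfl⟩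
  constructor
  · rintro ⟨-, h⟩
    exact ⟨h x (by simp) y (by simp) hxy, h y (by simp) z (by simp) hyz, h x (by simp) z (by simp) hxz⟩
  · rintro ⟨h1, h2, h3⟩
    refine ⟨hc, fun u hu v hv huv => ?_⟩
    simp only [Finset.mem_insert, Finset.mem_singleton] at hu hv
    rcases hu with rfl | rfl | rfl <;> rcases hv with rfl | rfl | rfl <;>
      first | exact absurd rfl huv | assumption | (rw [Sym2.eq_swap]; assumption)

/-- An edge bounds at most one triangle on each side. -/
lemma isTri_unique {D : Finset (Edg N)} (hD : ∀ e ∈ D, ∀ f ∈ D, ¬ crossE e f) {x y y' z : Fin N}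
    (h : Cyc x y z) (h' : Cyc x y' z) (ht : IsTri D {x, y, z}) (ht' : IsTri D {x, y', z}) :
    y = y' := by
  rw [isTri_insert h.ne.1 h.ne.2.1 h.ne.2.2] at ht
  rw [isTri_insert h'.ne.1 h'.ne.2.1 h'.ne.2.2] at ht'
  have c1 := isEdgeOf.not_crossE hD ht.1 ht'.2.1
  have c2 := isEdgeOf.not_crossE hD ht'.1 ht.2.1
  rw [crossE_iff] at c1 c2
  by_contra hne
  rcases cyc_or h.ne.1 hne h'.ne.1 with h1 | h1
  · exact c2 (Or.inl ⟨h1, h'.rot⟩)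
  · exact c1 (Or.inl ⟨h1, h.rot⟩)

lemma finset_rot {α : Type*} [DecidableEq α] (x y z : α) :
    ({x, y, z} : Finset α) = {y, z, x} := by
  ext; simp; tauto

lemma finset_swap {α : Type*} [DecidableEq α] (x y z : α) :
    ({x, y, z} : Finset α) = {x, z, y} := by
  ext; simp; tauto

omit [NeZero N] in
lemma Cyc.eq_of_finset_eq {x y z p j r : Fin N} (h : Cyc x y z) (h' : Cyc p j r)
    (he : ({x, y, z} : Finset (Fin N)) = {p, j, r}) :
    (x = p ∧ y = j ∧ z = r) ∨ (x = j ∧ y = r ∧ z = p) ∨ (x = r ∧ y = p ∧ z = j) := by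
  have hx : x ∈ ({p, j, r} : Finset (Fin N)) := he ▸ by simp
  have hy : y ∈ ({p, j, r} : Finset (Fin N)) := he ▸ by simp
  have hz : z ∈ ({p, j, r} : Finset (Fin N)) := he ▸ by simp
  simp only [Finset.mem_insert, Finset.mem_singleton, Fin.ext_iff] at *
  unfold Cyc at *
  omega

end Cyclic

/-- A multiplicative cone of units of a commutative ring with a coherent choice of square roots. -/
structure EvenCone (E : Type*) [CommRing E] where
  Pos : Set E
  sqrt : E → E
  add_mem : ∀ p ∈ Pos, ∀ q ∈ Pos, p + q ∈ Pos
  mul_mem : ∀ p ∈ Pos, ∀ q ∈ Pos, p * q ∈ Pos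
  exists_inv : ∀ p ∈ Pos, ∃ q ∈ Pos, q * p = 1
  sqrt_sq : ∀ p ∈ Pos, sqrt p * sqrt p = p
  sqrt_mem : ∀ p ∈ Pos, sqrt p ∈ Pos
  sqrt_mul : ∀ p ∈ Pos, ∀ q ∈ Pos, sqrt (p * q) = sqrt p * sqrt q

section FlipAlgebra

variable {E O : Type*} [CommRing E] [AddCommGroup O] [Module E O] (C : EvenCone E)

lemma EvenCone.smul_cancel {p : E} (hp : p ∈ C.Pos) {M : Type*} [AddCommGroup M] [Module E M]
    {x y : M} (h : p • x = p • y) : x = y := by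
  obtain ⟨q, -, hq⟩ := C.exists_inv p hp
  have := congrArg (q • ·) h
  simpa [smul_smul, hq] using this

lemma EvenCone.sqrt_smul {X Y n : E} (hX : X ∈ C.Pos) (hY : Y ∈ C.Pos) (h : X = Y + n) {m : O}
    (hm : n • m = 0) : C.sqrt X • m = C.sqrt Y • m := by
  apply C.smul_cancel (C.add_mem _ (C.sqrt_mem X hX) _ (C.sqrt_mem Y hY))
  have h1 := (C.sqrt_sq X hX).trans h
  have h2 := C.sqrt_sq Y hY
  linear_combination (norm := module) congrArg (· • m) h1 - congrArg (· • m) h2 + hm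

variable {V : Type*} {P : OddPairing E O} (F : SuperFrame V P)

lemma flip_odd {p j r l : V} {a b c d L J n q xl xj η₁ η₂ : E} {θ σ m : O}
    (ha : a ∈ C.Pos) (hb : b ∈ C.Pos) (hc : c ∈ C.Pos) (hd : d ∈ C.Pos) (hL : L ∈ C.Pos)
    (hJ : J ∈ C.Pos) (hpl : F.ν p l = xl * d) (hpj : F.ν p j = xj * a) (hpr : F.ν p r = q * L)
    (hη₁ : η₁ * η₁ = 1) (hη₂ : η₂ * η₂ = 1)
    (h₁ : (C.sqrt a * C.sqrt b * C.sqrt L) • θ = η₁ • F.D p j r)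
    (h₂ : (C.sqrt c * C.sqrt d * C.sqrt L) • σ = η₂ • F.D p r l)
    (hX : L * J = a * c + b * d + n) (hn₁ : n • θ = 0) (hn₂ : n • σ = 0)
    (hm : C.sqrt (a * c + b * d) • m = C.sqrt (b * d) • θ + C.sqrt (a * c) • σ)
    (hrel : xl * η₁ = xj * η₂) (hxl : xl * xl = 1) :
    (C.sqrt a * C.sqrt J * C.sqrt d) • m = (q * xl * η₁) • F.D p j l := by
  have hac := C.mul_mem _ ha _ hc
  have hbd := C.mul_mem _ hb _ hd
  have hY := C.add_mem _ hac _ hbd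
  have hnm : n • m = 0 := by
    apply C.smul_cancel (C.sqrt_mem _ hY)
    linear_combination (norm := module) n • hm + C.sqrt (b * d) • hn₁ + C.sqrt (a * c) • hn₂
  have hs := C.sqrt_smul (C.mul_mem _ hL _ hJ) hY hX hnm
  rw [hm, C.sqrt_mul _ hL _ hJ, C.sqrt_mul _ hb _ hd, C.sqrt_mul _ ha _ hc] at hs
  have hD := F.plucker p j r l
  rw [hpl, hpj, hpr] at hD
  have sa := C.sqrt_sq a ha
  have sd := C.sqrt_sq d hd
  have sL := C.sqrt_sq L hL
  have e₁ : F.D p j r = (η₁ * (C.sqrt a * C.sqrt b * C.sqrt L)) • θ := by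
    rw [mul_smul, h₁, smul_smul, hη₁, one_smul]
  have e₂ : F.D p r l = (η₂ * (C.sqrt c * C.sqrt d * C.sqrt L)) • σ := by
    rw [mul_smul, h₂, smul_smul, hη₂, one_smul]
  rw [e₁, e₂] at hD
  apply C.smul_cancel hL
  have key : L • ((q * xl * η₁) • F.D p j l) = (xl * η₁) • ((q * L) • F.D p j l) := by module
  rw [key, hD]
  have hd' : xl * d * (η₁ * (C.sqrt a * C.sqrt b * C.sqrt L)) =
    (xl * η₁) * (C.sqrt d * C.sqrt d) * C.sqrt a * C.sqrt b * C.sqrt L := by rw [sd]; ring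
  have ha' : xj * a * (η₂ * (C.sqrt c * C.sqrt d * C.sqrt L)) =
    (xl * η₁) * (C.sqrt a * C.sqrt a) * C.sqrt c * C.sqrt d * C.sqrt L := by rw [sa, hrel]; ring
  rw [smul_smul (xl * d), smul_smul (xj * a), hd', ha']
  have hsq : (xl * η₁) * (xl * η₁) = 1 := by linear_combination η₁ * η₁ * hxl + hη₁
  linear_combination (norm := skip) (C.sqrt L * C.sqrt a * C.sqrt d) • hs
    - congrArg (· • ((C.sqrt a * C.sqrt J * C.sqrt d) • m)) sL
    - congrArg (· • ((C.sqrt L * C.sqrt a * C.sqrt d) •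
      ((C.sqrt b * C.sqrt d) • θ + (C.sqrt a * C.sqrt c) • σ))) hsq
  module

lemma flip_even {p j r l : V} {a b c d L J q w xl xj xr xb η₁ η₂ : E} {θ σ : O}
    (ha : a ∈ C.Pos) (hb : b ∈ C.Pos) (hc : c ∈ C.Pos) (hd : d ∈ C.Pos) (hL : L ∈ C.Pos)
    (hpl : F.ν p l = xl * d) (hpj : F.ν p j = xj * a) (hpr : F.ν p r = q * L)
    (hjl : F.ν j l = w * J) (hrl : F.ν r l = xr * c) (hjr : F.ν j r = xb * b)
    (hq : q * q = 1) (hw : w * w = 1) (hη₁ : η₁ * η₁ = 1) (hη₂ : η₂ * η₂ = 1)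
    (h₁ : (C.sqrt a * C.sqrt b * C.sqrt L) • θ = η₁ • F.D p j r)
    (h₂ : (C.sqrt c * C.sqrt d * C.sqrt L) • σ = η₂ • F.D p r l)
    (e₁ : q * w * xj * xr = 1) (e₂ : q * w * xl * xb = 1) (e₃ : w * η₁ * η₂ = 1) :
    L * J = a * c + b * d + C.sqrt (a * b * c * d) * P.β σ θ := by
  have hs : C.sqrt (a * b * c * d) = C.sqrt a * C.sqrt b * C.sqrt c * C.sqrt d := by
    rw [C.sqrt_mul _ (C.mul_mem _ (C.mul_mem _ ha _ hb) _ hc) _ hd,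
      C.sqrt_mul _ (C.mul_mem _ ha _ hb) _ hc, C.sqrt_mul _ ha _ hb]
  have sL := C.sqrt_sq L hL
  have f₁ : F.D p j r = (η₁ * (C.sqrt a * C.sqrt b * C.sqrt L)) • θ := by
    rw [mul_smul, h₁, smul_smul, hη₁, one_smul]
  have f₂ : F.D p r l = (η₂ * (C.sqrt c * C.sqrt d * C.sqrt L)) • σ := by
    rw [mul_smul, h₂, smul_smul, hη₂, one_smul]
  have h := F.ptolemy p j r l
  rw [f₁, f₂, hpl, hpj, hpr, hjl, hrl, hjr] at h
  simp only [map_smul, LinearMap.smul_apply, smul_eq_mul] at h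
  have hβ := pairing_swap P.alt θ σ
  apply C.smul_cancel hL
  rw [hs, hβ]
  simp only [smul_eq_mul]
  linear_combination w * h - L * L * J * (q * q * hw + hq) + L * a * c * e₁ + L * b * d * e₂
    - L * C.sqrt a * C.sqrt b * C.sqrt c * C.sqrt d * P.β θ σ * e₃
    - w * η₁ * η₂ * C.sqrt a * C.sqrt b * C.sqrt c * C.sqrt d * P.β θ σ * sL

end FlipAlgebra

section States

variable {A : Type*} [Ring A] {E O : Type*} [CommRing E] [AddCommGroup O] [Module E O]
  {P : OddPairing E O} (H : SuperHull A P)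

/-- A cone in the even part lifting a cone of central elements. -/
structure EvenCone.Lifts (C : EvenCone E) (Pos : Set A) (sqrt : A → A) : Prop where
  mem_iff : ∀ e, e ∈ C.Pos ↔ H.ι e ∈ Pos
  exists_lift : ∀ p ∈ Pos, ∃ e ∈ C.Pos, H.ι e = p
  map_sqrt : ∀ e ∈ C.Pos, H.ι (C.sqrt e) = sqrt (H.ι e)

include H in
lemma exists_evenCone (Pos : Set A) (sqrt : A → A)
    (hPosAdd : ∀ p ∈ Pos, ∀ q ∈ Pos, p + q ∈ Pos)
    (hPosMul : ∀ p ∈ Pos, ∀ q ∈ Pos, p * q ∈ Pos)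
    (hPosInv : ∀ p ∈ Pos, Ring.inverse p ∈ Pos)
    (hPosCentral : ∀ p ∈ Pos, ∀ x : A, p * x = x * p)
    (hPosUnit : ∀ p ∈ Pos, IsUnit p)
    (hsqrtSq : ∀ p ∈ Pos, sqrt p * sqrt p = p)
    (hsqrtMem : ∀ p ∈ Pos, sqrt p ∈ Pos)
    (hsqrtMul : ∀ p ∈ Pos, ∀ q ∈ Pos, sqrt (p * q) = sqrt p * sqrt q) :
    ∃ C : EvenCone E, C.Lifts H Pos sqrt := by
  classical
  have lift : ∀ p ∈ Pos, ∃ e, H.ι e = p := fun p hp => H.center p (hPosCentral p hp)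
  have ex : ∀ e : E, ∃ f, H.ι e ∈ Pos → H.ι f = sqrt (H.ι e) := fun e => by
    by_cases h : H.ι e ∈ Pos
    · exact (lift _ (hsqrtMem _ h)).imp fun f hf _ => hf
    · exact ⟨0, fun h' => absurd h' h⟩
  choose s hs using ex
  refine ⟨⟨{e | H.ι e ∈ Pos}, s, ?_, ?_, ?_, ?_, ?_, ?_⟩, ?_, ?_, ?_⟩
  · intro p hp q hq; simpa using hPosAdd _ hp _ hq
  · intro p hp q hq; simpa using hPosMul _ hp _ hq
  · intro p hp
    obtain ⟨q, hq⟩ := lift _ (hPosInv _ hp)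
    refine ⟨q, by simpa [hq] using hPosInv _ hp, H.ι_inj ?_⟩
    rw [map_mul, hq, map_one, Ring.inverse_mul_cancel _ (hPosUnit _ hp)]
  · intro p hp
    exact H.ι_inj (by rw [map_mul, hs p hp, hsqrtSq _ hp])
  · intro p hp
    simpa [hs p hp] using hsqrtMem _ hp
  · intro p hp q hq
    apply H.ι_inj
    rw [map_mul, hs p hp, hs q hq, ← hsqrtMul _ hp _ hq, ← map_mul]
    exact hs _ (by simpa using hPosMul _ hp _ hq)
  · exact fun e => Iff.rfl
  · intro p hp
    obtain ⟨e, he⟩ := lift p hp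
    exact ⟨e, by simpa [he] using hp, he⟩
  · exact fun e he => hs e he

variable {N : ℕ} [NeZero N] (C : EvenCone E) (F : SuperFrame (Fin N) P)

/-- The length attached to a pair of vertices by a frame. -/
def SuperFrame.ell (u v : Fin N) : E := (χ u v : E) * F.ν u v

/-- The sign of an edge orientation relative to a direction. -/
def sgn (o : Edg N → Bool) (u v : Fin N) : ℤ := χ u v * if o s(u, v) then 1 else -1

/-- The product of the square roots of the side lengths of a triangle. -/
def triRoot (p j r : Fin N) : E :=
  C.sqrt (F.ell p j) * C.sqrt (F.ell j r) * C.sqrt (F.ell p r)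

/-- A state is given by a frame, up to signs `η` of the triangles determining the spin
structure. -/
structure Realizes (η : Finset (Fin N) → ℤ) (st : PState A N) : Prop where
  noncross : ∀ e ∈ st.diag, ∀ f ∈ st.diag, ¬ crossE e f
  lam : ∀ u v, u ≠ v → isEdgeOf st.diag s(u, v) →
    F.ell u v ∈ C.Pos ∧ st.lam s(u, v) = H.ι (F.ell u v)
  mu : ∀ p j r, Cyc p j r → IsTri st.diag {p, j, r} →
    ∃ m, st.mu {p, j, r} = H.κ m ∧ triRoot C F p j r • m = (η {p, j, r} : E) • F.D p j r
  eta : ∀ t, η t * η t = 1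
  ori : ∀ p j r l, Cyc p j r → Cyc p r l → s(p, r) ∈ st.diag → IsTri st.diag {p, j, r} →
    IsTri st.diag {p, r, l} → sgn st.ori p r = χ j l * η {p, j, r} * η {p, r, l}

/-- A flip, described so that the flipped diagonal is oriented from `p` to `r`. -/
structure NormFlip (Pos : Set A) (sqrt : A → A) (st st' : PState A N) (p j r l : Fin N) :
    Prop where
  left : Cyc p j r
  right : Cyc p r l
  mem : s(p, r) ∈ st.diag
  tri_left : IsTri st.diag {p, j, r}
  tri_right : IsTri st.diag {p, r, l}
  diag : st'.diag = insert s(j, l) (st.diag.erase s(p, r))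
  ori : sgn st.ori p r = 1
  lam : st.lam s(p, r) * st'.lam s(j, l) =
    st.lam s(p, j) * st.lam s(r, l) + st.lam s(j, r) * st.lam s(l, p) +
      sqrt (st.lam s(p, j) * st.lam s(j, r) * st.lam s(r, l) * st.lam s(l, p)) *
        (st.mu {p, r, l} * st.mu {p, j, r})
  pos : st'.lam s(j, l) ∈ Pos
  mu_left : st'.mu {p, j, l} *
      sqrt (st.lam s(p, j) * st.lam s(r, l) + st.lam s(j, r) * st.lam s(l, p)) =
    st.mu {p, j, r} * sqrt (st.lam s(j, r) * st.lam s(l, p)) +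
      st.mu {p, r, l} * sqrt (st.lam s(p, j) * st.lam s(r, l))
  mu_right : st'.mu {j, r, l} *
      sqrt (st.lam s(p, j) * st.lam s(r, l) + st.lam s(j, r) * st.lam s(l, p)) =
    st.mu {p, r, l} * sqrt (st.lam s(j, r) * st.lam s(l, p)) -
      st.mu {p, j, r} * sqrt (st.lam s(p, j) * st.lam s(r, l))
  lam_of_ne : ∀ e, e ≠ s(j, l) → st'.lam e = st.lam e
  mu_of_ne : ∀ t, t ≠ {p, j, l} → t ≠ {j, r, l} → st'.mu t = st.mu t
  ori_of_ne : ∀ e, e ≠ s(j, l) → e ≠ s(j, r) → st'.ori e = st.ori e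
  ori_side : st'.ori s(j, r) = ! st.ori s(j, r)
  ori_new : sgn st'.ori l j = 1

omit [NeZero N] in
lemma sgn_cases (o : Edg N → Bool) {u v : Fin N} (h : u ≠ v) :
    (sgn o u v = 1 ∧ sgn o v u = -1) ∨ (sgn o u v = -1 ∧ sgn o v u = 1) := by
  unfold sgn
  rw [Sym2.eq_swap, χ_swap h]
  rcases χ_cases u v with ⟨-, e⟩ | ⟨-, e⟩ <;> rw [e] <;> split_ifs <;> simp

lemma Flip.normForm {Pos : Set A} {sqrt : A → A} {st st' : PState A N}
    (h : Flip Pos sqrt st st') : ∃ p j r l, NormFlip Pos sqrt st st' p j r l := by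
  obtain ⟨p, j, r, l, hpj, hjr, hl, hmem, ht1, ht2, hD, h⟩ := h
  have c1 : Cyc p j r := Or.inl ⟨hpj, hjr⟩
  have c2 : Cyc p r l := by
    unfold Cyc
    simp only [Fin.lt_def] at *
    omega
  have hpr : p < r := hpj.trans hjr
  have hlj : l ≠ j := by
    rintro rfl
    rcases hl with h | h
    · exact absurd hpj h.asymm
    · exact absurd hjr h.asymm
  cases ho : st.ori s(p, r)
  · simp only [ho, Bool.false_eq_true, if_false] at h
    obtain ⟨h1, h2, h3, h4, h5, h6, h7, h8, h9⟩ := h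
    refine ⟨r, l, p, j, ⟨c2.rot, c1.rot.rot, ?_, ?_, ?_, ?_, ?_, ?_, ?_, ?_, ?_, ?_, ?_, ?_, ?_, ?_⟩⟩
    · rwa [Sym2.eq_swap]
    · rwa [finset_rot, finset_rot]
    · rwa [finset_rot]
    · rw [hD, Sym2.eq_swap (a := l), Sym2.eq_swap (a := r)]
    · rw [sgn, Sym2.eq_swap, ho]; simp [χ, hpr.not_gt]
    · rw [Sym2.eq_swap (a := r) (b := p), Sym2.eq_swap (a := l) (b := j),
        finset_rot r p j, finset_rot r l p, finset_rot l p r]; exact h1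
    · rwa [Sym2.eq_swap]
    · rw [finset_rot r l j, finset_rot l j r, finset_rot r l p, finset_rot l p r,
        finset_rot r p j]; exact h3
    · rw [finset_rot l p j, finset_rot r l p, finset_rot l p r, finset_rot r p j]; exact h4
    · rw [Sym2.eq_swap]; exact h5
    · rw [finset_rot r l j, finset_rot l j r, finset_rot l p j]; exact h6
    · rw [Sym2.eq_swap (a := l) (b := j)]; exact h7
    · exact h8
    · rw [sgn, h9]
      rcases lt_or_gt_of_ne hlj with h | h <;> simp [χ, h, h.not_gt]
  · simp only [ho, if_true] at h
    obtain ⟨h1, h2, h3, h4, h5, h6, h7, h8, h9⟩ := h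
    refine ⟨p, j, r, l, ⟨c1, c2, hmem, ht1, ht2, hD, ?_, h1, h2, h3, h4, h5, h6, h7, h8, ?_⟩⟩
    · rw [sgn, ho]; simp [χ, hpr]
    · rw [sgn, Sym2.eq_swap, h9]
      rcases lt_or_gt_of_ne hlj with h | h <;> simp [χ, h, h.not_gt]

end States

section Step

variable {A : Type*} [Ring A] {E O : Type*} [CommRing E] [AddCommGroup O] [Module E O]
  {P : OddPairing E O} {H : SuperHull A P}
  {N : ℕ} [NeZero N] {C : EvenCone E} {F : SuperFrame (Fin N) P}

lemma not_crossE_new {D : Finset (Edg N)} (hD : ∀ e ∈ D, ∀ f ∈ D, ¬ crossE e f) {p j r l : Fin N}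
    (h1 : Cyc p j r) (h2 : Cyc p r l) (t1 : IsTri D {p, j, r}) (t2 : IsTri D {p, r, l})
    {e : Edg N} (he : isEdgeOf D e) (hne : e ≠ s(p, r)) : ¬ crossE s(j, l) e := by
  rw [isTri_insert h1.ne.1 h1.ne.2.1 h1.ne.2.2] at t1
  rw [isTri_insert h2.ne.1 h2.ne.2.1 h2.ne.2.2] at t2
  have key : ∀ x y, isEdgeOf D s(x, y) → s(x, y) ≠ s(p, r) → ¬ (Cyc j x l ∧ Cyc l y j) := by
    rintro x y he hne ⟨hx, hy⟩
    have n1 := fun z w (h : isEdgeOf D s(z, w)) => isEdgeOf.not_crossE hD h he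
    simp only [crossE_iff] at n1
    have hjrl : Cyc j r l := by unfold Cyc at *; omega
    by_cases hxr : x = r
    · subst hxr
      by_cases hyp : y = p
      · subst hyp; exact hne Sym2.eq_swap
      · rcases cyc_or hy.ne.1 hyp h2.ne.2.2.symm with h | h
        · exact n1 p l t2.2.2 (Or.inl ⟨h2, h⟩)
        · exact n1 p j t1.1 (Or.inr ⟨by unfold Cyc at *; omega, by unfold Cyc at *; omega⟩)
    · rcases cyc_or hx.ne.1 hxr h1.ne.2.1 with h | h
      · exact n1 j r t1.2.1 (Or.inl ⟨h, by unfold Cyc at *; omega⟩)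
      · exact n1 r l t2.2.1 (Or.inl ⟨by unfold Cyc at *; omega, by unfold Cyc at *; omega⟩)
  induction e using Sym2.ind with | _ x y
  rw [crossE_iff]
  rintro (h | h)
  · exact key x y he hne h
  · exact key y x (by rwa [Sym2.eq_swap]) (by rwa [Sym2.eq_swap]) h

variable {Pos : Set A} {sqrt : A → A} {st st' : PState A N} {p j r l : Fin N}
  {η : Finset (Fin N) → ℤ}

lemma NormFlip.cyc₁ (h : NormFlip Pos sqrt st st' p j r l) : Cyc p j l := by
  have h1 := h.left; have h2 := h.right; unfold Cyc at *; omega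

lemma NormFlip.cyc₂ (h : NormFlip Pos sqrt st st' p j r l) : Cyc j r l := by
  have h1 := h.left; have h2 := h.right; unfold Cyc at *; omega

lemma NormFlip.mem_diag (h : NormFlip Pos sqrt st st' p j r l) {e : Edg N} :
    e ∈ st'.diag ↔ e = s(j, l) ∨ (e ≠ s(p, r) ∧ e ∈ st.diag) := by
  rw [h.diag, Finset.mem_insert, Finset.mem_erase]

lemma NormFlip.isEdgeOf (h : NormFlip Pos sqrt st st' p j r l) {e : Edg N}
    (he : isEdgeOf st'.diag e) : e = s(j, l) ∨ isEdgeOf st.diag e := by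
  rcases he with he | he
  · exact Or.inr (Or.inl he)
  · rw [h.mem_diag] at he
    exact he.imp id fun h => Or.inr h.2

lemma NormFlip.noncross (h : NormFlip Pos sqrt st st' p j r l)
    (hD : ∀ e ∈ st.diag, ∀ f ∈ st.diag, ¬ crossE e f) :
    ∀ e ∈ st'.diag, ∀ f ∈ st'.diag, ¬ crossE e f := by
  have key := @not_crossE_new _ _ _ hD _ _ _ _ h.left h.right h.tri_left h.tri_right
  intro e he f hf
  rw [h.mem_diag] at he hf
  rcases he with rfl | ⟨he, he'⟩ <;> rcases hf with rfl | ⟨hf, hf'⟩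
  · rw [crossE_iff]; unfold Cyc; omega
  · exact key (Or.inr hf') hf
  · rw [crossE_comm]; exact key (Or.inr he') he
  · exact hD _ he' _ hf'

/-- The signs of the triangles after a flip. -/
def flipSign (η : Finset (Fin N) → ℤ) (p j r l : Fin N) (t : Finset (Fin N)) : ℤ :=
  if t = {p, j, l} then η {p, j, r} * χ p l * χ p r
  else if t = {j, r, l} then η {p, r, l} * χ r j * χ r p else η t

omit [NeZero N] in
lemma flipSign_left (η : Finset (Fin N) → ℤ) (p j r l : Fin N) :
    flipSign η p j r l {p, j, l} = η {p, j, r} * χ p l * χ p r := if_pos rfl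

lemma NormFlip.sets_ne (h : NormFlip Pos sqrt st st' p j r l) :
    ({j, r, l} : Finset (Fin N)) ≠ {p, j, l} := by
  intro e
  rcases h.cyc₂.eq_of_finset_eq h.cyc₁ e with ⟨h1, -⟩ | ⟨-, h1, -⟩ | ⟨h1, -⟩
  · exact h.left.ne.1 h1.symm
  · exact h.right.ne.2.1 h1
  · exact h.cyc₁.ne.2.1 h1

lemma NormFlip.flipSign_right (h : NormFlip Pos sqrt st st' p j r l) :
    flipSign η p j r l {j, r, l} = η {p, r, l} * χ r j * χ r p := by
  rw [flipSign, if_neg h.sets_ne, if_pos rfl]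

/-- A triangle after a flip is one of the two new ones or was already there. -/
lemma NormFlip.isTri_cases (h : NormFlip Pos sqrt st st' p j r l)
    (hD : ∀ e ∈ st.diag, ∀ f ∈ st.diag, ¬ crossE e f) {x y z : Fin N} (hc : Cyc x y z)
    (ht : IsTri st'.diag {x, y, z}) :
    ({x, y, z} : Finset (Fin N)) = {p, j, l} ∨ ({x, y, z} : Finset (Fin N)) = {j, r, l} ∨
    (({x, y, z} : Finset (Fin N)) ≠ {p, j, l} ∧ ({x, y, z} : Finset (Fin N)) ≠ {j, r, l} ∧
      IsTri st.diag {x, y, z}) := by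
  by_cases e1 : ({x, y, z} : Finset (Fin N)) = {p, j, l}
  · exact Or.inl e1
  by_cases e2 : ({x, y, z} : Finset (Fin N)) = {j, r, l}
  · exact Or.inr (Or.inl e2)
  refine Or.inr (Or.inr ⟨e1, e2, ?_⟩)
  have hjl : s(j, l) ∈ st'.diag := h.mem_diag.2 (Or.inl rfl)
  have side : ∀ u v, s(u, v) = s(j, l) → ∀ w, Cyc u w v → IsTri st'.diag {u, w, v} →
      ({u, w, v} : Finset (Fin N)) = {p, j, l} ∨ ({u, w, v} : Finset (Fin N)) = {j, r, l} := by
    have t1 := (isTri_insert h.left.ne.1 h.left.ne.2.1 h.left.ne.2.2).1 h.tri_left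
    have t2 := (isTri_insert h.right.ne.1 h.right.ne.2.1 h.right.ne.2.2).1 h.tri_right
    have old : ∀ u v, SuperTeich.isEdgeOf st.diag s(u, v) → s(u, v) ≠ s(p, r) →
        SuperTeich.isEdgeOf st'.diag s(u, v) := by
      intro u v hu hne
      rcases hu with hu | hu
      · exact Or.inl hu
      · exact Or.inr (h.mem_diag.2 (Or.inr ⟨hne, hu⟩))
    have n1 := h.left.ne
    have n2 := h.right.ne
    have n3 := h.cyc₁.ne
    have n4 := h.cyc₂.ne
    intro u v huv w hw ht
    rw [Sym2.eq_iff] at huv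
    rcases huv with ⟨rfl, rfl⟩ | ⟨rfl, rfl⟩
    · right
      have : IsTri st'.diag {u, r, v} := by
        rw [isTri_insert n4.1 n4.2.1 n4.2.2]
        exact ⟨old _ _ t1.2.1 (by simp only [ne_eq, Sym2.eq_iff]; tauto),
          old _ _ t2.2.1 (by simp only [ne_eq, Sym2.eq_iff]; tauto), Or.inr hjl⟩
      rw [isTri_unique (h.noncross hD) hw h.cyc₂ ht this]
    · left
      have : IsTri st'.diag {u, p, v} := by
        rw [finset_rot, isTri_insert n3.1 n3.2.1 n3.2.2]
        exact ⟨old _ _ t1.1 (by simp only [ne_eq, Sym2.eq_iff]; tauto), Or.inr hjl,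
          old _ _ t2.2.2 (by simp only [ne_eq, Sym2.eq_iff]; tauto)⟩
      rw [isTri_unique (h.noncross hD) hw h.cyc₁.rot.rot ht this, finset_rot]
  have n := hc.ne
  have t := (isTri_insert n.1 n.2.1 n.2.2).1 ht
  have old : ∀ u v w, Cyc u w v → ({u, w, v} : Finset (Fin N)) = {x, y, z} →
      SuperTeich.isEdgeOf st'.diag s(u, v) → SuperTeich.isEdgeOf st.diag s(u, v) := by
    intro u v w hw hs he
    rcases h.isEdgeOf he with he | he
    · rcases side u v he w hw (hs ▸ ht) with h | h
      · exact absurd (hs.symm.trans h) e1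
      · exact absurd (hs.symm.trans h) e2
    · exact he
  rw [isTri_insert n.1 n.2.1 n.2.2]
  refine ⟨?_, ?_, ?_⟩
  · rw [Sym2.eq_swap]
    exact old y x z hc.rot (by rw [finset_rot y z x, finset_rot z x y]) (by rw [Sym2.eq_swap]; exact t.1)
  · rw [Sym2.eq_swap]
    exact old z y x hc.rot.rot (by rw [finset_rot z x y]) (by rw [Sym2.eq_swap]; exact t.2.1)
  · exact old x z y hc rfl t.2.2

end Step

section Step

variable {A : Type*} [Ring A] {E O : Type*} [CommRing E] [AddCommGroup O] [Module E O]
  {P : OddPairing E O} {H : SuperHull A P}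
  {N : ℕ} [NeZero N] {C : EvenCone E} {F : SuperFrame (Fin N) P}

omit [NeZero N] in
lemma SuperFrame.ell_swap {u v : Fin N} (h : u ≠ v) : F.ell v u = F.ell u v := by
  rw [ell, ell, χ_swap h, F.ν_swap u v]; push_cast; ring

omit [NeZero N] in
lemma SuperFrame.ν_eq (u v : Fin N) : F.ν u v = (χ u v : E) * F.ell u v := by
  have := congrArg (Int.cast (R := E)) (χ_sq u v)
  push_cast at this
  rw [ell]
  linear_combination - F.ν u v * this

omit [NeZero N] in
lemma SuperFrame.D_rot (u v w : Fin N) : F.D v w u = F.D u v w := by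
  rw [F.D_swap_right v u w, F.D_swap_left u v w, neg_neg]

omit [NeZero N] in
lemma triRoot_rot {x y z : Fin N} (h : Cyc x y z) : triRoot C F y z x = triRoot C F x y z := by
  rw [triRoot, triRoot, F.ell_swap h.ne.2.2, F.ell_swap h.ne.1]; ring

/-- The compatibility of the invariant of a triangle with a frame. -/
def RealizesTri (H : SuperHull A P) (C : EvenCone E) (F : SuperFrame (Fin N) P)
    (η : Finset (Fin N) → ℤ) (mu : Finset (Fin N) → A) (p j r : Fin N) : Prop :=
  ∃ m, mu {p, j, r} = H.κ m ∧ triRoot C F p j r • m = (η {p, j, r} : E) • F.D p j r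

omit [NeZero N] in
lemma RealizesTri.rot {η : Finset (Fin N) → ℤ} {mu : Finset (Fin N) → A} {p j r : Fin N}
    (hc : Cyc p j r) (h : RealizesTri H C F η mu p j r) : RealizesTri H C F η mu j r p := by
  obtain ⟨m, h1, h2⟩ := h
  exact ⟨m, by rw [← finset_rot, h1], by rw [triRoot_rot hc, h2, ← finset_rot p j r, F.D_rot p j r]⟩

omit [NeZero N] in
lemma RealizesTri.of_eq {η : Finset (Fin N) → ℤ} {mu : Finset (Fin N) → A} {p j r x y z : Fin N}
    (hc : Cyc p j r) (hc' : Cyc x y z) (h : RealizesTri H C F η mu p j r)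
    (he : ({x, y, z} : Finset (Fin N)) = {p, j, r}) : RealizesTri H C F η mu x y z := by
  rcases hc'.eq_of_finset_eq hc he with ⟨rfl, rfl, rfl⟩ | ⟨rfl, rfl, rfl⟩ | ⟨rfl, rfl, rfl⟩
  · exact h
  · exact h.rot hc
  · exact (h.rot hc).rot hc.rot

variable {Pos : Set A} {sqrt : A → A} {st st' : PState A N} {p j r l : Fin N}
  {η : Finset (Fin N) → ℤ}

lemma NormFlip.realizes_lam_mu (hC : C.Lifts H Pos sqrt) (h : NormFlip Pos sqrt st st' p j r l)
    (hR : Realizes H C F η st) :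
    (F.ell j l ∈ C.Pos ∧ st'.lam s(j, l) = H.ι (F.ell j l)) ∧
    RealizesTri H C F (flipSign η p j r l) st'.mu p j l ∧
    RealizesTri H C F (flipSign η p j r l) st'.mu j r l := by
  have n1 := h.left.ne
  have n2 := h.right.ne
  have n3 := h.cyc₁.ne
  have n4 := h.cyc₂.ne
  have t1 := (isTri_insert n1.1 n1.2.1 n1.2.2).1 h.tri_left
  have t2 := (isTri_insert n2.1 n2.2.1 n2.2.2).1 h.tri_right
  obtain ⟨ha, la⟩ := hR.lam p j n1.1 t1.1
  obtain ⟨hb, lb⟩ := hR.lam j r n1.2.1 t1.2.1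
  obtain ⟨hL, lL⟩ := hR.lam p r n1.2.2 t1.2.2
  obtain ⟨hc, lc⟩ := hR.lam r l n2.2.1 t2.2.1
  obtain ⟨hd, ld⟩ := hR.lam p l n2.2.2 t2.2.2
  obtain ⟨θ, hθ, h₁⟩ := hR.mu p j r h.left h.tri_left
  obtain ⟨σ, hσ, h₂⟩ := hR.mu p r l h.right h.tri_right
  have q1 := h.left.χ_left h.right
  have q2 : χ j r * χ p j = χ p r := by
    have := h.cyc₂.χ_left h.cyc₁.rot
    rw [χ_swap n1.2.2, χ_swap n1.1] at this
    linarith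
  have q3 : χ p l * χ r l = χ p r := by
    have := h.cyc₁.rot.rot.χ_left h.cyc₂.rot.rot
    rw [χ_swap n2.2.2, χ_swap n2.2.1] at this
    linarith
  have q4 := h.ori
  rw [hR.ori p j r l h.left h.right h.mem h.tri_left h.tri_right] at q4
  have sq := fun u v : Fin N => χ_sq u v
  have cE : ∀ {x y : ℤ}, x = y → (x : E) = y := fun h => by rw [h]
  have e₁ : χ p r * χ j l * χ p j * χ r l = 1 := by
    rw [q1, ← q3]; linear_combination (χ p l * χ p l * χ r l * χ r l) * sq p j +
      (χ r l * χ r l) * sq p l + sq r l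
  have e₂ : χ p r * χ j l * χ p l * χ j r = 1 := by
    rw [q1, ← q2]; linear_combination (χ p l * χ p l * χ j r * χ j r) * sq p j +
      (χ j r * χ j r) * sq p l + sq j r
  have η₁ := hR.eta {p, j, r}
  have η₂ := hR.eta {p, r, l}
  have rel : χ p l * η {p, j, r} = χ p j * η {p, r, l} := by
    rw [q1] at q4
    linear_combination - χ p l * η {p, j, r} * η₂ - χ p l * η {p, j, r} * η {p, r, l} * η {p, r, l} * sq p j
      + χ p j * η {p, r, l} * q4
  have rel' : χ r j * η {p, r, l} = χ r l * (- η {p, j, r}) := by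
    have q5 := h.cyc₂.χ_mul
    rw [χ_swap n4.2.2] at q5
    rw [χ_swap n4.1]
    linear_combination - χ r l * η {p, j, r} * q4 + χ r l * χ j l * η {p, r, l} * η₁ -
      χ j r * η {p, r, l} * q5 - χ r l * χ j l * η {p, r, l} * sq j r
  rw [triRoot] at h₁ h₂
  have h₂' : (C.sqrt (F.ell r l) * C.sqrt (F.ell p l) * C.sqrt (F.ell p r)) • σ =
      (η {p, r, l} : E) • F.D p r l := by
    rw [← h₂]; congr 1; ring
  have hX := flip_even C F ha hb hc hd hL (F.ν_eq p l) (F.ν_eq p j) (F.ν_eq p r) (F.ν_eq j l)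
    (F.ν_eq r l) (F.ν_eq j r) (by exact_mod_cast cE (sq p r)) (by exact_mod_cast cE (sq j l))
    (by exact_mod_cast cE η₁) (by exact_mod_cast cE η₂) h₁ h₂'
    (by exact_mod_cast cE e₁) (by exact_mod_cast cE e₂) (by exact_mod_cast cE q4)
  have hac := C.mul_mem _ ha _ hc
  have hbd := C.mul_mem _ hb _ hd
  have hY := C.add_mem _ hac _ hbd
  have hJ : F.ell j l ∈ C.Pos ∧ st'.lam s(j, l) = H.ι (F.ell j l) := by
    obtain ⟨J, hJ, hJ'⟩ := hC.exists_lift _ h.pos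
    have : F.ell p r • J = F.ell p r • F.ell j l := by
      apply H.ι_inj
      simp only [smul_eq_mul]
      rw [hX, map_mul, hJ', ← lL, h.lam, la, lb, lc, Sym2.eq_swap (a := l), ld, hθ, hσ,
        H.mul_odd, ← map_mul, ← map_mul, ← map_mul, ← map_mul, ← map_mul, ← map_add,
        ← hC.map_sqrt _ (C.mul_mem _ (C.mul_mem _ (C.mul_mem _ ha _ hb) _ hc) _ hd),
        ← map_mul, ← map_add]
    have := C.smul_cancel hL this
    exact ⟨this ▸ hJ, this ▸ hJ'.symm⟩
  have smul_κ : ∀ {e : E}, e ∈ C.Pos → ∀ {x : A} {y : O}, x * H.ι e = H.κ y →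
      ∃ m, x = H.κ m ∧ e • m = y := by
    intro e he x y hx
    obtain ⟨f, -, hf⟩ := C.exists_inv e he
    refine ⟨f • y, ?_, by rw [smul_smul, mul_comm, hf, one_smul]⟩
    rw [H.smul_right, ← hx, mul_assoc, ← map_mul, mul_comm, hf, map_one, mul_one]
  have hm₁ := h.mu_left
  have hm₂ := h.mu_right
  rw [la, lb, lc, Sym2.eq_swap (a := l), ld, hθ, hσ, ← map_mul, ← map_mul, ← map_add,
    ← hC.map_sqrt _ hac, ← hC.map_sqrt _ hbd, ← hC.map_sqrt _ hY, ← H.smul_right,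
    ← H.smul_right] at hm₁ hm₂
  rw [← map_add] at hm₁
  rw [← map_sub] at hm₂
  obtain ⟨m₁, f₁, g₁⟩ := smul_κ (C.sqrt_mem _ hY) hm₁
  obtain ⟨m₂, f₂, g₂⟩ := smul_κ (C.sqrt_mem _ hY) hm₂
  have k₁ : P.β σ θ • θ = 0 := pairing_smul_right P.alt P.assoc _ _
  have k₂ : P.β σ θ • σ = 0 := pairing_smul_left P.alt P.assoc _ _
  refine ⟨hJ, ⟨m₁, f₁, ?_⟩, ⟨m₂, f₂, ?_⟩⟩
  · have := flip_odd C F ha hb hc hd hL hJ.1 (F.ν_eq p l) (F.ν_eq p j) (F.ν_eq p r)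
      (by exact_mod_cast cE η₁) (by exact_mod_cast cE η₂) h₁ h₂' hX
      (by rw [mul_smul, k₁, smul_zero]) (by rw [mul_smul, k₂, smul_zero]) g₁
      (by exact_mod_cast cE rel) (by exact_mod_cast cE (sq p l))
    rw [triRoot, this, flipSign_left]
    push_cast
    congr 1
    ring
  · have := flip_odd C F (p := r) (j := l) (r := p) (l := j) (θ := σ) (σ := -θ)
      (η₁ := (η {p, r, l} : E)) (η₂ := ((- η {p, j, r} : ℤ) : E)) (a := F.ell r l)
      (b := F.ell p l) (c := F.ell p j) (d := F.ell j r) (J := F.ell j l) (L := F.ell p r)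
      (xl := (χ r j : E)) (xj := (χ r l : E)) (q := (χ r p : E)) (m := m₂) 
      (n := C.sqrt (F.ell p j * F.ell j r * F.ell r l * F.ell p l) * P.β σ θ)
      hc hd ha hb hL hJ.1
      (by rw [F.ν_eq, F.ell_swap n1.2.1]) (F.ν_eq r l) (by rw [F.ν_eq, F.ell_swap n1.2.2])
      (by exact_mod_cast cE η₂) (by push_cast; rw [neg_mul_neg]; exact_mod_cast cE η₁)
      (by rw [h₂', F.D_rot p r l])
      (by rw [smul_neg, h₁, F.D_rot r p j]; push_cast; module)
      (by rw [hX]; ring)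
      (by rw [mul_smul, k₂, smul_zero]) (by rw [smul_neg, mul_smul, k₁, smul_zero, neg_zero])
      (by rw [mul_comm (F.ell r l), mul_comm (F.ell p l), g₂]; module)
      (by exact_mod_cast cE rel') (by exact_mod_cast cE (sq r j))
    rw [F.D_rot j r l] at this
    rw [triRoot, h.flipSign_right]
    push_cast
    rw [show C.sqrt (F.ell j r) * C.sqrt (F.ell r l) * C.sqrt (F.ell j l) =
      C.sqrt (F.ell r l) * C.sqrt (F.ell j l) * C.sqrt (F.ell j r) by ring, this]
    congr 1
    ring

end Step

section Step

variable {A : Type*} [Ring A] {E O : Type*} [CommRing E] [AddCommGroup O] [Module E O]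
  {P : OddPairing E O} {H : SuperHull A P}
  {N : ℕ} [NeZero N] {C : EvenCone E} {F : SuperFrame (Fin N) P}

/-- The contribution of the triangle with apex `y` to the orientation of the edge from `u` to
`v`. -/
def apexSign (η : Finset (Fin N) → ℤ) (u v y : Fin N) : ℤ := χ u y * η {u, y, v}

omit [NeZero N] in
lemma apexSign_rev {η : Finset (Fin N) → ℤ} {u v y : Fin N} (h : Cyc u y v) :
    apexSign η v u y = χ v u * apexSign η u v y := by
  have h1 := h.χ_mul
  rw [χ_swap h.ne.2.1.symm] at h1
  rw [apexSign, apexSign, finset_swap v y u, finset_rot v u y]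
  linear_combination χ v y * η {u, y, v} * h1 + χ u y * χ v u * η {u, y, v} * χ_sq v y

omit [NeZero N] in
lemma apexSign_rev_right {η : Finset (Fin N) → ℤ} {u v w : Fin N} (h : Cyc u v w) :
    apexSign η v u w = - χ v u * apexSign η u v w := by
  have h1 := apexSign_rev (η := η) (h.rot)
  rw [h1, χ_swap h.ne.1, neg_neg]
  linear_combination (- apexSign η v u w) * χ_sq u v

variable {Pos : Set A} {sqrt : A → A} {st st' : PState A N} {p j r l : Fin N}
  {η : Finset (Fin N) → ℤ}

lemma Realizes.ori_apex (hR : Realizes H C F η st) {x y z w : Fin N} (h : Cyc x y z)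
    (h' : Cyc x z w) (hm : s(x, z) ∈ st.diag) (ht : IsTri st.diag {x, y, z})
    (ht' : IsTri st.diag {x, z, w}) : sgn st.ori x z = apexSign η x z y * apexSign η x z w := by
  rw [hR.ori x y z w h h' hm ht ht', h.χ_left h', apexSign, apexSign, finset_swap x z w]; ring

lemma NormFlip.apexSign_sides (h : NormFlip Pos sqrt st st' p j r l) (hR : Realizes H C F η st) :
    apexSign (flipSign η p j r l) p l j = apexSign η p l r ∧
    apexSign (flipSign η p j r l) p j l = apexSign η p j r ∧
    apexSign (flipSign η p j r l) r j l = - apexSign η r j p ∧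
    apexSign (flipSign η p j r l) r l j = apexSign η r l p := by
  have q := h.ori
  rw [hR.ori p j r l h.left h.right h.mem h.tri_left h.tri_right, h.left.χ_left h.right] at q
  have η₁ := hR.eta {p, j, r}
  have η₂ := hR.eta {p, r, l}
  have q5 := h.cyc₂.χ_mul
  have q6 := h.left.χ_left h.right
  rw [χ_swap h.cyc₂.ne.2.2, χ_swap h.cyc₂.ne.1.symm, q6] at q5
  have s1 : apexSign η p l r = χ p r * η {p, r, l} := rfl
  have s2 : apexSign η p j r = χ p r * η {p, j, r} := by rw [apexSign, finset_swap]
  have s3 : apexSign η r j p = χ r p * η {p, j, r} := by rw [apexSign, finset_rot]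
  have s4 : apexSign η r l p = χ r p * η {p, r, l} := by
    rw [apexSign, finset_rot, finset_swap]
  have t1 : apexSign (flipSign η p j r l) p l j = χ p j * (η {p, j, r} * χ p l * χ p r) := by
    rw [← flipSign_left]; rfl
  have t2 : apexSign (flipSign η p j r l) p j l = χ p l * (η {p, j, r} * χ p l * χ p r) := by
    rw [← flipSign_left, apexSign, finset_swap]
  have t3 : apexSign (flipSign η p j r l) r j l = χ r l * (η {p, r, l} * χ r j * χ r p) := by
    rw [← h.flipSign_right, apexSign, finset_rot j r l]
  have t4 : apexSign (flipSign η p j r l) r l j = χ r j * (η {p, r, l} * χ r j * χ r p) := by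
    rw [← h.flipSign_right, apexSign, finset_swap j r l, finset_rot j l r, finset_rot l r j]
  rw [s1, s2, s3, s4, t1, t2, t3, t4]
  refine ⟨?_, ?_, ?_, ?_⟩
  · linear_combination χ p r * η {p, r, l} * q - χ p j * χ p l * χ p r * η {p, j, r} * η₂
  · linear_combination χ p r * η {p, j, r} * χ_sq p l
  · linear_combination - χ r p * χ r j * χ r l * η {p, r, l} * q +
      χ r p * η {p, j, r} * η {p, r, l} * η {p, r, l} * q5 - χ r p * η {p, j, r} * η₂
  · linear_combination χ r p * η {p, r, l} * χ_sq r j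

lemma NormFlip.isEdgeOf' (h : NormFlip Pos sqrt st st' p j r l) {e : Edg N}
    (he : SuperTeich.isEdgeOf st.diag e) (hne : e ≠ s(p, r)) : SuperTeich.isEdgeOf st'.diag e :=
  he.imp id fun he => h.mem_diag.2 (Or.inr ⟨hne, he⟩)

lemma NormFlip.isTri_new (h : NormFlip Pos sqrt st st' p j r l) :
    IsTri st'.diag {p, j, l} ∧ IsTri st'.diag {j, r, l} := by
  have n1 := h.left.ne
  have n2 := h.right.ne
  have n3 := h.cyc₁.ne
  have n4 := h.cyc₂.ne
  have t1 := (isTri_insert n1.1 n1.2.1 n1.2.2).1 h.tri_left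
  have t2 := (isTri_insert n2.1 n2.2.1 n2.2.2).1 h.tri_right
  rw [isTri_insert n3.1 n3.2.1 n3.2.2, isTri_insert n4.1 n4.2.1 n4.2.2]
  have hjl : SuperTeich.isEdgeOf st'.diag s(j, l) := Or.inr (h.mem_diag.2 (Or.inl rfl))
  exact ⟨⟨h.isEdgeOf' t1.1 (by simp only [ne_eq, Sym2.eq_iff]; tauto), hjl,
    h.isEdgeOf' t2.2.2 (by simp only [ne_eq, Sym2.eq_iff]; tauto)⟩,
    h.isEdgeOf' t1.2.1 (by simp only [ne_eq, Sym2.eq_iff]; tauto),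
    h.isEdgeOf' t2.2.1 (by simp only [ne_eq, Sym2.eq_iff]; tauto), hjl⟩

lemma NormFlip.apexSign_new (h : NormFlip Pos sqrt st st' p j r l) (hR : Realizes H C F η st) :
    apexSign (flipSign η p j r l) l j p * apexSign (flipSign η p j r l) l j r = 1 := by
  have q := h.ori
  rw [hR.ori p j r l h.left h.right h.mem h.tri_left h.tri_right] at q
  have q5 := h.cyc₂.χ_mul
  rw [χ_swap h.cyc₂.ne.2.2, χ_swap h.cyc₂.ne.1.symm] at q5
  have t1 : apexSign (flipSign η p j r l) l j p = χ l p * (η {p, j, r} * χ p l * χ p r) := by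
    rw [← flipSign_left, apexSign, finset_rot l p j]
  have t2 : apexSign (flipSign η p j r l) l j r = χ l r * (η {p, r, l} * χ r j * χ r p) := by
    rw [← h.flipSign_right, apexSign, finset_rot l r j, finset_rot r j l, finset_rot j l r,
      finset_swap l r j, finset_rot l j r]
  rw [t1, t2, χ_swap h.right.ne.2.2, χ_swap h.right.ne.2.1, χ_swap h.right.ne.1]
  have η₁ := hR.eta {p, j, r}
  have η₂ := hR.eta {p, r, l}
  linear_combination (- χ r l * χ r j * η {p, j, r} * η {p, r, l} * χ p r * χ p r) * χ_sq p l -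
    χ r l * χ r j * η {p, j, r} * η {p, r, l} * χ_sq p r +
    χ r l * χ r j * η {p, j, r} * η {p, r, l} * q -
    χ r l * χ r j * χ j l * η {p, j, r} * η {p, j, r} * η₂ - χ r l * χ r j * χ j l * η₁ - q5

omit [NeZero N] in
lemma Cyc.finset_ne {x z w p j l : Fin N} (h : Cyc x z w) (h' : Cyc p j l) (n₁ : ¬ (x = p ∧ z = j))
    (n₂ : ¬ (x = j ∧ z = l)) (n₃ : ¬ (x = l ∧ z = p)) : ({x, z, w} : Finset (Fin N)) ≠ {p, j, l} := by
  intro e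
  rcases h.eq_of_finset_eq h' e with h | h | h
  exacts [n₁ ⟨h.1, h.2.1⟩, n₂ ⟨h.1, h.2.1⟩, n₃ ⟨h.1, h.2.1⟩]

lemma NormFlip.ori_outer (h : NormFlip Pos sqrt st st' p j r l) (hR : Realizes H C F η st)
    {x y z w o : Fin N} {ε : ℤ} (hc' : Cyc x z w) (hm : s(x, z) ∈ st'.diag)
    (ht' : IsTri st'.diag {x, z, w}) (hoc : Cyc x o z) (ho : IsTri st.diag {x, o, z})
    (e₁ : ({x, z, w} : Finset (Fin N)) ≠ {p, j, l}) (e₂ : ({x, z, w} : Finset (Fin N)) ≠ {j, r, l})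
    (hjl : s(x, z) ≠ s(j, l)) (hs : sgn st'.ori x z = ε * sgn st.ori x z)
    (ha : apexSign (flipSign η p j r l) x z y = ε * apexSign η x z o) :
    sgn st'.ori x z =
      apexSign (flipSign η p j r l) x z y * apexSign (flipSign η p j r l) x z w := by
  have hto' := (((h.isTri_cases hR.noncross hc' ht').resolve_left e₁).resolve_left e₂).2.2
  have hmo := ((h.mem_diag.1 hm).resolve_left hjl).2
  have : apexSign (flipSign η p j r l) x z w = apexSign η x z w := by
    simp only [apexSign, flipSign, finset_swap x z w ▸ e₁, finset_swap x z w ▸ e₂, if_false]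
  rw [hs, ha, this, hR.ori_apex hoc hc' hmo ho hto', mul_assoc]

lemma NormFlip.ori_left (h : NormFlip Pos sqrt st st' p j r l) (hR : Realizes H C F η st)
    {x y z w : Fin N} (hc : Cyc x y z) (hc' : Cyc x z w) (hm : s(x, z) ∈ st'.diag)
    (ht' : IsTri st'.diag {x, z, w})
    (hnew : ({x, y, z} : Finset (Fin N)) = {p, j, l} ∨ ({x, y, z} : Finset (Fin N)) = {j, r, l}) :
    sgn st'.ori x z =
      apexSign (flipSign η p j r l) x z y * apexSign (flipSign η p j r l) x z w := by
  obtain ⟨a₁, a₂, a₃, a₄⟩ := h.apexSign_sides hR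
  have n1 := h.left.ne
  have n2 := h.right.ne
  have n3 := h.cyc₁.ne
  have n4 := h.cyc₂.ne
  have d : (p ≠ j ∧ p ≠ r ∧ p ≠ l ∧ j ≠ r ∧ j ≠ l ∧ r ≠ l) ∧
      j ≠ p ∧ r ≠ p ∧ l ≠ p ∧ r ≠ j ∧ l ≠ j ∧ l ≠ r :=
    ⟨⟨n1.1, n1.2.2, n2.2.2, n1.2.1, n3.2.1, n2.2.1⟩, n1.1.symm, n1.2.2.symm, n2.2.2.symm,
      n1.2.1.symm, n3.2.1.symm, n2.2.1.symm⟩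
  clear n1 n2 n3 n4
  have c₁ : Cyc p r l := h.right
  have c₂ := h.left
  have tnew := h.isTri_new
  have olds : ∀ u v, s(u, v) ≠ s(j, l) → s(u, v) ≠ s(j, r) →
      sgn st'.ori u v = 1 * sgn st.ori u v := by
    intro u v h₁ h₂
    rw [sgn, h.ori_of_ne _ h₁ h₂, ← sgn, one_mul]
  rcases hnew with e | e
  · rcases hc.eq_of_finset_eq h.cyc₁ e with ⟨rfl, rfl, rfl⟩ | ⟨rfl, rfl, rfl⟩ | ⟨rfl, rfl, rfl⟩
    · refine h.ori_outer hR hc' hm ht' h.right h.tri_right ?_ ?_ ?_ (olds _ _ ?_ ?_) (by rw [a₁, one_mul])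
      · apply hc'.finset_ne h.cyc₁ <;> simp [d]
      · apply hc'.finset_ne h.cyc₂ <;> simp [d]
      all_goals simp [d]
    · refine h.ori_outer hR hc' hm ht' h.left.rot (by rw [← finset_rot]; exact h.tri_left) ?_ ?_ ?_
        (olds _ _ ?_ ?_) ?_
      · apply hc'.finset_ne h.cyc₁ <;> simp [d]
      · apply hc'.finset_ne h.cyc₂ <;> simp [d]
      · simp [d]
      · simp [d]
      · simp [d]
      · rw [apexSign_rev_right h.cyc₁, apexSign_rev_right h.left, a₂, one_mul]
    · have := isTri_unique (h.noncross hR.noncross) hc'.rot h.cyc₂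
        (by rwa [← finset_rot]) tnew.2
      subst this
      rw [h.ori_new, h.apexSign_new hR]
  · rcases hc.eq_of_finset_eq h.cyc₂ e with ⟨rfl, rfl, rfl⟩ | ⟨rfl, rfl, rfl⟩ | ⟨rfl, rfl, rfl⟩
    · have := isTri_unique (h.noncross hR.noncross) hc'.rot h.cyc₁.rot.rot
        (by rwa [← finset_rot]) (by rw [finset_rot]; exact tnew.1)
      subst this
      have e₁ := h.apexSign_new hR
      rw [apexSign_rev h.cyc₂, apexSign_rev_right hc'] at e₁
      have e₂ := (sgn_cases st'.ori d.2.2.2.2.2.1).resolve_right fun e => by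
        have := h.ori_new; omega
      rw [e₂.2]
      linear_combination apexSign (flipSign η w x y z) x z y *
        apexSign (flipSign η w x y z) x z w * χ_sq z x + e₁
    · refine h.ori_outer hR hc' hm ht' h.left.rot.rot (by rw [finset_rot]; exact h.tri_left) ?_ ?_ ?_
        (ε := -1) ?_ (by rw [a₃, neg_one_mul])
      · apply hc'.finset_ne h.cyc₁ <;> simp [d]
      · apply hc'.finset_ne h.cyc₂ <;> simp [d]
      · simp [d]
      · rw [sgn, sgn, Sym2.eq_swap, h.ori_side]
        cases st.ori s(z, x) <;> simp
    · refine h.ori_outer hR hc' hm ht' h.right.rot.rot (by rw [finset_rot]; exact h.tri_right) ?_ ?_ ?_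
        (olds _ _ ?_ ?_) ?_
      · apply hc'.finset_ne h.cyc₁ <;> simp [d]
      · apply hc'.finset_ne h.cyc₂ <;> simp [d]
      · simp [d]
      · simp [d]
      · simp [d]
      · rw [apexSign_rev_right h.cyc₂.rot, apexSign_rev_right h.right.rot, a₄, one_mul]

lemma NormFlip.realizes (hC : C.Lifts H Pos sqrt) (h : NormFlip Pos sqrt st st' p j r l)
    (hR : Realizes H C F η st) : Realizes H C F (flipSign η p j r l) st' := by
  obtain ⟨hJ, hT₁, hT₂⟩ := h.realizes_lam_mu hC hR
  refine ⟨h.noncross hR.noncross, ?_, ?_, ?_, ?_⟩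
  · intro u v huv he
    by_cases hj : s(u, v) = s(j, l)
    · rw [hj]
      rw [Sym2.eq_iff] at hj
      rcases hj with ⟨rfl, rfl⟩ | ⟨rfl, rfl⟩
      · exact hJ
      · rw [F.ell_swap h.cyc₂.ne.2.2]; exact hJ
    · rw [h.lam_of_ne _ hj]
      exact hR.lam u v huv ((h.isEdgeOf he).resolve_left hj)
  · intro x y z hc ht
    rcases h.isTri_cases hR.noncross hc ht with e | e | ⟨e₁, e₂, ht⟩
    · exact hT₁.of_eq h.cyc₁ hc e
    · exact hT₂.of_eq h.cyc₂ hc e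
    · rw [h.mu_of_ne _ e₁ e₂, flipSign, if_neg e₁, if_neg e₂]
      exact hR.mu x y z hc ht
  · intro t
    have h1 := hR.eta {p, j, r}
    have h2 := hR.eta {p, r, l}
    unfold flipSign
    split_ifs
    · linear_combination χ p l * χ p l * χ p r * χ p r * h1 + χ p r * χ p r * χ_sq p l + χ_sq p r
    · linear_combination χ r j * χ r j * χ r p * χ r p * h2 + χ r p * χ r p * χ_sq r j + χ_sq r p
    · exact hR.eta t
  · intro x y z w hc hc' hm ht ht'
    have goal : sgn st'.ori x z =
        apexSign (flipSign η p j r l) x z y * apexSign (flipSign η p j r l) x z w := by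
      rcases h.isTri_cases hR.noncross hc ht with e | e | ⟨e₁, e₂, hto⟩
      · exact h.ori_left hR hc hc' hm ht' (Or.inl e)
      · exact h.ori_left hR hc hc' hm ht' (Or.inr e)
      have key := fun e => h.ori_left hR (x := z) (y := w) (z := x) (w := y) hc'.rot hc.rot.rot
        (by rwa [Sym2.eq_swap]) (by rwa [finset_rot]) e
      have key' : ∀ _ : ({x, z, w} : Finset (Fin N)) = {p, j, l} ∨
          ({x, z, w} : Finset (Fin N)) = {j, r, l}, _ := fun e => key (by rwa [← finset_rot])
      have back : sgn st'.ori z x = apexSign (flipSign η p j r l) z x w *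
          apexSign (flipSign η p j r l) z x y → sgn st'.ori x z =
        apexSign (flipSign η p j r l) x z y * apexSign (flipSign η p j r l) x z w := by
        rw [apexSign_rev hc, apexSign_rev_right hc']
        intro e
        have := χ_sq z x
        rcases sgn_cases st'.ori hc.ne.2.2 with ⟨e1, e2⟩ | ⟨e1, e2⟩
        · rw [e2] at e; rw [e1]
          linear_combination - e + (apexSign (flipSign η p j r l) x z y * apexSign (flipSign η p j r l) x z w) * this
        · rw [e2] at e; rw [e1]
          linear_combination - e + (apexSign (flipSign η p j r l) x z y * apexSign (flipSign η p j r l) x z w) * this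
      rcases h.isTri_cases hR.noncross hc' ht' with e | e | ⟨e₃, e₄, hto'⟩
      · exact back (key' (Or.inl e))
      · exact back (key' (Or.inr e))
      · have hjl : s(x, z) ≠ s(j, l) := by
          intro e
          have h1 := ((isTri_insert hc.ne.1 hc.ne.2.1 hc.ne.2.2).1 hto).2.2
          rw [e] at h1
          refine isEdgeOf.not_crossE hR.noncross (Or.inr h.mem) h1 ?_
          rw [crossE_iff]
          exact Or.inl ⟨h.left, h.right.rot⟩
        have hmo := ((h.mem_diag.1 hm).resolve_left hjl).2
        have hjr : s(x, z) ≠ s(j, r) := by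
          intro e
          rw [Sym2.eq_iff] at e
          rcases e with ⟨rfl, rfl⟩ | ⟨rfl, rfl⟩
          · have := isTri_unique (h.noncross hR.noncross) hc'.rot h.cyc₂.rot
              (by rwa [← finset_rot]) (by rw [← finset_rot]; exact h.isTri_new.2)
            exact e₄ (by rw [this])
          · have := isTri_unique (h.noncross hR.noncross) hc h.cyc₂.rot
              ht (by rw [← finset_rot]; exact h.isTri_new.2)
            exact e₂ (by rw [this, ← finset_rot])
        rw [sgn, h.ori_of_ne _ hjl hjr, ← sgn, hR.ori_apex hc hc' hmo hto hto']
        simp only [apexSign, flipSign, finset_swap x z w ▸ e₃, finset_swap x z w ▸ e₄,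
          e₁, e₂, if_false]
    rw [goal, hc.χ_left hc', apexSign, apexSign, finset_swap x w z]; ring

lemma Realizes.of_flips (hC : C.Lifts H Pos sqrt) (hR : Realizes H C F η st)
    (h : Relation.ReflTransGen (Flip Pos sqrt) st st') : ∃ η', Realizes H C F η' st' := by
  induction h with
  | refl => exact ⟨η, hR⟩
  | tail _ hf ih =>
    obtain ⟨η', hR'⟩ := ih
    obtain ⟨p, j, r, l, hn⟩ := hf.normForm
    exact ⟨_, hn.realizes hC hR'⟩

end Step

/-- The triangles met by an arc, in order: the center `c k` of the `k`-th triangle, the vertex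
`v k` joined to `c k` by the next diagonal, and the third vertex `w k`. -/
structure FanChain (n : ℕ) (a b : Fin (n + 3)) (D : Finset (Edg (n + 3)))
    (c w v : ℕ → Fin (n + 3)) : Prop where
  pos : 1 ≤ n
  noncross : ∀ e ∈ D, ∀ f ∈ D, ¬ crossE e f
  not_isBnd : ∀ e ∈ D, ¬ isBnd e
  tri : ∀ k ≤ n, IsTri D {c k, w k, v k}
  ne : ∀ k ≤ n, c k ≠ w k ∧ w k ≠ v k ∧ c k ≠ v k
  mem : ∀ k < n, s(c k, v k) ∈ D
  enum : ∀ e ∈ D, ∃ k < n, e = s(c k, v k)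
  first : w 0 = a
  last : v n = b
  step : ∀ k < n, (c (k + 1) = c k ∧ w (k + 1) = v k) ∨ (c (k + 1) = v k ∧ w (k + 1) = c k)
  cross : ∀ k < n, crossE s(c k, v k) s(a, b)
  order : ∀ k < n, ∀ j ≤ k, ∀ x ∈ ({c j, w j, v j} : Finset (Fin (n + 3))), x ≠ c k → x ≠ v k →
    crossE s(c k, v k) s(x, b)

lemma crossE_ne {N : ℕ} {x y u v : Fin N} (h : crossE s(x, y) s(u, v)) :
    x ≠ u ∧ x ≠ v ∧ y ≠ u ∧ y ≠ v := by
  rw [crossE_iff] at h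
  unfold Cyc at h
  simp only [ne_eq, Fin.ext_iff]; omega

lemma eq_triple_of_mem {α : Type*} [DecidableEq α] {t : Finset α} (ht : t.card = 3) {x y z : α}
    (hx : x ∈ t) (hy : y ∈ t) (hz : z ∈ t) (hxy : x ≠ y) (hyz : y ≠ z) (hxz : x ≠ z) :
    t = {x, y, z} := by
  refine (Finset.eq_of_subset_of_card_le ?_ ?_).symm
  · intro u; simp only [Finset.mem_insert, Finset.mem_singleton]; rintro (rfl | rfl | rfl) <;> assumption
  · rw [ht, Finset.card_eq_three.2 ⟨x, y, z, hxy, hxz, hyz, rfl⟩]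

/-- The data of the triangles met by an arc form a chain. -/
lemma exists_fanChain
    (n : ℕ) (hn : 1 ≤ n)
    (a b : Fin (n + 3)) (hab : a ≠ b)
    (D0 : Finset (Edg (n + 3))) (hD0 : IsTriangulation D0)
    (tri : Fin (n + 1) → Finset (Fin (n + 3)))
    (ctr : Fin (n + 1) → Fin (n + 3))
    (oth : Fin (n + 1) → Fin (n + 3) × Fin (n + 3))
    (dsp : Fin n → Fin (n + 3) × Fin (n + 3))
    (htri : ∀ k, IsTri D0 (tri k))
    (htriv : ∀ k, tri k = {ctr k, (oth k).1, (oth k).2})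
    (ha : a ∈ tri 0) (hb : b ∈ tri (Fin.last n))
    (hdsp : ∀ k : Fin n, (dsp k).1 < (dsp k).2 ∧ s((dsp k).1, (dsp k).2) ∈ D0 ∧
      crossE s((dsp k).1, (dsp k).2) s(a, b))
    (hsep : ∀ k : Fin n, (dsp k).1 ∈ tri k.castSucc ∧ (dsp k).2 ∈ tri k.castSucc ∧
      (dsp k).1 ∈ tri k.succ ∧ (dsp k).2 ∈ tri k.succ)
    (hall : ∀ e ∈ D0, ∃ k : Fin n, e = s((dsp k).1, (dsp k).2))
    (horder : ∀ k : Fin n, ∀ j : Fin (n + 1), j.val ≤ k.val → ∀ w ∈ tri j,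
      w ≠ (dsp k).1 → w ≠ (dsp k).2 → w ≠ b →
      crossE s((dsp k).1, (dsp k).2) s(w, b))
    (before : ∀ k : Fin n, ctr k.castSucc ∈ s((dsp k).1, (dsp k).2))
    (after : ∀ k : Fin n, ctr k.succ ∈ s((dsp k).1, (dsp k).2)) :
    ∃ c w v : ℕ → Fin (n + 3), FanChain n a b D0 c w v ∧
      (∀ k : Fin (n + 1), ctr k = c k ∧ tri k = {c k, w k, v k}) ∧
      ∀ k : Fin n, s((dsp k).1, (dsp k).2) = s(c k, v k) := by
  have inj : ∀ k k' : Fin n, s((dsp k).1, (dsp k).2) = s((dsp k').1, (dsp k').2) → k = k' := by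
    have hsurj : Function.Surjective
        (fun k : Fin n => (⟨s((dsp k).1, (dsp k).2), (hdsp k).2.1⟩ : D0)) := by
      rintro ⟨e, he⟩
      obtain ⟨k, hk⟩ := hall e he
      exact ⟨k, Subtype.ext hk.symm⟩
    have := (Fintype.bijective_iff_surjective_and_card _).2 ⟨hsurj, by
      rw [Fintype.card_coe, Fintype.card_fin]; have := hD0.1; omega⟩
    exact fun k k' h => this.1 (Subtype.ext h)
  choose V hV using fun k => Sym2.mem_iff_exists.1 (before k)
  choose W hW using fun k => Sym2.mem_iff_exists.1 (after k)
  let c : ℕ → Fin (n + 3) := fun k => if h : k < n + 1 then ctr ⟨k, h⟩ else b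
  let v : ℕ → Fin (n + 3) := fun k => if h : k < n then V ⟨k, h⟩ else b
  let w : ℕ → Fin (n + 3) := fun k => if h : 0 < k ∧ k - 1 < n then W ⟨k - 1, h.2⟩ else a
  have hc : ∀ k : Fin (n + 1), c k = ctr k := fun k => dif_pos k.isLt
  have hv : ∀ k (h : k < n), s((dsp ⟨k, h⟩).1, (dsp ⟨k, h⟩).2) = s(c k, v k) := fun k h => by
    rw [hV]; simp only [c, v, h, Nat.lt_succ_of_lt h, dif_pos]; rfl
  have hw : ∀ k (h : k < n), s((dsp ⟨k, h⟩).1, (dsp ⟨k, h⟩).2) = s(c (k + 1), w (k + 1)) :=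
    fun k h => by
      rw [hW]
      simp only [c, w, h, Nat.succ_lt_succ h, dif_pos, Nat.succ_pos, true_and, Nat.add_sub_cancel]
      rfl
  have w0 : w 0 = a := by simp [w]
  have vn : v n = b := by simp [v]
  have hcross : ∀ k < n, crossE s(c k, v k) s(a, b) := fun k h => hv k h ▸ (hdsp ⟨k, h⟩).2.2
  have hcross' : ∀ k < n, crossE s(c (k + 1), w (k + 1)) s(a, b) := fun k h =>
    hw k h ▸ (hdsp ⟨k, h⟩).2.2
  have memL : ∀ k (h : k < n), ∀ x ∈ s(c k, v k), x ∈ tri ⟨k, by omega⟩ := by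
    intro k h x hx
    rw [← hv k h, Sym2.mem_iff] at hx
    rcases hx with rfl | rfl
    exacts [(hsep ⟨k, h⟩).1, (hsep ⟨k, h⟩).2.1]
  have memR : ∀ k (h : k < n), ∀ x ∈ s(c (k + 1), w (k + 1)), x ∈ tri ⟨k + 1, by omega⟩ := by
    intro k h x hx
    rw [← hw k h, Sym2.mem_iff] at hx
    rcases hx with rfl | rfl
    exacts [(hsep ⟨k, h⟩).2.2.1, (hsep ⟨k, h⟩).2.2.2]
  have neL : ∀ k < n, c k ≠ v k := by
    intro k h e
    have := hv k h
    rw [← e, Sym2.eq_iff] at this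
    have := (hdsp ⟨k, h⟩).1
    aesop
  have neR : ∀ k < n, c (k + 1) ≠ w (k + 1) := by
    intro k h e
    have := hw k h
    rw [← e, Sym2.eq_iff] at this
    have := (hdsp ⟨k, h⟩).1
    aesop
  have memv : ∀ k (h : k ≤ n), v k ∈ tri ⟨k, by omega⟩ := by
    intro k h
    rcases Nat.lt_or_eq_of_le h with h | rfl
    · exact memL k h _ (Sym2.mem_mk_right _ _)
    · rw [vn]; exact hb
  have memw : ∀ k (h : k ≤ n), w k ∈ tri ⟨k, by omega⟩ := by
    rintro (_ | k) h
    · rw [w0]; exact ha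
    · exact memR k h _ (Sym2.mem_mk_right _ _)
  have memc : ∀ k (h : k ≤ n), c k ∈ tri ⟨k, by omega⟩ := by
    rintro k h
    rw [hc ⟨k, by omega⟩, htriv]
    simp
  have neall : ∀ k ≤ n, c k ≠ w k ∧ w k ≠ v k ∧ c k ≠ v k := by
    intro k h
    have h1 : c k ≠ w k := by
      rcases k with _ | k
      · rw [w0]; exact (crossE_ne (hcross 0 hn)).1
      · exact neR k h
    have h3 : c k ≠ v k := by
      rcases Nat.lt_or_eq_of_le h with h | rfl
      · exact neL k h
      · obtain ⟨m, rfl⟩ := Nat.exists_eq_succ_of_ne_zero (Nat.one_le_iff_ne_zero.1 hn)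
        rw [vn]; exact (crossE_ne (hcross' m (Nat.lt_succ_self m))).2.1
    refine ⟨h1, ?_, h3⟩
    rcases k with _ | k
    · rw [w0]
      exact (crossE_ne (hcross 0 hn)).2.2.1.symm
    · rcases Nat.lt_or_eq_of_le h with h' | h'
      · intro e
        have := inj ⟨k, by omega⟩ ⟨k + 1, h'⟩ (by rw [hv _ h', hw k (by omega), e])
        simp at this
      · have hv' : v (k + 1) = b := by rw [h', vn]
        rw [hv']
        exact (crossE_ne (hcross' k (by omega))).2.2.2
  have htri' : ∀ k (h : k ≤ n), tri ⟨k, by omega⟩ = {c k, w k, v k} := fun k h =>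
    eq_triple_of_mem (htri _).1 (memc k h) (memw k h) (memv k h) (neall k h).1 (neall k h).2.1
      (neall k h).2.2
  have bnot : ∀ k < n, b ∉ ({c k, w k, v k} : Finset (Fin (n + 3))) := by
    intro k h
    have h1 := crossE_ne (hcross k h)
    simp only [Finset.mem_insert, Finset.mem_singleton, not_or]
    refine ⟨h1.2.1.symm, ?_, h1.2.2.2.symm⟩
    rcases k with _ | k
    · rw [w0]; exact hab.symm
    · exact (crossE_ne (hcross' k (by omega))).2.2.2.symm
  refine ⟨c, w, v, ⟨hn, hD0.2.2, fun e he => (hD0.2.1 e he).1, fun k h => htri' k h ▸ htri _, neall,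
    fun k h => hv k h ▸ (hdsp ⟨k, h⟩).2.1, ?_, w0, vn, ?_, hcross, ?_⟩, ?_, ?_⟩
  · intro e he
    obtain ⟨k, hk⟩ := hall e he
    exact ⟨k, k.isLt, by rw [hk, ← hv]⟩
  · intro k h
    have := (hw k h).symm.trans (hv k h)
    rw [Sym2.eq_iff] at this
    exact this
  · intro k hk j hj x hx h1 h2
    have hx' : x ∉ s(c k, v k) := fun h => (Sym2.mem_iff.1 h).elim h1 h2
    rw [← hv k hk, Sym2.mem_iff, not_or] at hx'
    rw [← hv k hk]
    refine horder ⟨k, hk⟩ ⟨j, by omega⟩ hj x ?_ hx'.1 hx'.2 ?_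
    · rw [htri' j (by omega)]; exact hx
    · rintro rfl; exact bnot j (by omega) hx
  · intro k
    exact ⟨(hc k).symm, htri' k (by omega)⟩
  · intro k
    exact hv k k.isLt

/-- The position of `x` counted counterclockwise from `a`. -/
def shift {N : ℕ} (a x : Fin N) : ℕ := if a.val ≤ x.val then x.val - a.val else x.val + N - a.val

lemma shift_self {N : ℕ} (a : Fin N) : shift a a = 0 := by simp [shift]

lemma shift_lt {N : ℕ} (a x : Fin N) : shift a x < N := by
  unfold shift; split_ifs <;> omega

lemma shift_inj {N : ℕ} {a x y : Fin N} : shift a x = shift a y ↔ x = y := by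
  rw [Fin.ext_iff]; unfold shift; split_ifs <;> omega

lemma crossE_shift_self {N : ℕ} {a x y b : Fin N} :
    crossE s(x, y) s(a, b) ↔ (0 < shift a x ∧ shift a x < shift a b ∧ shift a b < shift a y) ∨
      (0 < shift a y ∧ shift a y < shift a b ∧ shift a b < shift a x) := by
  rw [crossE_iff]; unfold Cyc shift; split_ifs <;> omega

lemma crossE_shift {N : ℕ} {a x y z b : Fin N} (h : crossE s(x, y) s(z, b))
    (h1 : shift a x < shift a b) (h2 : shift a b < shift a y) :
    shift a z < shift a x ∨ shift a y < shift a z := by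
  rw [crossE_iff] at h; revert h h1 h2; unfold Cyc shift; split_ifs <;> omega

lemma isBnd_shift {N : ℕ} [NeZero N] (a x y : Fin N) : isBnd s(x, y) ↔
    (shift a y = shift a x + 1 ∨ shift a x = shift a y + 1 ∨
      (shift a x = 0 ∧ shift a y + 1 = N) ∨ (shift a y = 0 ∧ shift a x + 1 = N)) := by
  have key : isBnd s(x, y) ↔ (y.val = x.val + 1 ∨ x.val = y.val + 1 ∨
      (x.val = 0 ∧ y.val + 1 = N) ∨ (y.val = 0 ∧ x.val + 1 = N)) := by
    have succ_val : ∀ i : Fin N, (i.val + 1 < N ∧ (i + 1 : Fin N).val = i.val + 1) ∨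
        (i.val + 1 = N ∧ (i + 1 : Fin N).val = 0) := by
      intro i
      have h0 := i.isLt
      have h1 : (i + 1 : Fin N).val = (i.val + 1 % N) % N := rfl
      rw [Nat.add_mod_mod] at h1
      rcases Nat.lt_or_ge (i.val + 1) N with h | h
      · exact Or.inl ⟨h, by rw [h1, Nat.mod_eq_of_lt h]⟩
      · have h2 : i.val + 1 = N := by omega
        exact Or.inr ⟨h2, by rw [h1, h2, Nat.mod_self]⟩
    constructor
    · rintro ⟨i, hi⟩
      have := succ_val i
      rw [Sym2.eq_iff] at hi
      rcases hi with ⟨rfl, rfl⟩ | ⟨rfl, rfl⟩ <;> omega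
    · intro h
      have h1 := succ_val x
      have h2 := succ_val y
      have := x.isLt
      have := y.isLt
      by_cases h3 : y.val = (x + 1 : Fin N).val
      · exact ⟨x, by rw [Fin.ext h3]⟩
      · refine ⟨y, ?_⟩
        have h4 : x = y + 1 := Fin.ext (by omega)
        rw [← h4, Sym2.eq_swap]
  rw [key]
  have := x.isLt
  have := y.isLt
  unfold shift; split_ifs <;> omega

namespace FanChain
variable {n : ℕ} {a b : Fin (n + 3)} {D : Finset (Edg (n + 3))} {c w v : ℕ → Fin (n + 3)}

/-- Numbering the vertices on both sides of the arc starting from `a`, the `k`-th diagonal joins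
the vertices with numbers `L k` and `R k`. -/
lemma exists_coord (h : FanChain n a b D c w v) : ∃ L R : ℕ → ℕ,
    (∀ k < n, 1 ≤ L k ∧ L k < shift a b ∧ 1 ≤ R k ∧ R k + shift a b < n + 3 ∧ L k + R k = k + 2) ∧
    (∀ k < n, (shift a (c k) = L k ∧ shift a (v k) + R k = n + 3) ∨
      (shift a (v k) = L k ∧ shift a (c k) + R k = n + 3)) ∧
    (∀ j k, j ≤ k → k < n → L j ≤ L k ∧ R j ≤ R k) ∧
    (∀ k < n, (shift a (w (k + 1)) = L k ∧ shift a (c (k + 1)) + R k = n + 3 ∧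
        shift a (v (k + 1)) = L k + 1) ∨
      (shift a (w (k + 1)) + R k = n + 3 ∧ shift a (c (k + 1)) = L k ∧
        shift a (v (k + 1)) + R k + 1 = n + 3)) := by
  obtain ⟨L, hL⟩ : ∃ L : ℕ → ℕ, ∀ k, L k = min (shift a (c k)) (shift a (v k)) := ⟨_, fun _ => rfl⟩
  obtain ⟨R, hR⟩ : ∃ R : ℕ → ℕ, ∀ k, R k = n + 3 - max (shift a (c k)) (shift a (v k)) :=
    ⟨_, fun _ => rfl⟩
  have hpos := h.pos
  have h1 : ∀ k < n, 1 ≤ L k ∧ L k < shift a b ∧ 1 ≤ R k ∧ R k + shift a b < n + 3 ∧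
      ((shift a (c k) = L k ∧ shift a (v k) + R k = n + 3) ∨
      (shift a (v k) = L k ∧ shift a (c k) + R k = n + 3)) := by
    intro k hk
    have := crossE_shift_self.1 (h.cross k hk)
    have := shift_lt a (c k)
    have := shift_lt a (v k)
    rw [hL, hR]; omega
  have h2 : ∀ k, k + 1 < n → (L k < L (k + 1) ∧ R k = R (k + 1) ∧ shift a (w (k + 1)) = L k ∧
        shift a (c (k + 1)) + R k = n + 3 ∧ shift a (v (k + 1)) = L (k + 1)) ∨
      (L k = L (k + 1) ∧ R k < R (k + 1) ∧ shift a (w (k + 1)) + R k = n + 3 ∧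
        shift a (c (k + 1)) = L k ∧ shift a (v (k + 1)) + R (k + 1) = n + 3) := by
    intro k hk
    have hn := h.ne (k + 1) hk.le
    have hc := h.order (k + 1) hk (k + 1) le_rfl (w (k + 1)) (by simp) hn.1.symm hn.2.1
    have hc' : crossE s(v (k + 1), c (k + 1)) s(w (k + 1), b) := by rwa [Sym2.eq_swap]
    have h3 := crossE_shift (a := a) hc
    have h4 := crossE_shift (a := a) hc'
    have h5 := h1 k (by omega)
    have h6 := h1 (k + 1) hk
    have h7 : (shift a (c (k + 1)) = shift a (c k) ∧ shift a (w (k + 1)) = shift a (v k)) ∨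
        (shift a (c (k + 1)) = shift a (v k) ∧ shift a (w (k + 1)) = shift a (c k)) := by
      rw [shift_inj, shift_inj, shift_inj, shift_inj]; exact h.step k (by omega)
    omega
  have h3 : ∀ k, k < n → k + 2 ≤ L k + R k := by
    intro k
    induction k with
    | zero => intro hk; have := h1 0 hk; omega
    | succ k ih => intro hk; have := ih (by omega); have := h2 k hk; omega
  have h4 : ∀ k, k < n → L (n - 1 - k) + R (n - 1 - k) ≤ n + 1 - k := by
    intro k
    induction k with
    | zero => intro hk; have := h1 (n - 1) (by omega); simp only [Nat.sub_zero]; omega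
    | succ k ih =>
      intro hk
      have := ih (by omega)
      have h' := h2 (n - 1 - (k + 1)) (by omega)
      rw [show n - 1 - (k + 1) + 1 = n - 1 - k by omega] at h'
      omega
  have h5 : ∀ k < n, L k + R k = k + 2 := by
    intro k hk
    have := h3 k hk
    have h' := h4 (n - 1 - k) (by omega)
    rw [show n - 1 - (n - 1 - k) = k by omega] at h'
    omega
  refine ⟨L, R, fun k hk => ?_, fun k hk => (h1 k hk).2.2.2.2, ?_, ?_⟩
  · have := h1 k hk; have := h5 k hk; omega
  · intro j k hjk
    induction k, hjk using Nat.le_induction with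
    | base => intro _; exact ⟨le_rfl, le_rfl⟩
    | succ k _ ih => intro hk; have := ih (by omega); have := h2 k hk; omega
  · intro k hk
    rcases Nat.lt_or_ge (k + 1) n with hk' | hk'
    · have := h2 k hk'; have := h5 k hk; have := h5 (k + 1) hk'; omega
    · have hkn : k + 1 = n := by omega
      have h7 : (shift a (c (k + 1)) = shift a (c k) ∧ shift a (w (k + 1)) = shift a (v k)) ∨
          (shift a (c (k + 1)) = shift a (v k) ∧ shift a (w (k + 1)) = shift a (c k)) := by
        rw [shift_inj, shift_inj, shift_inj, shift_inj]; exact h.step k (by omega)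
      have h8 : shift a (v (k + 1)) = shift a b := by rw [hkn, h.last]
      have := h1 k hk
      have := h5 k hk
      omega

end FanChain

namespace FanChain
variable {n : ℕ} {a b : Fin (n + 3)} {D : Finset (Edg (n + 3))} {c w v : ℕ → Fin (n + 3)}

lemma isBnd_start (h : FanChain n a b D c w v) (u : Fin (n + 3)) :
    isBnd s(a, u) ↔ u = c 0 ∨ u = v 0 := by
  obtain ⟨L, R, h1, h2, -, -⟩ := h.exists_coord
  have := h1 0 h.pos
  have := h2 0 h.pos
  have := shift_self a
  have := shift_lt a u
  rw [isBnd_shift a, ← shift_inj (a := a) (x := u), ← shift_inj (a := a) (x := u)]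
  omega

lemma isBnd_end (h : FanChain n a b D c w v) : isBnd s(c n, b) := by
  obtain ⟨L, R, h1, h2, -, h4⟩ := h.exists_coord
  have hp := h.pos
  have := h1 (n - 1) (by omega)
  have h4 := h4 (n - 1) (by omega)
  rw [Nat.sub_add_cancel hp, h.last] at h4
  rw [isBnd_shift a]
  omega

lemma isBnd_w (h : FanChain n a b D c w v) {k : ℕ} (hk : 1 ≤ k) (hkn : k ≤ n) :
    isBnd s(w k, v k) := by
  obtain ⟨L, R, h1, h2, -, h4⟩ := h.exists_coord
  obtain ⟨k, rfl⟩ := Nat.exists_eq_add_of_le' hk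
  have := h4 k hkn
  rw [isBnd_shift a]
  omega

lemma coord_center {L R : ℕ → ℕ}
    (h2 : ∀ k < n, (shift a (c k) = L k ∧ shift a (v k) + R k = n + 3) ∨
      (shift a (v k) = L k ∧ shift a (c k) + R k = n + 3))
    (h4 : ∀ k < n, (shift a (w (k + 1)) = L k ∧ shift a (c (k + 1)) + R k = n + 3 ∧
        shift a (v (k + 1)) = L k + 1) ∨
      (shift a (w (k + 1)) + R k = n + 3 ∧ shift a (c (k + 1)) = L k ∧
        shift a (v (k + 1)) + R k + 1 = n + 3)) (hp : 1 ≤ n) {j : ℕ} (hj : j ≤ n) :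
    ∃ k < n, (k = j ∨ k + 1 = n ∧ j = n) ∧
      (shift a (c j) = L k ∨ shift a (c j) + R k = n + 3) := by
  rcases Nat.lt_or_eq_of_le hj with hj | rfl
  · exact ⟨j, hj, Or.inl rfl, by have := h2 j hj; omega⟩
  · obtain ⟨m, rfl⟩ := Nat.exists_eq_add_of_le' hp
    exact ⟨m, by omega, Or.inr ⟨rfl, rfl⟩, by have := h4 m (by omega); omega⟩

lemma fresh (h : FanChain n a b D c w v) {k j : ℕ} (hk : 1 ≤ k) (hkj : k ≤ j) (hj : j ≤ n) :
    w k ≠ c j ∧ w k ≠ v j := by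
  rcases Nat.eq_or_lt_of_le hkj with rfl | hkj
  · exact ⟨(h.ne k hj).1.symm, (h.ne k hj).2.1⟩
  obtain ⟨L, R, h1, h2, h3, h4⟩ := h.exists_coord
  obtain ⟨k, rfl⟩ := Nat.exists_eq_add_of_le' hk
  obtain ⟨i, hi, hij, hci⟩ := coord_center h2 h4 h.pos hj
  have e1 := h1 k (by omega)
  have e2 := h4 k (by omega)
  have e3 := h1 (k + 1) (by omega)
  have e4 := h2 (k + 1) (by omega)
  have e5 := h1 i hi
  have e6 := h3 (k + 1) i (by omega) hi
  have e7 : shift a (v j) = shift a b ∨ (i = j ∧ j < n) := by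
    rcases Nat.lt_or_eq_of_le hj with hj | rfl
    · right; omega
    · left; rw [h.last]
  have e8 := h2 i hi
  rw [ne_eq, ne_eq, ← shift_inj (a := a), ← shift_inj (a := a)]
  rcases e7 with e7 | ⟨rfl, e7⟩ <;> omega

lemma isBnd_neighbor (h : FanChain n a b D c w v) {k : ℕ} (hk : 1 ≤ k) {u : Fin (n + 3)}
    (hu : isBnd s(w k, u)) (huv : u ≠ v k) {j : ℕ} (hkj : k ≤ j) (hj : j ≤ n) :
    u ≠ c j ∧ u ≠ v j := by
  obtain ⟨L, R, h1, h2, h3, h4⟩ := h.exists_coord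
  obtain ⟨k, rfl⟩ := Nat.exists_eq_add_of_le' hk
  obtain ⟨i, hi, hij, hci⟩ := coord_center h2 h4 h.pos hj
  have e1 := h1 k (by omega)
  have e2 := h4 k (by omega)
  have e5 := h1 i hi
  have e6 := h3 k i (by omega) hi
  have e7 : shift a (v j) = shift a b ∨ (i = j ∧ j < n) := by
    rcases Nat.lt_or_eq_of_le hj with hj | rfl
    · right; omega
    · left; rw [h.last]
  have e8 := h2 i hi
  rw [isBnd_shift a] at hu
  rw [ne_eq, ← shift_inj (a := a)] at huv
  rw [ne_eq, ne_eq, ← shift_inj (a := a), ← shift_inj (a := a)]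
  rcases e7 with e7 | ⟨rfl, e7⟩ <;> omega

lemma first_fresh (h : FanChain n a b D c w v) {j : ℕ} (hj : j ≤ n) : a ≠ c j ∧ a ≠ v j := by
  obtain ⟨L, R, h1, h2, h3, h4⟩ := h.exists_coord
  obtain ⟨i, hi, hij, hci⟩ := coord_center h2 h4 h.pos hj
  have e5 := h1 i hi
  have e7 : shift a (v j) = shift a b ∨ (i = j ∧ j < n) := by
    rcases Nat.lt_or_eq_of_le hj with hj | rfl
    · right; omega
    · left; rw [h.last]
  have e8 := h2 i hi
  have e9 := shift_self a
  rw [ne_eq, ne_eq, ← shift_inj (a := a), ← shift_inj (a := a)]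
  rcases e7 with e7 | ⟨rfl, e7⟩ <;> omega

lemma diagonal_inj (h : FanChain n a b D c w v) {j k : ℕ} (hj : j < n) (hk : k < n)
    (e : s(c j, v j) = s(c k, v k)) : j = k := by
  obtain ⟨L, R, h1, h2, h3, h4⟩ := h.exists_coord
  have := h1 j hj
  have := h1 k hk
  have := h2 j hj
  have := h2 k hk
  rw [Sym2.eq_iff, ← shift_inj (a := a), ← shift_inj (a := a), ← shift_inj (a := a),
    ← shift_inj (a := a)] at e
  omega

lemma not_isBnd_diagonal (h : FanChain n a b D c w v) {k : ℕ} (hk : k < n) :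
    ¬ isBnd s(c k, v k) := h.not_isBnd _ (h.mem k hk)

/-- `q` is the position of a crossing of the arc by a diagonal or `σ`-edge at `x`. -/
def Touches (n : ℕ) (c v : ℕ → Fin (n + 3)) (x : Fin (n + 3)) (q : ℕ) : Prop :=
  (∃ k < n, (x = c k ∨ x = v k) ∧ q = 2 * k + 2) ∨ ∃ k ≤ n, x = c k ∧ q = 2 * k + 1

lemma Touches.coord {x : Fin (n + 3)} {q : ℕ} (hq : Touches n c v x q) {L R : ℕ → ℕ}
    (h2 : ∀ k < n, (shift a (c k) = L k ∧ shift a (v k) + R k = n + 3) ∨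
      (shift a (v k) = L k ∧ shift a (c k) + R k = n + 3))
    (h4 : ∀ k < n, (shift a (w (k + 1)) = L k ∧ shift a (c (k + 1)) + R k = n + 3 ∧
        shift a (v (k + 1)) = L k + 1) ∨
      (shift a (w (k + 1)) + R k = n + 3 ∧ shift a (c (k + 1)) = L k ∧
        shift a (v (k + 1)) + R k + 1 = n + 3)) (hp : 1 ≤ n) :
    ∃ k < n, (shift a x = L k ∨ shift a x + R k = n + 3) ∧ 2 * k + 1 ≤ q ∧
      (q ≤ 2 * k + 2 ∨ k + 1 = n) ∧ q ≤ 2 * n + 1 := by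
  rcases hq with ⟨k, hk, hx, rfl⟩ | ⟨k, hk, rfl, rfl⟩
  · refine ⟨k, hk, ?_, by omega⟩
    have := h2 k hk
    rcases hx with rfl | rfl <;> omega
  · obtain ⟨i, hi, hik, hc⟩ := coord_center h2 h4 hp hk
    exact ⟨i, hi, hc, by omega⟩

/-- Along a boundary edge all crossings at one end precede all crossings at the other. -/
lemma touches_lt (h : FanChain n a b D c w v) {x y : Fin (n + 3)} (hxy : isBnd s(x, y)) :
    ((∀ q q', Touches n c v x q → Touches n c v y q' → q < q') ∧ x ≠ b ∧ y ≠ a) ∨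
    ((∀ q q', Touches n c v y q → Touches n c v x q' → q < q') ∧ y ≠ b ∧ x ≠ a) := by
  obtain ⟨L, R, h1, h2, h3, h4⟩ := h.exists_coord
  have key : ∀ x y : Fin (n + 3), ((shift a y = shift a x + 1 ∧ shift a y ≤ shift a b) ∨
      (shift a x = 0 ∧ shift a y + 1 = n + 3) ∨
      (shift a x = shift a y + 1 ∧ shift a b ≤ shift a y)) →
      ((∀ q q', Touches n c v x q → Touches n c v y q' → q < q') ∧ x ≠ b ∧ y ≠ a) := by
    intro x y hxy
    have h0 := h1 0 h.pos
    have hs := shift_self a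
    refine ⟨?_, ?_, ?_⟩
    · intro q q' hq hq'
      obtain ⟨k, hk, e1, e2⟩ := hq.coord (a := a) h2 h4 h.pos
      obtain ⟨k', hk', e1', e2'⟩ := hq'.coord (a := a) h2 h4 h.pos
      have := h1 k hk
      have := h1 k' hk'
      have hkk : k < k' := by
        by_contra! hlt
        have := h3 k' k hlt hk
        omega
      omega
    · rw [ne_eq, ← shift_inj (a := a)]; omega
    · rw [ne_eq, ← shift_inj (a := a)]; omega
  rw [isBnd_shift a] at hxy
  have := shift_lt a x
  have := shift_lt a y
  by_cases h' : (shift a y = shift a x + 1 ∧ shift a y ≤ shift a b) ∨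
      (shift a x = 0 ∧ shift a y + 1 = n + 3) ∨
      (shift a x = shift a y + 1 ∧ shift a b ≤ shift a y)
  · exact Or.inl (key x y h')
  · exact Or.inr (key y x (by omega))

end FanChain

section Paths

variable {n : ℕ} (b : Fin (n + 3)) (D0 : Finset (Edg (n + 3)))
  (ctr : Fin (n + 1) → Fin (n + 3)) (dsp : Fin n → Fin (n + 3) × Fin (n + 3))

open Classical in
/-- The position reached after a step from position `m`. -/
noncomputable def nextPos (p : VV n × VV n) (m : ℕ) : ℕ :=
  if h : ∃ q, cpos dsp p q then h.choose else m

/-- The step from `x` to `y` is allowed after `par` steps that reached position `m`. -/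
def IsStep (par m : ℕ) (x y : VV n) : Prop :=
  jn D0 ctr x y ∧ (Odd par → ∃ q, cpos dsp (x, y) q) ∧ (isSig (x, y) → Odd par) ∧
    (isTau (x, y) → Even par) ∧ ∀ q, cpos dsp (x, y) q → m < q

/-- The list of vertices completes a path that reached `x` and position `m` after `par` steps. -/
def IsPath : ℕ → ℕ → VV n → List (VV n) → Prop
  | par, _, x, [] => Odd par ∧ x = inl b
  | par, m, x, y :: l => IsStep D0 ctr dsp par m x y ∧ IsPath (par + 1) (nextPos dsp (x, y) m) y l

/-- The conditions on a super `T`-path, except for distinctness of edges, for a path starting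
after `par` steps that reached position `m`. -/
structure PathFrom (par m len : ℕ) (vert : Fin (len + 1) → VV n) : Prop where
  odd_len : Odd (par + len)
  last_eq : vert (Fin.last len) = inl b
  isStep : ∀ i : Fin len, IsStep D0 ctr dsp (par + i.val) m (vert i.castSucc) (vert i.succ)
  mono : ∀ i i' : Fin len, i < i' → ∀ q q',
    cpos dsp (vert i.castSucc, vert i.succ) q →
    cpos dsp (vert i'.castSucc, vert i'.succ) q' → q < q'

variable {b D0 ctr dsp}

/-- The diagonals are numbered injectively. -/
def InjDsp (dsp : Fin n → Fin (n + 3) × Fin (n + 3)) : Prop :=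
  ∀ j k, s((dsp j).1, (dsp j).2) = s((dsp k).1, (dsp k).2) → j = k

lemma cpos_unique (hd : InjDsp dsp) {p : VV n × VV n} {q q' : ℕ} (h : cpos dsp p q)
    (h' : cpos dsp p q') : q = q' := by
  obtain ⟨x | k, y | k'⟩ := p
  · obtain ⟨j, hj, rfl⟩ := h
    obtain ⟨j', hj', rfl⟩ := h'
    rw [hd j j' (hj.symm.trans hj')]
  · exact h.trans h'.symm
  · exact h.trans h'.symm
  · exact h.elim

lemma cpos_swap {x y : VV n} {q : ℕ} (h : cpos dsp (x, y) q) : cpos dsp (y, x) q := by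
  rcases x with x | k <;> rcases y with y | k'
  · obtain ⟨j, hj, rfl⟩ := h
    exact ⟨j, by rw [← hj, Sym2.eq_swap], rfl⟩
  · exact h
  · exact h
  · exact h

lemma nextPos_eq (hd : InjDsp dsp) {p : VV n × VV n} {m q : ℕ} (h : cpos dsp p q) :
    nextPos dsp p m = q := by
  have h' : ∃ q, cpos dsp p q := ⟨q, h⟩
  rw [nextPos, dif_pos h']
  exact cpos_unique hd h'.choose_spec h

lemma nextPos_of_not {p : VV n × VV n} {m : ℕ} (h : ¬ ∃ q, cpos dsp p q) :
    nextPos dsp p m = m := by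
  rw [nextPos, dif_neg h]

lemma pathFrom_succ (hd : InjDsp dsp) (par m len : ℕ) (vert : Fin (len + 1 + 1) → VV n) :
    PathFrom b D0 ctr dsp par m (len + 1) vert ↔
      IsStep D0 ctr dsp par m (vert 0) (vert 1) ∧
      PathFrom b D0 ctr dsp (par + 1) (nextPos dsp (vert 0, vert 1) m) len
        (fun i => vert i.succ) := by
  constructor
  · intro h
    have h0 := h.isStep 0
    refine ⟨h0, ⟨?_, h.last_eq, ?_, ?_⟩⟩
    · have := h.odd_len; rwa [show par + 1 + len = par + (len + 1) by omega]
    · intro i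
      obtain ⟨s1, s2, s3, s4, s5⟩ := h.isStep i.succ
      rw [show par + (i.succ : Fin (len + 1)).val = par + 1 + i.val by
        rw [Fin.val_succ]; omega] at s2 s3 s4
      refine ⟨s1, s2, s3, s4, fun q hq => ?_⟩
      by_cases hc : ∃ q, cpos dsp (vert 0, vert 1) q
      · obtain ⟨q', hq'⟩ := hc
        rw [nextPos_eq hd hq']
        exact h.mono 0 i.succ (Fin.succ_pos i) q' q hq' hq
      · rw [nextPos_of_not hc]; exact s5 q hq
    · intro i i' hi q q' hq hq'
      exact h.mono i.succ i'.succ (Fin.succ_lt_succ_iff.2 hi) q q' hq hq'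
  · rintro ⟨h0, h⟩
    have h5 : ∀ i : Fin len, ∀ q, cpos dsp (vert i.castSucc.succ, vert i.succ.succ) q → m < q := by
      intro i q hq
      have h1 := (h.isStep i).2.2.2.2 q hq
      by_cases hc : ∃ q, cpos dsp (vert 0, vert 1) q
      · obtain ⟨q', hq'⟩ := hc
        rw [nextPos_eq hd hq'] at h1
        exact (h0.2.2.2.2 q' hq').trans h1
      · rwa [nextPos_of_not hc] at h1
    refine ⟨?_, h.last_eq, ?_, ?_⟩
    · have := h.odd_len; rwa [show par + (len + 1) = par + 1 + len by omega]
    · refine Fin.cases h0 fun i => ?_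
      obtain ⟨s1, s2, s3, s4, s5⟩ := h.isStep i
      rw [show par + 1 + i.val = par + (i.succ : Fin (len + 1)).val by
        rw [Fin.val_succ]; omega] at s2 s3 s4
      exact ⟨s1, s2, s3, s4, h5 i⟩
    · refine Fin.cases ?_ fun i => ?_
      · refine Fin.cases (fun hi => absurd hi (lt_irrefl _)) fun i' _ q q' hq hq' => ?_
        have h1 := (h.isStep i').2.2.2.2 q' hq'
        rwa [show nextPos dsp (vert 0, vert 1) m = q from nextPos_eq hd hq] at h1
      · refine Fin.cases (fun hi => absurd hi (Fin.not_lt_zero _)) fun i' hi q q' hq hq' => ?_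
        exact h.mono i i' (Fin.succ_lt_succ_iff.1 hi) q q' hq hq'

lemma pathFrom_iff (hd : InjDsp dsp) (len : ℕ) : ∀ (par m : ℕ) (vert : Fin (len + 1) → VV n),
    PathFrom b D0 ctr dsp par m len vert ↔
      IsPath b D0 ctr dsp par m (vert 0) (List.ofFn fun i : Fin len => vert i.succ) := by
  induction len with
  | zero =>
    intro par m vert
    rw [List.ofFn_zero, IsPath]
    exact ⟨fun h => ⟨h.odd_len, h.last_eq⟩, fun h => ⟨h.1, h.2, fun i => i.elim0,
      fun i => i.elim0⟩⟩
  | succ len ih =>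
    intro par m vert
    rw [pathFrom_succ hd, List.ofFn_succ, IsPath, ih]
    rfl

lemma SuperTPath.pathFrom {a : Fin (n + 3)} (t : SuperTPath n a b D0 ctr dsp) :
    PathFrom b D0 ctr dsp 0 0 t.len t.vert := by
  refine ⟨by rw [zero_add]; exact t.odd_len, t.last_eq, fun i => ?_, t.cross_mono⟩
  rw [zero_add]
  refine ⟨t.joins i, t.even_cross i, t.sig_even i, t.tau_odd i, fun q hq => ?_⟩
  rcases hx : t.vert i.castSucc with x | k <;> rcases hy : t.vert i.succ with y | k' <;>
    rw [hx, hy] at hq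
  · obtain ⟨k, -, rfl⟩ := hq; omega
  · have : q = _ := hq
    omega
  · have : q = _ := hq
    omega
  · exact hq.elim

end Paths

section Paths

variable {n : ℕ} {b : Fin (n + 3)} {D0 : Finset (Edg (n + 3))}
  {ctr : Fin (n + 1) → Fin (n + 3)} {dsp : Fin n → Fin (n + 3) × Fin (n + 3)}

lemma jn_symm {x y : VV n} (h : jn D0 ctr x y) : jn D0 ctr y x := by
  rcases x with x | k <;> rcases y with y | k'
  · exact ⟨h.1.symm, by rw [Sym2.eq_swap]; exact h.2⟩
  · exact h
  · exact h
  · exact Ne.symm h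

/-- All crossings at `x` precede all crossings at `y`. -/
def Precedes (a b : Fin (n + 3)) (D0 : Finset (Edg (n + 3)))
    (ctr : Fin (n + 1) → Fin (n + 3)) (dsp : Fin n → Fin (n + 3) × Fin (n + 3))
    (x y : VV n) : Prop :=
  (∀ z z' q q', jn D0 ctr x z → cpos dsp (x, z) q → jn D0 ctr y z' → cpos dsp (y, z') q' →
    q < q') ∧ x ≠ inl b ∧ y ≠ inl a

lemma PathFrom.edges_distinct {a : Fin (n + 3)} {len : ℕ} {vert : Fin (len + 1) → VV n}
    (hd : InjDsp dsp)
    (hsep : ∀ x y, jn D0 ctr x y → (¬ ∃ q, cpos dsp (x, y) q) →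
      Precedes a b D0 ctr dsp x y ∨ Precedes a b D0 ctr dsp y x)
    (h : PathFrom b D0 ctr dsp 0 0 len vert) (ha : vert 0 = inl a) (i i' : Fin len) (hi : i ≠ i') :
    ¬ pairEqV (vert i.castSucc, vert i.succ) (vert i'.castSucc, vert i'.succ) := by
  obtain ⟨f, hf⟩ : ∃ f : ℕ → VV n, ∀ k : Fin (len + 1), vert k = f k.val :=
    ⟨fun k => if h : k < len + 1 then vert ⟨k, h⟩ else inl b, fun k => by simp only [k.isLt, dif_pos]⟩
  have step : ∀ i < len, jn D0 ctr (f i) (f (i + 1)) ∧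
      (Odd i → ∃ q, cpos dsp (f i, f (i + 1)) q) := by
    intro i hi
    obtain ⟨h1, h2, -⟩ := h.isStep ⟨i, hi⟩
    rw [zero_add] at h2
    rw [hf, hf] at h1 h2
    exact ⟨h1, h2⟩
  have mono : ∀ i i' q q', i < i' → i' < len → cpos dsp (f i, f (i + 1)) q →
      cpos dsp (f i', f (i' + 1)) q' → q < q' := by
    intro i i' q q' hii hi' hq hq'
    refine h.mono ⟨i, hii.trans hi'⟩ ⟨i', hi'⟩ hii q q' ?_ ?_
    · rw [hf, hf]; exact hq
    · rw [hf, hf]; exact hq'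
  have h0 : f 0 = inl a := by rw [← ha, hf]; rfl
  have hl : f len = inl b := by rw [← h.last_eq, hf]; rfl
  have key : ∀ i i', i < i' → i' < len →
      ¬ pairEqV (f i, f (i + 1)) (f i', f (i' + 1)) := by
    intro i i' hii hi' hp
    have hi := hii.trans hi'
    by_cases hc : ∃ q, cpos dsp (f i, f (i + 1)) q
    · obtain ⟨q, hq⟩ := hc
      refine lt_irrefl q (mono i i' q q hii hi' hq ?_)
      rcases hp with ⟨e1, e2⟩ | ⟨e1, e2⟩ <;> simp only at e1 e2
      · rw [← e1, ← e2]; exact hq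
      · rw [← e1, ← e2]; exact cpos_swap hq
    have hc' : ¬ ∃ q, cpos dsp (f i', f (i' + 1)) q := by
      rintro ⟨q, hq⟩
      refine hc ⟨q, ?_⟩
      rcases hp with ⟨e1, e2⟩ | ⟨e1, e2⟩ <;> simp only at e1 e2
      · rw [e1, e2]; exact hq
      · rw [e1, e2]; exact cpos_swap hq
    have ei : Even i := Nat.not_odd_iff_even.1 fun ho => hc ((step i hi).2 ho)
    have ei' : Even i' := Nat.not_odd_iff_even.1 fun ho => hc' ((step i' hi').2 ho)
    have hii2 : i + 2 ≤ i' := by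
      obtain ⟨x, rfl⟩ := ei; obtain ⟨y, rfl⟩ := ei'; omega
    obtain ⟨j1, s1⟩ := step (i + 1) (by omega)
    obtain ⟨q1, hq1⟩ := s1 ei.add_one
    rcases hsep _ _ (step i hi).1 hc with ⟨hs, hb, -⟩ | ⟨hs, -, ha'⟩
    · rcases hp with ⟨e1, -⟩ | ⟨e2, -⟩
      · simp only at e1
        obtain ⟨m, rfl⟩ : ∃ m, i' = m + 1 := ⟨i' - 1, by omega⟩
        have om : Odd m := by
          by_contra hm
          exact Nat.not_even_iff_odd.2 (Nat.not_odd_iff_even.1 hm).add_one ei'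
        obtain ⟨j2, s2⟩ := step m (by omega)
        obtain ⟨q2, hq2⟩ := s2 om
        have lt := hs (f m) _ q2 q1 (by rw [e1]; exact jn_symm j2)
          (by rw [e1]; exact cpos_swap hq2) j1 hq1
        rcases Nat.lt_or_eq_of_le (show i + 1 ≤ m by omega) with hlt | rfl
        · exact absurd (mono _ _ _ _ hlt (by omega) hq1 hq2) (by omega)
        · rw [cpos_unique hd hq1 hq2] at lt; exact lt_irrefl _ lt
      · simp only at e2
        have hne : i' + 1 ≠ len := by
          rintro rfl
          rw [← e2] at hl
          exact hb hl
        obtain ⟨j3, s3⟩ := step (i' + 1) (by omega)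
        obtain ⟨q3, hq3⟩ := s3 ei'.add_one
        have lt := hs _ _ q3 q1 (by rw [e2]; exact j3) (by rw [e2]; exact hq3) j1 hq1
        exact absurd (mono _ _ _ _ (by omega) (by omega) hq1 hq3) (by omega)
    · rcases i with _ | m
      · exact ha' h0
      · have om : Odd m := by
          by_contra hm
          exact Nat.not_even_iff_odd.2 (Nat.not_odd_iff_even.1 hm).add_one ei
        obtain ⟨j2, s2⟩ := step m (by omega)
        obtain ⟨q2, hq2⟩ := s2 om
        have lt := hs _ _ q1 q2 j1 hq1 (jn_symm j2) (cpos_swap hq2)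
        exact absurd (mono _ _ _ _ (by omega) (by omega) hq2 hq1) (by omega)
  rw [hf, hf, hf, hf]
  rcases lt_or_gt_of_ne hi with hlt | hlt
  · exact key _ _ hlt i'.isLt
  · intro hp
    refine key _ _ hlt i.isLt ?_
    rcases hp with ⟨e1, e2⟩ | ⟨e1, e2⟩
    · exact Or.inl ⟨e1.symm, e2.symm⟩
    · exact Or.inr ⟨e2.symm, e1.symm⟩

/-- The vertices of a super `T`-path after the first. -/
def SuperTPath.tail {a : Fin (n + 3)} (t : SuperTPath n a b D0 ctr dsp) : List (VV n) :=
  List.ofFn fun i : Fin t.len => t.vert i.succ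

lemma SuperTPath.tail_injective {a : Fin (n + 3)} :
    Function.Injective (SuperTPath.tail : SuperTPath n a b D0 ctr dsp → List (VV n)) := by
  rintro ⟨l, f, a1, a2, a3, a4, a5, a6, a7, a8, a9⟩ ⟨l', f', b1, b2, b3, b4, b5, b6, b7, b8, b9⟩ h
  have hl : l = l' := by
    have := congrArg List.length h
    simpa only [SuperTPath.tail, List.length_ofFn] using this
  subst hl
  have hf : f = f' := by
    funext i
    refine Fin.cases (a2.trans b2.symm) (fun i => ?_) i
    exact congrFun (List.ofFn_injective h) i
  subst hf
  rfl

lemma SuperTPath.range_tail {a : Fin (n + 3)} (hd : InjDsp dsp)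
    (hsep : ∀ x y, jn D0 ctr x y → (¬ ∃ q, cpos dsp (x, y) q) →
      Precedes a b D0 ctr dsp x y ∨ Precedes a b D0 ctr dsp y x) (l : List (VV n)) :
    IsPath b D0 ctr dsp 0 0 (inl a) l ↔ ∃ t : SuperTPath n a b D0 ctr dsp, t.tail = l := by
  constructor
  · intro h
    obtain ⟨vert, h0, hv⟩ : ∃ vert : Fin (l.length + 1) → VV n, vert 0 = inl a ∧
        (List.ofFn fun i : Fin l.length => vert i.succ) = l := by
      refine ⟨Fin.cons (inl a) l.get, rfl, ?_⟩
      simp only [Fin.cons_succ]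
      exact List.ofFn_get l
    have hp : PathFrom b D0 ctr dsp 0 0 l.length vert := by
      rw [pathFrom_iff hd, h0, hv]; exact h
    have hs := hp.isStep
    simp only [zero_add] at hs
    exact ⟨⟨l.length, vert, by have := hp.odd_len; rwa [zero_add] at this, h0, hp.last_eq,
      fun i => (hs i).1, hp.edges_distinct hd hsep h0, fun i => (hs i).2.1,
      fun i => (hs i).2.2.1, fun i => (hs i).2.2.2.1, hp.mono⟩, hv⟩
  · rintro ⟨t, rfl⟩
    have := (pathFrom_iff hd _ _ _ _).1 t.pathFrom
    rwa [t.first_eq] at this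

variable {A : Type*} [Ring A] (lam0 : Edg (n + 3) → A) (mu0 : Finset (Fin (n + 3)) → A)
  (sqrt : A → A) (le : Fin (n + 1) → Fin (n + 1) → Bool) (tri : Fin (n + 1) → Finset (Fin (n + 3)))
  (ctr : Fin (n + 1) → Fin (n + 3)) (oth : Fin (n + 1) → Fin (n + 3) × Fin (n + 3))

/-- The even part of the weight of a path continuing from `x` after `par` steps. -/
noncomputable def evenWt : ℕ → VV n → List (VV n) → A
  | _, _, [] => 1
  | par, x, y :: l => stepWt lam0 sqrt ctr oth par (x, y) * evenWt (par + 1) y l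

/-- The indices of the `σ`-edges of a path. -/
def sigList : VV n → List (VV n) → List (Fin (n + 1))
  | _, [] => []
  | x, y :: l => (sigIdx (x, y)).toList ++ sigList y l

/-- The odd part of the weight of a path. -/
noncomputable def oddWt (l : List (Fin (n + 1))) : A :=
  ((sortB le l).map fun k => mu0 (tri k)).prod

/-- The weight of a path continuing from `x` after `par` steps. -/
noncomputable def pathWt (par : ℕ) (x : VV n) (l : List (VV n)) : A :=
  evenWt lam0 sqrt ctr oth par x l * oddWt mu0 le tri (sigList x l)

lemma evenWt_ofFn (len : ℕ) : ∀ (par : ℕ) (vert : Fin (len + 1) → VV n),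
    ((List.finRange len).map (fun i => stepWt lam0 sqrt ctr oth (par + i.val)
      (vert i.castSucc, vert i.succ))).prod =
    evenWt lam0 sqrt ctr oth par (vert 0) (List.ofFn fun i : Fin len => vert i.succ) := by
  induction len with
  | zero => intro par vert; rfl
  | succ len ih =>
    intro par vert
    rw [List.finRange_succ, List.map_cons, List.prod_cons, List.map_map, List.ofFn_succ, evenWt,
      ← ih (par + 1) fun i => vert i.succ]
    congr 1
    refine congrArg List.prod (List.map_congr_left fun i _ => ?_)
    simp only [Function.comp, Fin.val_succ]
    rw [show par + (i.val + 1) = par + 1 + i.val by omega]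
    rfl

lemma sigList_ofFn (len : ℕ) : ∀ (vert : Fin (len + 1) → VV n),
    (List.finRange len).filterMap (fun i => sigIdx (vert i.castSucc, vert i.succ)) =
    sigList (vert 0) (List.ofFn fun i : Fin len => vert i.succ) := by
  induction len with
  | zero => intro vert; rfl
  | succ len ih =>
    intro vert
    rw [List.finRange_succ, List.ofFn_succ, sigList, ← ih fun i => vert i.succ,
      List.filterMap_cons, List.filterMap_map]
    cases h : sigIdx (vert (Fin.castSucc 0), vert (Fin.succ 0)) with
    | none =>
      rw [show sigIdx (vert 0, vert (Fin.succ 0)) = none from h]; rfl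
    | some k =>
      rw [show sigIdx (vert 0, vert (Fin.succ 0)) = some k from h]; rfl

lemma finsum_wt {a : Fin (n + 3)} (o : Edg (n + 3) → Bool) (hd : InjDsp dsp)
    (hsep : ∀ x y, jn D0 ctr x y → (¬ ∃ q, cpos dsp (x, y) q) →
      Precedes a b D0 ctr dsp x y ∨ Precedes a b D0 ctr dsp y x) :
    ∑ᶠ t : SuperTPath n a b D0 ctr dsp, wt lam0 mu0 sqrt o tri ctr oth t =
      ∑ᶠ l ∈ {l | IsPath b D0 ctr dsp 0 0 (inl a) l},
        pathWt lam0 mu0 sqrt (posB o dsp a) tri ctr oth 0 (inl a) l := by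
  have hr : {l | IsPath b D0 ctr dsp 0 0 (inl a) l} =
      Set.range (SuperTPath.tail : SuperTPath n a b D0 ctr dsp → List (VV n)) := by
    ext l; exact SuperTPath.range_tail hd hsep l
  rw [hr, finsum_mem_range SuperTPath.tail_injective]
  refine finsum_congr fun t => ?_
  rw [wt, pathWt, sigList_ofFn, ← t.first_eq, SuperTPath.tail, ← evenWt_ofFn]
  simp only [zero_add]
  rfl

end Paths

lemma finsum_mem_list {V M : Type*} [Fintype V] [AddCommMonoid M] {S : Set (List V)}
    (hS : S.Finite) (f : List V → M) [Decidable ([] ∈ S)] :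
    ∑ᶠ l ∈ S, f l = (if [] ∈ S then f [] else 0) + ∑ y, ∑ᶠ l ∈ {l | y :: l ∈ S}, f (y :: l) := by
  have e : S = (S ∩ {[]}) ∪ ⋃ y, List.cons y '' {l | y :: l ∈ S} := by
    ext l
    rcases l with _ | ⟨y, l⟩ <;> simp
  have fin : ∀ y, (List.cons y '' {l | y :: l ∈ S}).Finite := fun y =>
    hS.subset (by rintro _ ⟨l, hl, rfl⟩; exact hl)
  conv_lhs => rw [e]
  rw [finsum_mem_union (Set.disjoint_left.2 ?_) (hS.subset Set.inter_subset_left)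
    (Set.finite_iUnion fin), finsum_mem_iUnion ?_ fin, finsum_eq_sum_of_fintype (α := V)]
  · congr 1
    · split_ifs with h
      · rw [Set.inter_eq_right.2 (Set.singleton_subset_iff.2 h), finsum_mem_singleton]
      · rw [Set.inter_singleton_eq_empty.2 h, finsum_mem_empty]
    · refine Finset.sum_congr rfl fun y _ => ?_
      exact finsum_mem_image (List.cons_injective.injOn)
  · intro y y' hy
    refine Set.disjoint_left.2 ?_
    rintro _ ⟨l, -, rfl⟩ ⟨l', -, h⟩
    exact hy (List.cons.inj h).1.symm
  · rintro l ⟨-, rfl⟩ h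
    obtain ⟨y, l, -, h⟩ := Set.mem_iUnion.1 h
    cases h

lemma mem_insB {α : Type*} {le : α → α → Bool} {x y : α} {l : List α} (h : y ∈ insB le x l) :
    y = x ∨ y ∈ l := by
  induction l with
  | nil => simpa [insB] using h
  | cons z t ih =>
    rw [insB] at h
    split_ifs at h
    · simpa using h
    · rcases List.mem_cons.1 h with rfl | h
      · simp
      · rcases ih h with h | h <;> simp [h]

lemma mem_sortB {α : Type*} {le : α → α → Bool} {y : α} {l : List α} (h : y ∈ sortB le l) :
    y ∈ l := by
  induction l with
  | nil => exact h
  | cons z t ih =>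
    rcases mem_insB h with rfl | h
    · simp
    · exact List.mem_cons_of_mem _ (ih h)

lemma insB_of_le {α : Type*} {le : α → α → Bool} {x : α} {l : List α}
    (h : ∀ y ∈ l, le x y = true) : insB le x l = x :: l := by
  cases l with
  | nil => rfl
  | cons z t => rw [insB, if_pos (h z (by simp))]

lemma insB_of_not_le {α : Type*} {le : α → α → Bool} {x : α} {l : List α}
    (h : ∀ y ∈ l, le x y = false) : insB le x l = l ++ [x] := by
  induction l with
  | nil => rfl
  | cons z t ih =>
    rw [insB, h z (by simp), ih fun y hy => h y (List.mem_cons_of_mem _ hy)]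
    rfl

section Paths

variable {n : ℕ} {b : Fin (n + 3)} {D0 : Finset (Edg (n + 3))}
  {ctr : Fin (n + 1) → Fin (n + 3)} {dsp : Fin n → Fin (n + 3) × Fin (n + 3)}

lemma cpos_le {p : VV n × VV n} {q : ℕ} (h : cpos dsp p q) : q ≤ 2 * n + 1 := by
  obtain ⟨x | k, y | k'⟩ := p
  · obtain ⟨j, -, rfl⟩ := h
    have := j.isLt; omega
  · have h : q = _ := h
    have := k'.isLt; omega
  · have h : q = _ := h
    have := k.isLt; omega
  · exact h.elim

lemma IsStep.le_nextPos {par m : ℕ} {x y : VV n} (h : IsStep D0 ctr dsp par m x y) :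
    m ≤ nextPos dsp (x, y) m := by
  by_cases hc : ∃ q, cpos dsp (x, y) q
  · rw [nextPos, dif_pos hc]; exact (h.2.2.2.2 _ hc.choose_spec).le
  · rw [nextPos_of_not hc]

lemma IsPath.length_le {l : List (VV n)} : ∀ {par m : ℕ} {x : VV n},
    IsPath b D0 ctr dsp par m x l →
    l.length + 2 * m ≤ 2 * max m (2 * n + 1) + if Odd par then 0 else 1 := by
  induction l with
  | nil => intro par m x _; simp only [List.length_nil]; omega
  | cons y l ih =>
    rintro par m x ⟨h1, h2⟩
    have h3 := ih h2
    rw [List.length_cons]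
    by_cases ho : Odd par
    · obtain ⟨q, hq⟩ := h1.2.1 ho
      have hc : ∃ q, cpos dsp (x, y) q := ⟨q, hq⟩
      have h4 : m < nextPos dsp (x, y) m := by
        rw [nextPos, dif_pos hc]; exact h1.2.2.2.2 _ hc.choose_spec
      have h5 : nextPos dsp (x, y) m ≤ 2 * n + 1 := by
        rw [nextPos, dif_pos hc]; exact cpos_le hc.choose_spec
      rw [if_pos ho]
      split_ifs at h3 <;> omega
    · have h4 := h1.le_nextPos
      have h5 : nextPos dsp (x, y) m = m ∨ nextPos dsp (x, y) m ≤ 2 * n + 1 := by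
        by_cases hc : ∃ q, cpos dsp (x, y) q
        · right; rw [nextPos, dif_pos hc]; exact cpos_le hc.choose_spec
        · left; exact nextPos_of_not hc
      rw [if_pos (Nat.not_odd_iff_even.1 ho).add_one] at h3
      rw [if_neg ho]
      omega

lemma finite_isPath (par m : ℕ) (x : VV n) : {l | IsPath b D0 ctr dsp par m x l}.Finite := by
  refine (List.finite_length_le (VV n) (2 * max m (2 * n + 1) + 1)).subset fun l hl => ?_
  have := hl.length_le
  simp only [Set.mem_ofPred_eq]
  split_ifs at this <;> omega

lemma IsPath.lt_of_mem_sigList {l : List (VV n)} : ∀ {par m : ℕ} {x : VV n},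
    IsPath b D0 ctr dsp par m x l → ∀ k ∈ sigList x l, m < 2 * k.val + 1 := by
  induction l with
  | nil => intro par m x _ k hk; cases hk
  | cons y l ih =>
    rintro par m x ⟨h1, h2⟩ k hk
    rw [sigList, List.mem_append] at hk
    rcases hk with hk | hk
    · refine h1.2.2.2.2 _ ?_
      rw [Option.mem_toList] at hk
      rcases x with x | j <;> rcases y with y | j'
      · cases hk
      · cases hk; exact rfl
      · cases hk; exact rfl
      · cases hk
    · exact h1.le_nextPos.trans_lt (ih h2 k hk)

lemma isPath_add_two (l : List (VV n)) : ∀ (par m : ℕ) (x : VV n),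
    IsPath b D0 ctr dsp (par + 2) m x l ↔ IsPath b D0 ctr dsp par m x l := by
  have ho : ∀ par : ℕ, Odd (par + 2) ↔ Odd par := fun par => by
    rw [Nat.odd_add]; simp
  have he : ∀ par : ℕ, Even (par + 2) ↔ Even par := fun par => by
    rw [Nat.even_add]; simp
  induction l with
  | nil => intro par m x; rw [IsPath, IsPath, ho]
  | cons y l ih =>
    intro par m x
    rw [IsPath, IsPath, show par + 2 + 1 = par + 1 + 2 by omega, ih, IsStep, IsStep, ho, he]

variable {A : Type*} [Ring A] (lam0 : Edg (n + 3) → A) (mu0 : Finset (Fin (n + 3)) → A)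
  (sqrt : A → A) (le : Fin (n + 1) → Fin (n + 1) → Bool) (tri : Fin (n + 1) → Finset (Fin (n + 3)))
  (oth : Fin (n + 1) → Fin (n + 3) × Fin (n + 3))

lemma stepWt_add_two (par : ℕ) (p : VV n × VV n) :
    stepWt lam0 sqrt ctr oth (par + 2) p = stepWt lam0 sqrt ctr oth par p := by
  obtain ⟨x | k, y | k'⟩ := p
  · rw [stepWt, stepWt, Nat.add_mod_right]
  all_goals rfl

lemma evenWt_add_two (l : List (VV n)) : ∀ (par : ℕ) (x : VV n),
    evenWt lam0 sqrt ctr oth (par + 2) x l = evenWt lam0 sqrt ctr oth par x l := by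
  induction l with
  | nil => intro par x; rfl
  | cons y l ih =>
    intro par x
    rw [evenWt, evenWt, show par + 2 + 1 = par + 1 + 2 by omega, ih, stepWt_add_two]

variable (b D0 ctr dsp) in
/-- The sum of the weights of the paths continuing from `x`. -/
noncomputable def pathSum (par m : ℕ) (x : VV n) : A :=
  ∑ᶠ l ∈ {l | IsPath b D0 ctr dsp par m x l}, pathWt lam0 mu0 sqrt le tri ctr oth par x l

lemma pathSum_add_two (par m : ℕ) (x : VV n) :
    pathSum b D0 ctr dsp lam0 mu0 sqrt le tri oth (par + 2) m x =
      pathSum b D0 ctr dsp lam0 mu0 sqrt le tri oth par m x := by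
  unfold pathSum
  simp only [isPath_add_two, pathWt, evenWt_add_two]

/-- Multiplication by `θ k` from the left or from the right. -/
def starHom (θ : Fin (n + 1) → A) (r : Fin (n + 1) → Bool) (k : Fin (n + 1)) : A →+ A :=
  if r k then AddMonoidHom.mulLeft (θ k) else AddMonoidHom.mulRight (θ k)

lemma oddWt_cons {r : Fin (n + 1) → Bool} (hle : ∀ k k', k < k' → le k k' = r k) {k : Fin (n + 1)}
    {l : List (Fin (n + 1))} (hl : ∀ k' ∈ l, k < k') :
    oddWt mu0 le tri (k :: l) = starHom (fun k => mu0 (tri k)) r k (oddWt mu0 le tri l) := by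
  have hl' : ∀ y ∈ sortB le l, le k y = r k := fun y hy => hle k y (hl y (mem_sortB hy))
  rw [oddWt, sortB, starHom]
  cases hr : r k
  · rw [insB_of_not_le (by rw [← hr]; exact hl'), List.map_append, List.prod_append]
    simp [oddWt]
  · rw [insB_of_le (by rw [← hr]; exact hl'), List.map_cons, List.prod_cons]
    simp [oddWt]

variable (ctr) in
/-- The effect of a first step on the sum of the weights of its continuations. -/
noncomputable def stepHom (r : Fin (n + 1) → Bool) (par : ℕ) (p : VV n × VV n) : A →+ A :=
  (AddMonoidHom.mulLeft (stepWt lam0 sqrt ctr oth par p)).comp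
    (match sigIdx p with
    | none => AddMonoidHom.id A
    | some k => starHom (fun k => mu0 (tri k)) r k)

lemma evenWt_comm
    (hcent : ∀ par m x y, IsStep D0 ctr dsp par m x y → ∀ z,
      Commute (stepWt lam0 sqrt ctr oth par (x, y)) z) {l : List (VV n)} :
    ∀ {par m : ℕ} {x : VV n}, IsPath b D0 ctr dsp par m x l → ∀ z,
      Commute (evenWt lam0 sqrt ctr oth par x l) z := by
  induction l with
  | nil => intro par m x _ z; exact Commute.one_left z
  | cons y l ih =>
    rintro par m x ⟨h1, h2⟩ z
    exact (hcent _ _ _ _ h1 z).mul_left (ih h2 z)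

lemma pathWt_cons (hd : InjDsp dsp) {r : Fin (n + 1) → Bool}
    (hle : ∀ k k', k < k' → le k k' = r k)
    (hcent : ∀ par m x y, IsStep D0 ctr dsp par m x y → ∀ z,
      Commute (stepWt lam0 sqrt ctr oth par (x, y)) z) {par m : ℕ} {x y : VV n} {l : List (VV n)}
    (h : IsPath b D0 ctr dsp par m x (y :: l)) :
    pathWt lam0 mu0 sqrt le tri ctr oth par x (y :: l) =
      stepHom ctr lam0 mu0 sqrt tri oth r par (x, y)
        (pathWt lam0 mu0 sqrt le tri ctr oth (par + 1) y l) := by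
  have hc := evenWt_comm lam0 sqrt oth hcent h.2
  have hs := h.2.lt_of_mem_sigList
  have key : ∀ k, cpos dsp (x, y) (2 * k.val + 1) → sigIdx (x, y) = some k →
      pathWt lam0 mu0 sqrt le tri ctr oth par x (y :: l) =
      stepHom ctr lam0 mu0 sqrt tri oth r par (x, y)
        (pathWt lam0 mu0 sqrt le tri ctr oth (par + 1) y l) := by
    intro k hk e
    have hlt : ∀ k' ∈ sigList y l, k < k' := fun k' hk' => by
      have := hs k' hk'
      rw [nextPos_eq hd hk] at this
      rw [Fin.lt_def]; omega
    rw [pathWt, pathWt, evenWt, sigList, stepHom, e, Option.toList_some, List.singleton_append,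
      oddWt_cons mu0 le tri hle hlt, mul_assoc]
    simp only [AddMonoidHom.comp_apply, AddMonoidHom.coe_mulLeft, starHom]
    congr 1
    split_ifs
    · rw [AddMonoidHom.coe_mulLeft]
      rw [← mul_assoc, (hc _).eq, mul_assoc]
    · simp only [AddMonoidHom.mulRight_apply]
      rw [mul_assoc]
  rcases x with x | k <;> rcases y with y | k'
  · rw [pathWt, pathWt, evenWt, sigList, stepHom, mul_assoc]; rfl
  · exact key k' rfl rfl
  · exact key k rfl rfl
  · rw [pathWt, pathWt, evenWt, sigList, stepHom, mul_assoc]; rfl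

open Classical in
lemma pathSum_eq (hd : InjDsp dsp) {r : Fin (n + 1) → Bool}
    (hle : ∀ k k', k < k' → le k k' = r k)
    (hcent : ∀ par m x y, IsStep D0 ctr dsp par m x y → ∀ z,
      Commute (stepWt lam0 sqrt ctr oth par (x, y)) z) (par m : ℕ) (x : VV n) :
    pathSum b D0 ctr dsp lam0 mu0 sqrt le tri oth par m x =
      (if Odd par ∧ x = inl b then 1 else 0) +
      ∑ y, if IsStep D0 ctr dsp par m x y then
        stepHom ctr lam0 mu0 sqrt tri oth r par (x, y)
          (pathSum b D0 ctr dsp lam0 mu0 sqrt le tri oth (par + 1) (nextPos dsp (x, y) m) y)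
        else 0 := by
  rw [pathSum, finsum_mem_list (finite_isPath par m x)]
  congr 1
  · refine if_congr Iff.rfl ?_ rfl
    simp [pathWt, evenWt, oddWt, sigList, sortB]
  · refine Finset.sum_congr rfl fun y _ => ?_
    split_ifs with h
    · rw [pathSum, AddMonoidHom.map_finsum_mem _ _ (finite_isPath _ _ _)]
      have hS : {l | y :: l ∈ {l | IsPath b D0 ctr dsp par m x l}} =
          {l | IsPath b D0 ctr dsp (par + 1) (nextPos dsp (x, y) m) y l} := by
        ext l; exact ⟨fun h => h.2, fun h' => ⟨h, h'⟩⟩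
      rw [hS]
      refine finsum_mem_congr rfl fun l hl => ?_
      exact pathWt_cons lam0 mu0 sqrt le tri oth hd hle hcent ⟨h, hl⟩
    · rw [show {l | y :: l ∈ {l | IsPath b D0 ctr dsp par m x l}} = ∅ from
        Set.eq_empty_of_forall_notMem fun l hl => h hl.1, finsum_mem_empty]

end Paths

open Classical in
/-- The recursions satisfied by the sums of the weights of the continuations of super `T`-paths:
`U k x` and `O k x` are the sums over the paths continuing from the vertex `x`, about to make an odd
resp. even step, all of whose remaining crossings come after the diagonal `k - 1`; the function
`G k` is the sum over those continuing from the face `k` after its `σ`-edge. -/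
structure PathSystem {A : Type*} [Ring A] {n : ℕ} (b : Fin (n + 3)) (c v : ℕ → Fin (n + 3))
    (lam : Edg (n + 3) → A) (S : ℕ → A →+ A) (U O : ℕ → Fin (n + 3) → A) (G : ℕ → A) :
    Prop where
  U_eq : ∀ k x, k ≤ n → U k x = (∑ u, if isBnd s(x, u) then lam s(x, u) * O k u else 0) +
    ∑ j ∈ Finset.Ico k n, ((if x = c j then lam s(c j, v j) * O (j + 1) (v j) else 0) +
      if x = v j then lam s(c j, v j) * O (j + 1) (c j) else 0)
  O_eq : ∀ k x, k ≤ n → O k x = (if x = b then 1 else 0) +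
    ∑ j ∈ Finset.Ico k n,
      ((if x = c j then Ring.inverse (lam s(c j, v j)) * U (j + 1) (v j) else 0) +
        if x = v j then Ring.inverse (lam s(c j, v j)) * U (j + 1) (c j) else 0) +
    ∑ j ∈ Finset.Ico k (n + 1), if x = c j then S j (G j) else 0
  G_eq : ∀ k, k ≤ n → G k = ∑ j ∈ Finset.Ico (k + 1) (n + 1), S j (U j (c j))

namespace PathSystem

variable {A : Type*} [Ring A] {n : ℕ} {a b : Fin (n + 3)} {D : Finset (Edg (n + 3))}
  {c w v : ℕ → Fin (n + 3)} {lam : Edg (n + 3) → A} {S : ℕ → A →+ A}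
  {U O : ℕ → Fin (n + 3) → A} {G : ℕ → A} (hS : PathSystem b c v lam S U O G)
  (hC : FanChain n a b D c w v)

include hS

lemma O_succ_of_ne {k : ℕ} (hk : k < n) {x : Fin (n + 3)} (hc : x ≠ c k) (hv : x ≠ v k) :
    O k x = O (k + 1) x := by
  rw [hS.O_eq k x hk.le, hS.O_eq (k + 1) x hk, Finset.sum_eq_sum_Ico_succ_bot hk,
    Finset.sum_eq_sum_Ico_succ_bot (show k < n + 1 by omega), if_neg hc, if_neg hv, if_neg hc]
  simp

lemma O_eq_zero {k : ℕ} (hk : k ≤ n) {x : Fin (n + 3)} (hb : x ≠ b)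
    (hx : ∀ j, k ≤ j → j ≤ n → x ≠ c j ∧ x ≠ v j) : O k x = 0 := by
  rw [hS.O_eq k x hk, if_neg hb, Finset.sum_eq_zero, Finset.sum_eq_zero]
  · simp
  · intro j hj
    rw [Finset.mem_Ico] at hj
    rw [if_neg (hx j hj.1 (by omega)).1]
  · intro j hj
    rw [Finset.mem_Ico] at hj
    rw [if_neg (hx j hj.1 (by omega)).1, if_neg (hx j hj.1 (by omega)).2, add_zero]

lemma G_last : G n = 0 := by rw [hS.G_eq n le_rfl, Finset.Ico_self, Finset.sum_empty]

lemma O_last (x : Fin (n + 3)) : O n x = if x = b then 1 else 0 := by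
  rw [hS.O_eq n x le_rfl, Finset.Ico_self, Finset.sum_empty, Nat.Ico_succ_singleton,
    Finset.sum_singleton, hS.G_last, map_zero, ite_self, add_zero, add_zero]

include hC

lemma O_center {k : ℕ} (hk : k < n) : O k (c k) =
    O (k + 1) (c k) + Ring.inverse (lam s(c k, v k)) * U (k + 1) (v k) + S k (G k) := by
  rw [hS.O_eq k _ hk.le, hS.O_eq (k + 1) _ hk, Finset.sum_eq_sum_Ico_succ_bot hk,
    Finset.sum_eq_sum_Ico_succ_bot (show k < n + 1 by omega), if_pos rfl, if_pos rfl,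
    if_neg (hC.ne k hk.le).2.2]
  abel

lemma O_other {k : ℕ} (hk : k < n) : O k (v k) =
    O (k + 1) (v k) + Ring.inverse (lam s(c k, v k)) * U (k + 1) (c k) := by
  rw [hS.O_eq k _ hk.le, hS.O_eq (k + 1) _ hk, Finset.sum_eq_sum_Ico_succ_bot hk,
    Finset.sum_eq_sum_Ico_succ_bot (show k < n + 1 by omega), if_pos rfl,
    if_neg (hC.ne k hk.le).2.2.symm, if_neg (hC.ne k hk.le).2.2.symm]
  abel

lemma U_center {k : ℕ} (hk : k < n) : U k (c k) =
    lam s(c k, v k) * O (k + 1) (v k) + U (k + 1) (c k) := by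
  classical
  rw [hS.U_eq k _ hk.le, hS.U_eq (k + 1) _ hk, Finset.sum_eq_sum_Ico_succ_bot hk, if_pos rfl,
    if_neg (hC.ne k hk.le).2.2]
  have : ∀ u, (if isBnd s(c k, u) then lam s(c k, u) * O k u else 0) =
      if isBnd s(c k, u) then lam s(c k, u) * O (k + 1) u else 0 := by
    intro u
    split_ifs with hu
    · rw [hS.O_succ_of_ne hk]
      · rintro rfl
        obtain ⟨i, hi⟩ := hu
        rcases Sym2.eq_iff.1 hi with ⟨h, h'⟩ | ⟨h, h'⟩
        · have := h.symm.trans h'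
          simp at this
        · have := h'.symm.trans h
          simp at this
      · rintro rfl
        exact hC.not_isBnd_diagonal hk hu
    · rfl
  simp only [this]
  abel

lemma O_wing {k : ℕ} (h0 : 1 ≤ k) (hk : k ≤ n) : O k (w k) = 0 := by
  refine hS.O_eq_zero hk ?_ fun j h1 h2 => hC.fresh h0 h1 h2
  have := (hC.fresh h0 hk le_rfl).2
  rwa [hC.last] at this

lemma U_wing {k : ℕ} (h0 : 1 ≤ k) (hk : k ≤ n) :
    U k (w k) = lam s(w k, v k) * O k (v k) := by
  rw [hS.U_eq k _ hk, Finset.sum_eq_single (v k), if_pos (hC.isBnd_w h0 hk), Finset.sum_eq_zero,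
    add_zero]
  · intro j hj
    rw [Finset.mem_Ico] at hj
    rw [if_neg (hC.fresh h0 hj.1 (by omega)).1, if_neg (hC.fresh h0 hj.1 (by omega)).2, add_zero]
  · intro u _ hu
    split_ifs with hB
    · rw [hS.O_eq_zero hk, mul_zero]
      · have := (hC.isBnd_neighbor h0 hB hu hk le_rfl).2
        rwa [hC.last] at this
      · exact fun j h1 h2 => hC.isBnd_neighbor h0 hB hu h1 h2
    · rfl
  · simp

lemma U_last_center : U n (c n) = lam s(c n, b) := by
  rw [hS.U_eq n _ le_rfl, Finset.Ico_self, Finset.sum_empty, add_zero, Finset.sum_eq_single b,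
    if_pos hC.isBnd_end, hS.O_last, if_pos rfl, mul_one]
  · intro u _ hu
    rw [hS.O_last, if_neg hu, mul_zero, ite_self]
  · simp

lemma U_first : U 0 a = lam s(a, c 0) * O 0 (c 0) + lam s(a, v 0) * O 0 (v 0) := by
  have hne := (hC.ne 0 (Nat.zero_le n)).2.2
  rw [hS.U_eq 0 _ (Nat.zero_le n), Finset.sum_eq_zero (s := Finset.Ico 0 n), add_zero,
    ← Finset.sum_subset (Finset.subset_univ {c 0, v 0}), Finset.sum_pair hne,
    if_pos ((hC.isBnd_start _).2 (.inl rfl)), if_pos ((hC.isBnd_start _).2 (.inr rfl))]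
  · intro u _ hu
    rw [if_neg]
    intro h
    refine hu ?_
    simpa using (hC.isBnd_start u).1 h
  · intro j hj
    rw [Finset.mem_Ico] at hj
    rw [if_neg (hC.first_fresh hj.2.le).1, if_neg (hC.first_fresh hj.2.le).2, add_zero]

/-- The path sums are determined by the super Ptolemy relations satisfied by the `λ`-lengths
`Lb` of the arcs ending at `b`. -/
theorem eval {Lb : Fin (n + 3) → A} (hunit : ∀ k < n, IsUnit (lam s(c k, v k)))
    (hcent : ∀ k < n, ∀ x, lam s(c k, v k) * x = x * lam s(c k, v k))
    (hcn : lam s(c n, b) = Lb (c n)) (hwn : lam s(w n, b) = Lb (w n))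
    (hI : ∀ k < n, lam s(c k, v k) * Lb (w k) =
      lam s(w k, c k) * Lb (v k) + lam s(w k, v k) * Lb (c k) + lam s(c k, v k) *
        (lam s(w k, c k) * S k (∑ j ∈ Finset.Ico (k + 1) (n + 1), S j (Lb (c j))))) :
    U 0 a = Lb a := by
  have main : ∀ d k, k + d = n → (∀ j, k ≤ j → j ≤ n → U j (c j) = Lb (c j)) ∧
      lam s(w k, c k) * O k (c k) + lam s(w k, v k) * O k (v k) = Lb (w k) := by
    intro d
    induction d with
    | zero =>
      intro k hk
      obtain rfl : k = n := hk
      refine ⟨fun j h1 h2 => ?_, ?_⟩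
      · obtain rfl := le_antisymm h1 h2
        rw [hS.U_last_center hC]; exact hcn
      · have := (hC.ne k le_rfl).2.2
        rw [hS.O_last, hS.O_last, ← hC.last, if_neg this]
        simp only [if_true, mul_zero, zero_add, mul_one]
        rw [hC.last]; exact hwn
    | succ d ih =>
      intro k hk
      obtain ⟨ihA, ihB⟩ := ih (k + 1) (by omega)
      have hkn : k < n := by omega
      have hA' := ihA (k + 1) le_rfl hkn
      have hO := hS.O_wing hC (show 1 ≤ k + 1 by omega) hkn
      have hU := hS.U_wing hC (show 1 ≤ k + 1 by omega) hkn
      have key : lam s(c k, v k) * O (k + 1) (v k) + U (k + 1) (c k) = Lb (c k) ∧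
          lam s(c k, v k) * O (k + 1) (c k) + U (k + 1) (v k) = Lb (v k) := by
        rw [← hU] at ihB
        rcases hC.step k hkn with ⟨h1, h2⟩ | ⟨h1, h2⟩
        · rw [h1] at hA'
          rw [h2] at hO
          rw [h1, h2] at ihB
          rw [hO, mul_zero, zero_add]
          rw [Sym2.eq_swap] at ihB
          exact ⟨hA', ihB⟩
        · rw [h1] at hA'
          rw [h2] at hO
          rw [h1, h2] at ihB
          rw [hO, mul_zero, zero_add]
          exact ⟨ihB, hA'⟩
      have hA : ∀ j, k ≤ j → j ≤ n → U j (c j) = Lb (c j) := by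
        intro j h1 h2
        rcases Nat.eq_or_lt_of_le h1 with rfl | h1
        · rw [hS.U_center hC hkn]; exact key.1
        · exact ihA j h1 h2
      refine ⟨hA, ?_⟩
      rw [hS.O_center hC hkn, hS.O_other hC hkn, hS.G_eq k hkn.le]
      rw [Finset.sum_congr rfl fun j hj => by
        rw [hA j (by rw [Finset.mem_Ico] at hj; omega) (by rw [Finset.mem_Ico] at hj; omega)]]
      refine (hunit k hkn).mul_left_cancel ?_
      rw [hI k hkn, ← key.1, ← key.2]
      have hi := Ring.mul_inverse_cancel _ (hunit k hkn)
      have hc := hcent k hkn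
      have e : ∀ x y, lam s(c k, v k) * (x * y) = x * (lam s(c k, v k) * y) := fun x y => by
        rw [← mul_assoc, hc, mul_assoc]
      simp only [mul_add, e (lam s(w k, c k)), e (lam s(w k, v k)),
        ← mul_assoc (lam s(c k, v k)) (Ring.inverse _), hi, one_mul]
      abel
  obtain ⟨-, h⟩ := main n 0 (by omega)
  rw [hS.U_first hC, ← hC.first]
  rw [h]

end PathSystem

lemma ne_of_isBnd {n : ℕ} {x y : Fin (n + 3)} (h : isBnd s(x, y)) : x ≠ y := by
  rintro rfl
  rw [isBnd_shift x, shift_self] at h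
  omega

namespace FanChain

variable {n : ℕ} {a b : Fin (n + 3)} {D0 : Finset (Edg (n + 3))} {c w v : ℕ → Fin (n + 3)}
  {ctr : Fin (n + 1) → Fin (n + 3)} {dsp : Fin n → Fin (n + 3) × Fin (n + 3)}
  (hF : FanChain n a b D0 c w v) (hctr : ∀ k : Fin (n + 1), ctr k = c k)
  (hdsp : ∀ k : Fin n, s((dsp k).1, (dsp k).2) = s(c k, v k))

include hdsp

lemma cpos_inl_iff {x u : Fin (n + 3)} {q : ℕ} :
    cpos dsp (inl x, inl u) q ↔ ∃ k < n, s(x, u) = s(c k, v k) ∧ q = 2 * k + 2 := by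
  constructor
  · rintro ⟨k, h, rfl⟩
    exact ⟨k, k.isLt, h.trans (hdsp k), rfl⟩
  · rintro ⟨k, hk, h, rfl⟩
    exact ⟨⟨k, hk⟩, h.trans (hdsp ⟨k, hk⟩).symm, rfl⟩

include hF

lemma injDsp : InjDsp dsp := by
  intro j k h
  rw [hdsp, hdsp] at h
  exact Fin.ext (hF.diagonal_inj j.isLt k.isLt h)

omit hdsp in
lemma isEdgeOf_iff {e : Edg (n + 3)} :
    isEdgeOf D0 e ↔ isBnd e ∨ ∃ k < n, e = s(c k, v k) := by
  constructor
  · rintro (h | h)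
    · exact .inl h
    · exact .inr (hF.enum e h)
  · rintro (h | ⟨k, hk, rfl⟩)
    · exact .inl h
    · exact .inr (hF.mem k hk)

include hctr

omit hF in
lemma touches_of_cpos {x : Fin (n + 3)} {z : VV n} {q : ℕ} (hj : jn D0 ctr (inl x) z)
    (hq : cpos dsp (inl x, z) q) : Touches n c v x q := by
  rcases z with u | k
  · obtain ⟨k, hk, h, rfl⟩ := (cpos_inl_iff hdsp).1 hq
    refine .inl ⟨k, hk, ?_, rfl⟩
    rcases Sym2.eq_iff.1 h with ⟨h, -⟩ | ⟨h, -⟩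
    · exact .inl h
    · exact .inr h
  · have hj : x = ctr k := hj
    exact .inr ⟨k, Nat.lt_succ_iff.1 k.isLt, by rw [hj, hctr], hq⟩

omit hF hctr hdsp in
lemma cpos_inr {k : Fin (n + 1)} {z : VV n} {q : ℕ} (hq : cpos dsp (inr k, z) q) :
    q = 2 * k.val + 1 := by
  rcases z with u | k'
  · exact hq
  · exact hq.elim

lemma precedes (x y : VV n) (hj : jn D0 ctr x y) (hc : ¬ ∃ q, cpos dsp (x, y) q) :
    Precedes a b D0 ctr dsp x y ∨ Precedes a b D0 ctr dsp y x := by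
  rcases x with x | k <;> rcases y with y | k'
  · have hB : isBnd s(x, y) := by
      rcases hF.isEdgeOf_iff.1 hj.2 with h | ⟨k, hk, h⟩
      · exact h
      · exact (hc ⟨_, (cpos_inl_iff hdsp).2 ⟨k, hk, h, rfl⟩⟩).elim
    have key := fun {x : Fin (n + 3)} {z : VV n} {q : ℕ} =>
      touches_of_cpos (D0 := D0) hctr hdsp (x := x) (z := z) (q := q)
    rcases hF.touches_lt hB with ⟨h1, h2, h3⟩ | ⟨h1, h2, h3⟩
    · exact .inl ⟨fun z z' q q' hz hq hz' hq' => h1 q q' (key hz hq) (key hz' hq'),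
        fun e => h2 (inl_injective e), fun e => h3 (inl_injective e)⟩
    · exact .inr ⟨fun z z' q q' hz hq hz' hq' => h1 q q' (key hz hq) (key hz' hq'),
        fun e => h2 (inl_injective e), fun e => h3 (inl_injective e)⟩
  · exact (hc ⟨_, rfl⟩).elim
  · exact (hc ⟨_, rfl⟩).elim
  · have hne : k.val ≠ k'.val := fun e => hj (Fin.ext e)
    rcases lt_or_gt_of_ne hne with h | h
    · refine .inl ⟨fun z z' q q' _ hq _ hq' => ?_, inr_ne_inl, inr_ne_inl⟩
      rw [cpos_inr hq, cpos_inr hq']; omega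
    · refine .inr ⟨fun z z' q q' _ hq _ hq' => ?_, inr_ne_inl, inr_ne_inl⟩
      rw [cpos_inr hq, cpos_inr hq']; omega

omit hctr

lemma isStep_inl_of_diag {par m k : ℕ} (hk : k < n) {x u : Fin (n + 3)}
    (h : s(x, u) = s(c k, v k)) :
    IsStep D0 ctr dsp par m (inl x) (inl u) ↔ m < 2 * k + 2 := by
  have hq : cpos dsp (inl x, inl u) (2 * k + 2) := (cpos_inl_iff hdsp).2 ⟨k, hk, h, rfl⟩
  constructor
  · exact fun hs => hs.2.2.2.2 _ hq
  · intro hm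
    refine ⟨⟨?_, hF.isEdgeOf_iff.2 (.inr ⟨k, hk, h⟩)⟩, fun _ => ⟨_, hq⟩, fun h => h.elim,
      fun h => h.elim, fun q hq' => ?_⟩
    · rintro rfl
      have hne := (hF.ne k hk.le).2.2
      rcases Sym2.eq_iff.1 h with ⟨h, h'⟩ | ⟨h, h'⟩
      · exact hne (h.symm.trans h')
      · exact hne (h'.symm.trans h)
    · rwa [cpos_unique (hF.injDsp hdsp) hq' hq]

lemma isStep_inl_of_not_diag {par m : ℕ} {x u : Fin (n + 3)}
    (h : ¬ ∃ k < n, s(x, u) = s(c k, v k)) :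
    IsStep D0 ctr dsp par m (inl x) (inl u) ↔ Even par ∧ isBnd s(x, u) := by
  have hc : ¬ ∃ q, cpos dsp (inl x, inl u) q := by
    rintro ⟨q, hq⟩
    obtain ⟨k, hk, e, -⟩ := (cpos_inl_iff hdsp).1 hq
    exact h ⟨k, hk, e⟩
  constructor
  · intro hs
    refine ⟨Nat.not_odd_iff_even.1 fun ho => hc (hs.2.1 ho), ?_⟩
    exact (hF.isEdgeOf_iff.1 hs.1.2).resolve_right h
  · rintro ⟨he, hB⟩
    exact ⟨⟨ne_of_isBnd hB, .inl hB⟩, fun ho => (Nat.not_odd_iff_even.2 he ho).elim,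
      fun h => h.elim, fun h => h.elim, fun q hq => (hc ⟨q, hq⟩).elim⟩

open Classical in
lemma sum_isStep_inl {A : Type*} [AddCommMonoid A] (par m : ℕ) (x : Fin (n + 3))
    (F : ℕ → Fin (n + 3) → A) :
    (∑ u, if IsStep D0 ctr dsp par m (inl x) (inl u) then
        F (nextPos dsp (inl x, inl u) m) u else 0) =
      (∑ u, if Even par ∧ isBnd s(x, u) then F m u else 0) +
      ∑ k ∈ Finset.range n, if m < 2 * k + 2 then
        (if x = c k then F (2 * k + 2) (v k) else 0) + (if x = v k then F (2 * k + 2) (c k) else 0)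
        else 0 := by
  have key : ∀ u, (if IsStep D0 ctr dsp par m (inl x) (inl u) then
        F (nextPos dsp (inl x, inl u) m) u else 0) =
      (if Even par ∧ isBnd s(x, u) then F m u else 0) +
      ∑ k ∈ Finset.range n, if s(x, u) = s(c k, v k) then
        (if m < 2 * k + 2 then F (2 * k + 2) u else 0) else 0 := by
    intro u
    by_cases h : ∃ k < n, s(x, u) = s(c k, v k)
    · obtain ⟨k, hk, h⟩ := h
      have hB : ¬ isBnd s(x, u) := by rw [h]; exact hF.not_isBnd_diagonal hk
      rw [if_neg (c := Even par ∧ isBnd s(x, u)) fun h => hB h.2, zero_add, Finset.sum_eq_single k, if_pos h,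
        nextPos_eq (hF.injDsp hdsp) ((cpos_inl_iff hdsp).2 ⟨k, hk, h, rfl⟩)]
      · exact if_congr (hF.isStep_inl_of_diag hdsp hk h) rfl rfl
      · intro j hj hjk
        rw [if_neg]
        exact fun e => hjk (hF.diagonal_inj (Finset.mem_range.1 hj) hk (e.symm.trans h))
      · exact fun h => (h (Finset.mem_range.2 hk)).elim
    · rw [Finset.sum_eq_zero fun k hk => if_neg fun e => h ⟨k, Finset.mem_range.1 hk, e⟩, add_zero,
        nextPos_of_not fun ⟨q, hq⟩ => by
          obtain ⟨k, hk, e, -⟩ := (cpos_inl_iff hdsp).1 hq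
          exact h ⟨k, hk, e⟩]
      exact if_congr (hF.isStep_inl_of_not_diag hdsp h) rfl rfl
  rw [Finset.sum_congr rfl fun u _ => key u, Finset.sum_add_distrib, Finset.sum_comm]
  congr 1
  refine Finset.sum_congr rfl fun k hk => ?_
  have hne := (hF.ne k (Finset.mem_range.1 hk).le).2.2
  by_cases hm : m < 2 * k + 2
  · simp only [if_pos hm]
    by_cases h1 : x = c k
    · rw [if_pos h1, if_neg (h1 ▸ hne), add_zero, Finset.sum_eq_single (v k), if_pos (by rw [h1])]
      · intro u _ hu
        rw [if_neg]
        intro e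
        rw [h1, Sym2.congr_right] at e
        exact hu e
      · simp
    · rw [if_neg h1, zero_add]
      split_ifs with h2
      · rw [Finset.sum_eq_single (c k), if_pos (by rw [h2, Sym2.eq_swap])]
        · intro u _ hu
          rw [if_neg]
          intro e
          rw [h2, Sym2.eq_swap, Sym2.congr_left] at e
          exact hu e
        · simp
      · refine Finset.sum_eq_zero fun u _ => if_neg fun e => ?_
        rcases Sym2.eq_iff.1 e with ⟨h, -⟩ | ⟨h, -⟩
        · exact h1 h
        · exact h2 h
  · simp only [if_neg hm, ite_self, Finset.sum_const_zero]

end FanChain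

namespace FanChain

variable {n : ℕ} {a b : Fin (n + 3)} {D0 : Finset (Edg (n + 3))} {c w v : ℕ → Fin (n + 3)}
  {ctr : Fin (n + 1) → Fin (n + 3)} {dsp : Fin n → Fin (n + 3) × Fin (n + 3)}
  (hF : FanChain n a b D0 c w v) (hctr : ∀ k : Fin (n + 1), ctr k = c k)
  (hdsp : ∀ k : Fin n, s((dsp k).1, (dsp k).2) = s(c k, v k))

lemma isStep_inl_inr {par m : ℕ} {x : Fin (n + 3)} {k : Fin (n + 1)} :
    IsStep D0 ctr dsp par m (inl x) (inr k) ↔ Odd par ∧ m < 2 * k.val + 1 ∧ x = ctr k := by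
  constructor
  · intro h
    exact ⟨h.2.2.1 trivial, h.2.2.2.2 _ rfl, h.1⟩
  · rintro ⟨h1, h2, h3⟩
    exact ⟨h3, fun _ => ⟨_, rfl⟩, fun _ => h1, fun h => h.elim, fun q hq => by
      rw [show q = _ from hq]; exact h2⟩

lemma isStep_inr_inl {par m : ℕ} {x : Fin (n + 3)} {k : Fin (n + 1)} :
    IsStep D0 ctr dsp par m (inr k) (inl x) ↔ Odd par ∧ m < 2 * k.val + 1 ∧ x = ctr k := by
  constructor
  · intro h
    exact ⟨h.2.2.1 trivial, h.2.2.2.2 _ rfl, h.1⟩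
  · rintro ⟨h1, h2, h3⟩
    exact ⟨h3, fun _ => ⟨_, rfl⟩, fun _ => h1, fun h => h.elim, fun q hq => by
      rw [show q = _ from hq]; exact h2⟩

lemma isStep_inr_inr {par m : ℕ} {j k : Fin (n + 1)} :
    IsStep D0 ctr dsp par m (inr j) (inr k) ↔ Even par ∧ j ≠ k := by
  constructor
  · intro h
    exact ⟨h.2.2.2.1 trivial, h.1⟩
  · rintro ⟨h1, h2⟩
    exact ⟨h2, fun ho => (Nat.not_odd_iff_even.2 h1 ho).elim, fun h => h.elim, fun _ => h1,
      fun q hq => hq.elim⟩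

lemma nextPos_sig (hd : InjDsp dsp) {m : ℕ} {x : Fin (n + 3)} {k : Fin (n + 1)} :
    nextPos dsp (inl x, inr k) m = 2 * k.val + 1 ∧ nextPos dsp (inr k, inl x) m = 2 * k.val + 1 :=
  ⟨nextPos_eq hd rfl, nextPos_eq hd rfl⟩

variable {A : Type*} [Ring A] {lam0 : Edg (n + 3) → A} {mu0 : Finset (Fin (n + 3)) → A}
  {sqrt : A → A} {le : Fin (n + 1) → Fin (n + 1) → Bool} {tri : Fin (n + 1) → Finset (Fin (n + 3))}
  {oth : Fin (n + 1) → Fin (n + 3) × Fin (n + 3)} {r : Fin (n + 1) → Bool}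

variable (ctr lam0 mu0 sqrt tri oth r) in
/-- The effect of a step along a `σ`-edge. -/
noncomputable def sigHom (k : ℕ) : A →+ A :=
  if h : k < n + 1 then
    (AddMonoidHom.mulLeft (sqrt (lam0 s((oth ⟨k, h⟩).1, (oth ⟨k, h⟩).2) *
        Ring.inverse (lam0 s(ctr ⟨k, h⟩, (oth ⟨k, h⟩).1) *
          lam0 s(ctr ⟨k, h⟩, (oth ⟨k, h⟩).2))))).comp
      (starHom (fun k => mu0 (tri k)) r ⟨k, h⟩)
  else 0

lemma sigHom_apply (k : Fin (n + 1)) (par : ℕ) (x : Fin (n + 3)) :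
    stepHom ctr lam0 mu0 sqrt tri oth r par (inl x, inr k) =
      sigHom ctr lam0 mu0 sqrt tri oth r k ∧
    stepHom ctr lam0 mu0 sqrt tri oth r par (inr k, inl x) =
      sigHom ctr lam0 mu0 sqrt tri oth r k := by
  rw [sigHom, dif_pos k.isLt]
  exact ⟨rfl, rfl⟩

variable (hle : ∀ k k', k < k' → le k k' = r k)
    (hcent : ∀ par m x y, IsStep D0 ctr dsp par m x y → ∀ z,
      Commute (stepWt lam0 sqrt ctr oth par (x, y)) z)

include hF hdsp hle hcent

local notation "Ψ" => pathSum b D0 ctr dsp lam0 mu0 sqrt le tri oth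

open Classical in
lemma pathSum_even_inl (m : ℕ) (x : Fin (n + 3)) :
    Ψ 0 m (inl x) = (∑ u, if isBnd s(x, u) then lam0 s(x, u) * Ψ 1 m (inl u) else 0) +
      ∑ k ∈ Finset.range n, if m < 2 * k + 2 then
        (if x = c k then lam0 s(c k, v k) * Ψ 1 (2 * k + 2) (inl (v k)) else 0) +
        (if x = v k then lam0 s(c k, v k) * Ψ 1 (2 * k + 2) (inl (c k)) else 0) else 0 := by
  rw [pathSum_eq lam0 mu0 sqrt le tri oth (hF.injDsp hdsp) hle hcent, Fintype.sum_sum_type,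
    if_neg (by rintro ⟨h, -⟩; exact absurd h (by decide)), zero_add]
  have h2 : ∑ k : Fin (n + 1), (if IsStep D0 ctr dsp 0 m (inl x) (inr k) then
      stepHom ctr lam0 mu0 sqrt tri oth r 0 (inl x, inr k)
        (Ψ (0 + 1) (nextPos dsp (inl x, inr k) m) (inr k)) else 0) = 0 :=
    Finset.sum_eq_zero fun k _ => if_neg fun h =>
      absurd (isStep_inl_inr.1 h).1 (by decide)
  have h1 := hF.sum_isStep_inl (ctr := ctr) hdsp 0 m x
    fun q u => lam0 s(x, u) * Ψ 1 q (inl u)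
  rw [h2, add_zero]
  refine h1.trans ?_
  congr 1
  · refine Finset.sum_congr rfl fun u _ => if_congr ?_ rfl rfl
    simp
  · refine Finset.sum_congr rfl fun k _ => if_congr Iff.rfl ?_ rfl
    congr 1
    · split_ifs with h
      · rw [h]
      · rfl
    · split_ifs with h
      · rw [h, Sym2.eq_swap]
      · rfl

include hctr

open Classical in
lemma pathSum_odd_inl (m : ℕ) (x : Fin (n + 3)) :
    Ψ 1 m (inl x) = (if x = b then 1 else 0) +
      (∑ k ∈ Finset.range n, if m < 2 * k + 2 then
        (if x = c k then Ring.inverse (lam0 s(c k, v k)) * Ψ 0 (2 * k + 2) (inl (v k)) else 0) +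
        (if x = v k then Ring.inverse (lam0 s(c k, v k)) * Ψ 0 (2 * k + 2) (inl (c k)) else 0)
        else 0) +
      ∑ k : Fin (n + 1), if m < 2 * k.val + 1 then
        (if x = c k then sigHom ctr lam0 mu0 sqrt tri oth r k (Ψ 0 (2 * k.val + 1) (inr k)) else 0)
        else 0 := by
  rw [pathSum_eq lam0 mu0 sqrt le tri oth (hF.injDsp hdsp) hle hcent, Fintype.sum_sum_type,
    add_assoc]
  congr 1
  · refine if_congr ?_ rfl rfl
    simp
  have h1 := hF.sum_isStep_inl (ctr := ctr) hdsp 1 m x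
    fun q u => Ring.inverse (lam0 s(x, u)) * Ψ 0 q (inl u)
  congr 1
  · refine (Finset.sum_congr rfl fun u _ => ?_).trans (h1.trans ?_)
    · rw [pathSum_add_two (par := 0)]
      rfl
    rw [Finset.sum_eq_zero (s := Finset.univ) fun u _ => if_neg ?_, zero_add]
    · refine Finset.sum_congr rfl fun k _ => if_congr Iff.rfl ?_ rfl
      congr 1
      · split_ifs with h
        · rw [h]
        · rfl
      · split_ifs with h
        · rw [h, Sym2.eq_swap]
        · rfl
    · rintro ⟨h, -⟩
      exact absurd h (by decide)
  · refine Finset.sum_congr rfl fun k _ => ?_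
    rw [(nextPos_sig (hF.injDsp hdsp)).1, (sigHom_apply k _ x).1, pathSum_add_two (par := 0),
      ← ite_and]
    refine if_congr ?_ rfl rfl
    rw [isStep_inl_inr, hctr]
    exact and_iff_right (by decide)

lemma pathSum_odd_inr (m : ℕ) (k : Fin (n + 1)) :
    Ψ 1 m (inr k) = if m < 2 * k.val + 1 then
      sigHom ctr lam0 mu0 sqrt tri oth r k (Ψ 0 (2 * k.val + 1) (inl (c k))) else 0 := by
  classical
  rw [pathSum_eq lam0 mu0 sqrt le tri oth (hF.injDsp hdsp) hle hcent, Fintype.sum_sum_type,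
    if_neg (by simp), zero_add, Finset.sum_eq_single (c k)]
  · rw [Finset.sum_eq_zero, add_zero, (nextPos_sig (hF.injDsp hdsp)).2, (sigHom_apply k _ _).2,
      pathSum_add_two (par := 0)]
    · refine if_congr ?_ rfl rfl
      rw [isStep_inr_inl, hctr]
      simp
    · intro j _
      exact if_neg fun h => absurd (isStep_inr_inr.1 h).1 (by decide)
  · intro u _ hu
    refine if_neg fun h => hu ?_
    rw [(isStep_inr_inl.1 h).2.2, hctr]
  · simp

lemma pathSum_even_inr (k : Fin (n + 1)) :
    Ψ 0 (2 * k.val + 1) (inr k) = ∑ j : Fin (n + 1), if k.val < j.val then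
      sigHom ctr lam0 mu0 sqrt tri oth r j (Ψ 0 (2 * j.val + 1) (inl (c j))) else 0 := by
  classical
  rw [pathSum_eq lam0 mu0 sqrt le tri oth (hF.injDsp hdsp) hle hcent, Fintype.sum_sum_type,
    if_neg (by simp), zero_add, Finset.sum_eq_zero, zero_add]
  · refine Finset.sum_congr rfl fun j _ => ?_
    rw [nextPos_of_not (by rintro ⟨q, hq⟩; exact hq),
      show (0 + 1 = 1) from rfl, hF.pathSum_odd_inr hctr hdsp hle hcent]
    by_cases h : k.val < j.val
    · rw [if_pos h, if_pos (isStep_inr_inr.2 ⟨by decide, fun e => by rw [e] at h; omega⟩),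
        if_pos (by omega), stepHom]
      simp [stepWt, sigIdx]
    · rw [if_neg h, if_neg (c := 2 * k.val + 1 < 2 * j.val + 1) (by omega), map_zero, ite_self]
  · intro u _
    exact if_neg fun h => absurd (isStep_inr_inl.1 h).1 (by decide)

end FanChain

namespace FanChain

variable {n : ℕ} {a b : Fin (n + 3)} {D0 : Finset (Edg (n + 3))} {c w v : ℕ → Fin (n + 3)}
  {ctr : Fin (n + 1) → Fin (n + 3)} {dsp : Fin n → Fin (n + 3) × Fin (n + 3)}
  {A : Type*} [Ring A] {lam0 : Edg (n + 3) → A} {mu0 : Finset (Fin (n + 3)) → A}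
  {sqrt : A → A} {le : Fin (n + 1) → Fin (n + 1) → Bool} {tri : Fin (n + 1) → Finset (Fin (n + 3))}
  {oth : Fin (n + 1) → Fin (n + 3) × Fin (n + 3)} {r : Fin (n + 1) → Bool}

lemma sum_range_ite_eq_sum_Ico {M : Type*} [AddCommMonoid M] {k N : ℕ} (p : ℕ → Prop)
    [DecidablePred p] (hp : ∀ j, p j ↔ k ≤ j) (f : ℕ → M) :
    (∑ j ∈ Finset.range N, if p j then f j else 0) = ∑ j ∈ Finset.Ico k N, f j := by
  rw [← Finset.sum_filter]
  congr 1
  ext j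
  rw [Finset.mem_filter, Finset.mem_range, Finset.mem_Ico, hp, and_comm]

theorem pathSystem (hF : FanChain n a b D0 c w v) (hctr : ∀ k : Fin (n + 1), ctr k = c k)
    (hdsp : ∀ k : Fin n, s((dsp k).1, (dsp k).2) = s(c k, v k))
    (hle : ∀ k k', k < k' → le k k' = r k)
    (hcent : ∀ par m x y, IsStep D0 ctr dsp par m x y → ∀ z,
      Commute (stepWt lam0 sqrt ctr oth par (x, y)) z) :
    PathSystem b c v lam0 (sigHom ctr lam0 mu0 sqrt tri oth r)
      (fun k x => pathSum b D0 ctr dsp lam0 mu0 sqrt le tri oth 0 (2 * k) (inl x))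
      (fun k x => pathSum b D0 ctr dsp lam0 mu0 sqrt le tri oth 1 (2 * k) (inl x))
      (fun k => if h : k < n + 1 then
        pathSum b D0 ctr dsp lam0 mu0 sqrt le tri oth 0 (2 * k + 1) (inr ⟨k, h⟩) else 0) where
  U_eq k x hk := by
    rw [hF.pathSum_even_inl hdsp hle hcent, sum_range_ite_eq_sum_Ico]
    · rfl
    · intro j; omega
  O_eq k x hk := by
    rw [hF.pathSum_odd_inl hctr hdsp hle hcent, sum_range_ite_eq_sum_Ico]
    · congr 1
      rw [← sum_range_ite_eq_sum_Ico (fun j => 2 * k < 2 * j + 1), Finset.sum_range]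
      · refine Finset.sum_congr rfl fun j _ => ?_
        rw [dif_pos j.isLt]
      · intro j; omega
    · intro j; omega
  G_eq k hk := by
    classical
    have hk' : k < n + 1 := by omega
    rw [dif_pos hk', hF.pathSum_even_inr hctr hdsp hle hcent ⟨k, hk'⟩,
      ← sum_range_ite_eq_sum_Ico (fun j => k < j), Finset.sum_range]
    · refine Finset.sum_congr rfl fun j _ => ?_
      dsimp only
      split_ifs with h
      · congr 1
        rw [hF.pathSum_even_inl hdsp hle hcent, hF.pathSum_even_inl hdsp hle hcent]
        congr 1
        · refine Finset.sum_congr rfl fun u _ => ?_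
          split_ifs with hu
          · rw [hF.pathSum_odd_inl hctr hdsp hle hcent, hF.pathSum_odd_inl hctr hdsp hle hcent]
            congr 2
            · congr 1
              refine Finset.sum_congr rfl fun i _ => if_congr ?_ rfl rfl
              omega
            · refine Finset.sum_congr rfl fun i _ => ?_
              by_cases hij : i = j
              · subst hij
                rw [if_neg (lt_irrefl _), if_pos (by omega), if_neg (ne_of_isBnd hu).symm]
              · refine if_congr ?_ rfl rfl
                have : i.val ≠ j.val := fun e => hij (Fin.ext e)
                omega
          · rfl
        · refine Finset.sum_congr rfl fun i _ => if_congr ?_ rfl rfl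
          omega
      · rfl
    · intro j; omega

end FanChain

/-- The orientation sign of a triple. -/
noncomputable def cycSign {N : ℕ} (p j r : Fin N) : ℤ :=
  open Classical in if Cyc p j r then 1 else -1

lemma cycSign_eq {N : ℕ} {p j r : Fin N} (h : Cyc p j r) : cycSign p j r = 1 := by
  simp [cycSign, h]

lemma cycSign_eq_neg {N : ℕ} {p j r : Fin N} (h : Cyc p r j) : cycSign p j r = -1 := by
  simp [cycSign, h.not_swap]

lemma cycSign_sq {N : ℕ} (p j r : Fin N) : cycSign p j r * cycSign p j r = 1 := by
  unfold cycSign; split_ifs <;> rfl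

/-- Signs of a quadrilateral `c w v x` with diagonal `c v`. -/
lemma χ_quad {N : ℕ} {c w v x : Fin N} (h : (Cyc c w v ∧ Cyc c v x) ∨ (Cyc c v w ∧ Cyc c x v)) :
    χ w x = cycSign c w v * χ c w * χ c x ∧ χ c v * χ v x * χ c x = cycSign c w v := by
  rcases h with ⟨h1, h2⟩ | ⟨h1, h2⟩
  · have e := h2.χ_mul
    rw [cycSign_eq h1, χ_swap h2.ne.2.2] at *
    exact ⟨by rw [h1.χ_left h2]; ring, by linarith⟩
  · have e := h2.χ_mul
    have e' := h2.χ_left h1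
    have hx : w ≠ x := by
      rintro rfl
      exact h1.not_swap h2
    rw [cycSign_eq_neg h1]
    rw [χ_swap h2.ne.2.1.symm, χ_swap h2.ne.2.2] at e
    rw [χ_swap hx] at e'
    exact ⟨by linarith, by linarith⟩

lemma cyc_shift {N : ℕ} (a : Fin N) {x y z : Fin N} : Cyc x y z ↔
    (shift a x < shift a y ∧ shift a y < shift a z) ∨
    (shift a y < shift a z ∧ shift a z < shift a x) ∨
    (shift a z < shift a x ∧ shift a x < shift a y) := by
  unfold Cyc shift; split_ifs <;> omega

namespace FanChain
variable {n : ℕ} {a b : Fin (n + 3)} {D : Finset (Edg (n + 3))} {c w v : ℕ → Fin (n + 3)}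

lemma third_ne (h : FanChain n a b D c w v) {k j : ℕ} (hkj : k ≤ j) (hj : j ≤ n) :
    w k ≠ c j ∧ w k ≠ v j := by
  rcases Nat.eq_zero_or_pos k with rfl | hk
  · rw [h.first]; exact h.first_fresh hj
  · exact h.fresh hk hkj hj

lemma third_ne_third (h : FanChain n a b D c w v) {k j : ℕ} (hkj : k < j) (hj : j ≤ n) :
    w k ≠ w j := by
  obtain ⟨j, rfl⟩ := Nat.exists_eq_add_of_lt hkj
  have h1 := h.third_ne (k := k) (j := k + j) (by omega) (by omega)
  rcases h.step (k + j) (by omega) with ⟨-, e⟩ | ⟨-, e⟩ <;> rw [e]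
  exacts [h1.2, h1.1]

lemma triangle_inj (h : FanChain n a b D c w v) {j k : ℕ} (hj : j ≤ n) (hk : k ≤ n)
    (e : ({c j, w j, v j} : Finset (Fin (n + 3))) = {c k, w k, v k}) : j = k := by
  wlog hjk : j < k generalizing j k
  · rcases eq_or_ne j k with e' | e'
    · exact e'
    · exact (this hk hj e.symm (by omega)).symm
  have hm : w j ∈ ({c k, w k, v k} : Finset (Fin (n + 3))) := e ▸ by simp
  simp only [Finset.mem_insert, Finset.mem_singleton] at hm
  have h1 := h.third_ne hjk.le hk
  have h2 := h.third_ne_third hjk hk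
  tauto

/-- The third vertices of the two triangles at a diagonal lie on opposite sides. -/
lemma opposite (h : FanChain n a b D c w v) {k : ℕ} (hk : k < n) {x : Fin (n + 3)}
    (hx : x = b ∨ x = v (k + 1)) :
    (Cyc (c k) (w k) (v k) ∧ Cyc (c k) (v k) x) ∨
      (Cyc (c k) (v k) (w k) ∧ Cyc (c k) x (v k)) := by
  obtain ⟨L, R, h1, h2, h3, h4⟩ := h.exists_coord
  have e1 := h1 k hk
  have e2 := h2 k hk
  have e4 := h4 k hk
  have key : ∀ x y z t : ℕ, ((x < y ∧ y < z ∧ (z < t ∨ t < x)) ∨ (z < y ∧ y < x ∧ (x < t ∨ t < z)) ∨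
      (x < t ∧ t < z ∧ (z < y ∨ y < x)) ∨ (z < t ∧ t < x ∧ (x < y ∨ y < z))) →
      ((x < y ∧ y < z ∨ y < z ∧ z < x ∨ z < x ∧ x < y) ∧
        (x < z ∧ z < t ∨ z < t ∧ t < x ∨ t < x ∧ x < z)) ∨
      ((x < z ∧ z < y ∨ z < y ∧ y < x ∨ y < x ∧ x < z) ∧
        (x < t ∧ t < z ∨ t < z ∧ z < x ∨ z < x ∧ x < t)) := by
    intro x y z t h
    rcases h with h | h | h | h
    · exact Or.inl (by omega)
    · exact Or.inr (by omega)
    · exact Or.inr (by omega)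
    · exact Or.inl (by omega)
  have hw : ∃ l r, shift a (w k) ≤ l ∧ l + 1 = L k ∧ r = R k ∨
      shift a (w k) + r = n + 3 ∧ r + 1 = R k ∨ shift a (w k) = 0 := by
    rcases k with _ | k
    · exact ⟨0, 0, Or.inr (Or.inr (by rw [h.first, shift_self]))⟩
    · have f1 := h1 k (by omega)
      have f4 := h4 k (by omega)
      have f3 := h3 k (k + 1) (by omega) hk
      exact ⟨L k, R k, by omega⟩
  have hx' : (L k < shift a x ∧ shift a x + R k < n + 3) := by
    rcases hx with rfl | rfl <;> omega
  have hwk := shift_lt a (w k)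
  simp only [cyc_shift a]
  obtain ⟨l, r, hw⟩ := hw
  apply key
  rcases e2 with e2 | e2
  · exact Or.inr (Or.inr (Or.inl ⟨by omega, by omega, by omega⟩))
  · exact Or.inr (Or.inr (Or.inr ⟨by omega, by omega, by omega⟩))

lemma next_triangle (h : FanChain n a b D c w v) {k : ℕ} (hk : k < n) :
    ({c (k + 1), w (k + 1), v (k + 1)} : Finset (Fin (n + 3))) = {c k, v k, v (k + 1)} := by
  rcases h.step k hk with ⟨e1, e2⟩ | ⟨e1, e2⟩ <;> rw [e1, e2]
  ext; simp; tauto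

/-- The triangles at a diagonal. -/
lemma eq_of_isTri (h : FanChain n a b D c w v) {k : ℕ} (hk : k < n) {x : Fin (n + 3)}
    (hxc : x ≠ c k) (hxv : x ≠ v k) (ht : IsTri D {c k, x, v k}) :
    x = w k ∨ x = v (k + 1) := by
  have t1 := h.tri k hk.le
  have t2 := h.tri (k + 1) hk
  rw [h.next_triangle hk] at t2
  have perm : ∀ y, ({c k, y, v k} : Finset (Fin (n + 3))) = {v k, y, c k} := by
    intro y; ext; simp; tauto
  rcases h.opposite hk (Or.inr rfl) with ⟨o1, o2⟩ | ⟨o1, o2⟩ <;>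
    rcases cyc_or hxc.symm hxv (h.ne k hk.le).2.2 with hx | hx
  · exact Or.inl (isTri_unique h.noncross hx o1 ht t1)
  · refine Or.inr (isTri_unique h.noncross hx.rot o2.rot (perm _ ▸ ht) ?_)
    rwa [← finset_rot]
  · refine Or.inr (isTri_unique h.noncross hx o2 ht ?_)
    rwa [finset_swap]
  · exact Or.inl (isTri_unique h.noncross hx.rot o1.rot (perm _ ▸ ht) (perm _ ▸ t1))

lemma isBnd_last (h : FanChain n a b D c w v) {u : Fin (n + 3)} (hu : isBnd s(b, u)) :
    u = c n ∨ u = w n := by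
  obtain ⟨L, R, h1, h2, -, h4⟩ := h.exists_coord
  obtain ⟨m, hm⟩ : ∃ m, n = m + 1 := Nat.exists_eq_add_of_le' h.pos
  have e1 := h1 m (by omega)
  have e4 := h4 m (by omega)
  rw [← hm] at e4
  have := shift_lt a u
  rw [isBnd_shift a] at hu
  rw [← shift_inj (a := a) (x := u), ← shift_inj (a := a) (x := u)]
  rcases e4 with e4 | e4 <;> omega

/-- Every triangle is one of the triangles met by the arc. -/
lemma exists_triangle (h : FanChain n a b D c w v) {t : Finset (Fin (n + 3))} (ht : IsTri D t) :
    ∃ k ≤ n, t = {c k, w k, v k} := by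
  obtain ⟨p, j, r, hpj, hpr, hjr, rfl⟩ := Finset.card_eq_three.1 ht.1
  have ht' := (isTri_insert hpj hjr hpr).1 ht
  have key : ∀ p j r : Fin (n + 3), p ≠ j → j ≠ r → p ≠ r → IsTri D {p, j, r} → s(p, r) ∈ D →
      ∃ k ≤ n, ({p, j, r} : Finset (Fin (n + 3))) = {c k, w k, v k} := by
    intro p j r hpj hjr hpr ht hm
    obtain ⟨k, hk, e⟩ := h.enum _ hm
    have main : ∀ p r : Fin (n + 3), p = c k → r = v k → p ≠ j → j ≠ r → IsTri D {p, j, r} →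
        ∃ k ≤ n, ({p, j, r} : Finset (Fin (n + 3))) = {c k, w k, v k} := by
      rintro p r rfl rfl hpj hjr ht
      rcases h.eq_of_isTri hk hpj.symm hjr ht with rfl | rfl
      · exact ⟨k, hk.le, rfl⟩
      · exact ⟨k + 1, hk, by rw [h.next_triangle hk, finset_swap]⟩
    have hs : ({p, j, r} : Finset (Fin (n + 3))) = {r, j, p} := by ext; simp; tauto
    rcases Sym2.eq_iff.1 e with ⟨e1, e2⟩ | ⟨e1, e2⟩
    · exact main p r e1 e2 hpj hjr ht
    · rw [hs] at ht ⊢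
      exact main r p e2 e1 hjr.symm hpj.symm ht
  rcases ht'.2.2 with b1 | m1
  swap
  · exact key _ _ _ hpj hjr hpr ht m1
  rcases ht'.1 with b2 | m2
  swap
  · rw [finset_swap] at ht ⊢
    exact key _ _ _ hpr hjr.symm hpj ht m2
  rcases ht'.2.1 with b3 | m3
  swap
  · rw [finset_rot, finset_swap] at ht ⊢
    exact key _ _ _ hpj.symm hpr hjr ht m3
  exfalso
  have hp := h.pos
  have := shift_lt a p
  have := shift_lt a j
  have := shift_lt a r
  rw [ne_eq, ← shift_inj (a := a)] at hpj hjr hpr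
  rw [isBnd_shift a] at b1 b2 b3
  omega

/-- Every edge is a side of one of the triangles met by the arc. -/
lemma exists_side (h : FanChain n a b D c w v) {x y : Fin (n + 3)}
    (he : isEdgeOf D s(x, y)) :
    ∃ k ≤ n, s(x, y) = s(c k, v k) ∨ s(x, y) = s(w k, v k) ∨ s(x, y) = s(c k, w k) := by
  rcases he with hb | hm
  swap
  · obtain ⟨k, hk, e⟩ := h.enum _ hm
    exact ⟨k, hk.le, Or.inl e⟩
  have start : ∀ x y, x = a → isBnd s(x, y) →
      ∃ k ≤ n, s(x, y) = s(c k, v k) ∨ s(x, y) = s(w k, v k) ∨ s(x, y) = s(c k, w k) := by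
    rintro x y rfl hb
    refine ⟨0, by omega, ?_⟩
    rw [h.first]
    rcases (h.isBnd_start y).1 hb with rfl | rfl <;> simp [Sym2.eq_swap]
  have fin : ∀ x y, x = b → isBnd s(x, y) →
      ∃ k ≤ n, s(x, y) = s(c k, v k) ∨ s(x, y) = s(w k, v k) ∨ s(x, y) = s(c k, w k) := by
    rintro x y rfl hb
    refine ⟨n, le_rfl, ?_⟩
    rw [h.last]
    rcases h.isBnd_last hb with rfl | rfl <;> simp [Sym2.eq_swap]
  by_cases hxa : x = a
  · exact start x y hxa hb
  by_cases hya : y = a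
  · rw [Sym2.eq_swap] at hb ⊢
    exact start y x hya hb
  by_cases hxb : x = b
  · exact fin x y hxb hb
  by_cases hyb : y = b
  · rw [Sym2.eq_swap] at hb ⊢
    exact fin y x hyb hb
  clear start fin
  obtain ⟨L, R, h1, h2, h3, h4⟩ := h.exists_coord
  obtain ⟨m, hm⟩ : ∃ m, n = m + 1 := Nat.exists_eq_add_of_le' h.pos
  rw [← shift_inj (a := a)] at hxa hya hxb hyb
  rw [shift_self] at hxa hya
  have e0 := h1 0 h.pos
  have em := h1 m (by omega)
  have key : ∀ x y : Fin (n + 3), shift a x ≠ 0 → shift a x ≠ shift a b → shift a y ≠ shift a b →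
      shift a y = shift a x + 1 →
      ∃ k ≤ n, s(x, y) = s(c k, v k) ∨ s(x, y) = s(w k, v k) ∨ s(x, y) = s(c k, w k) := by
    intro x y hxa hxb hyb hxy
    have hy := shift_lt a y
    have ind : ∀ f : ℕ → ℕ, ∀ t : ℕ, f 0 ≤ t → t < f m → ∃ i < m, f i ≤ t ∧ t < f (i + 1) := by
      intro f t h0
      clear * - h0
      induction m with
      | zero => intro h; omega
      | succ m ih =>
        intro hm
        by_cases ht : t < f m
        · obtain ⟨i, hi, h⟩ := ih ht
          exact ⟨i, by omega, h⟩
        · exact ⟨m, by omega, by omega, hm⟩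
    by_cases c3 : shift a x < shift a b
    · obtain ⟨i, hi, hi1, hi2⟩ := ind L (shift a x) (by omega) (by omega)
      have f1 := h1 i (by omega)
      have f2 := h1 (i + 1) (by omega)
      have f3 := h3 i (i + 1) (by omega) (by omega)
      have f5 := h2 (i + 1) (by omega)
      refine ⟨i + 1, by omega, Or.inr (Or.inl ?_)⟩
      have e : x = w (i + 1) ∧ y = v (i + 1) := by
        rw [← shift_inj (a := a), ← shift_inj (a := a)]
        rcases h4 i (by omega) with f4 | f4 <;> omega
      rw [e.1, e.2]
    · obtain ⟨i, hi, hi1, hi2⟩ := ind R (n + 3 - shift a y) (by omega) (by omega)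
      have f1 := h1 i (by omega)
      have f2 := h1 (i + 1) (by omega)
      have f3 := h3 i (i + 1) (by omega) (by omega)
      have f5 := h2 (i + 1) (by omega)
      refine ⟨i + 1, by omega, Or.inr (Or.inl ?_)⟩
      have e : y = w (i + 1) ∧ x = v (i + 1) := by
        rw [← shift_inj (a := a), ← shift_inj (a := a)]
        rcases h4 i (by omega) with f4 | f4 <;> omega
      rw [e.1, e.2, Sym2.eq_swap]
  rw [isBnd_shift a] at hb
  by_cases hc : shift a y = shift a x + 1
  · exact key x y hxa hxb hyb hc
  · rw [Sym2.eq_swap]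
    exact key y x hya hyb hxb (by omega)

end FanChain

section ChainFrame

variable {n : ℕ} {a b : Fin (n + 3)} {D : Finset (Edg (n + 3))} {c w v : ℕ → Fin (n + 3)}
  {E O : Type*} [CommRing E] [AddCommGroup O] [Module E O] {P : OddPairing E O}

/-- Vectors with prescribed pairings along the sides and odd invariants of the triangles met by
the arc. -/
lemma FanChain.exists_vectors (h : FanChain n a b D c w v) (M : Fin (n + 3) → Fin (n + 3) → E)
    (hM : ∀ x y, x ≠ y → M y x = - M x y) (hunit : ∀ k ≤ n, IsUnit (M (c k) (v k)))
    (d : ℕ → O) : ∃ x : Fin (n + 3) → SuperVec E O, ∀ k ≤ n,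
      osp P.β (x (c k)) (x (w k)) = M (c k) (w k) ∧ osp P.β (x (c k)) (x (v k)) = M (c k) (v k) ∧
      osp P.β (x (w k)) (x (v k)) = M (w k) (v k) ∧
      oddDet P.β (x (c k)) (x (w k)) (x (v k)) = d k := by
  suffices key : ∀ j ≤ n + 1, ∃ x : Fin (n + 3) → SuperVec E O,
      osp P.β (x (c n)) (x (v n)) = M (c n) (v n) ∧ ∀ k ≤ n, n + 1 ≤ k + j →
      osp P.β (x (c k)) (x (w k)) = M (c k) (w k) ∧ osp P.β (x (c k)) (x (v k)) = M (c k) (v k) ∧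
      osp P.β (x (w k)) (x (v k)) = M (w k) (v k) ∧
      oddDet P.β (x (c k)) (x (w k)) (x (v k)) = d k by
    obtain ⟨x, -, hx⟩ := key (n + 1) le_rfl
    exact ⟨x, fun k hk => hx k hk (by omega)⟩
  intro j
  induction j with
  | zero =>
    intro _
    refine ⟨fun u => if u = c n then ⟨1, 0, 0⟩ else ⟨0, M (c n) (v n), 0⟩, ?_,
      fun k hk hk' => by omega⟩
    simp [(h.ne n le_rfl).2.2.symm, osp]
  | succ j ih =>
    intro hj
    obtain ⟨x, hx0, hx⟩ := ih (by omega)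
    obtain ⟨i, rfl⟩ : ∃ i, n = i + j := ⟨n - j, by omega⟩
    have hcv : osp P.β (x (c i)) (x (v i)) = M (c i) (v i) := by
      rcases Nat.eq_zero_or_pos j with rfl | hj0
      · exact hx0
      have hx1 := (hx (i + 1) (by omega) (by omega)).1
      rcases h.step i (by omega) with ⟨e1, e2⟩ | ⟨e1, e2⟩
      · rwa [e1, e2] at hx1
      · rw [e1, e2] at hx1
        rw [osp_swap P.alt, hx1, hM _ _ (h.ne i (by omega)).2.2, neg_neg]
    obtain ⟨y, hy1, hy2, hy3⟩ := exists_superVec P.alt P.assoc (x (c i)) (x (v i))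
      (hcv ▸ hunit i (by omega)) (M (c i) (w i)) (M (v i) (w i)) (- d i)
    have fr : ∀ k ≤ i + j, i ≤ k → Function.update x (w i) y (c k) = x (c k) ∧
        Function.update x (w i) y (v k) = x (v k) := fun k hk hik =>
      ⟨Function.update_of_ne (h.third_ne hik hk).1.symm _ _,
        Function.update_of_ne (h.third_ne hik hk).2.symm _ _⟩
    refine ⟨Function.update x (w i) y, ?_, fun k hk hkj => ?_⟩
    · rw [(fr _ le_rfl (by omega)).1, (fr _ le_rfl (by omega)).2, hx0]
    · rw [(fr k hk (by omega)).1, (fr k hk (by omega)).2]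
      rcases Nat.eq_or_lt_of_le (show i ≤ k by omega) with rfl | hik
      · rw [Function.update_self]
        refine ⟨hy1, hcv, ?_, ?_⟩
        · rw [osp_swap P.alt, hy2, hM _ _ (h.ne i hk).2.1, neg_neg]
        · rw [oddDet_swap_right P.alt P.assoc, hy3, neg_neg]
      · rw [Function.update_of_ne (h.third_ne_third hik hk).symm]
        exact hx k hk (by omega)

/-- A frame with given side lengths and odd invariants of the triangles met by an arc. -/
structure ChainFrame (n : ℕ) (b : Fin (n + 3)) (c w v : ℕ → Fin (n + 3)) (C : EvenCone E)
    (F : SuperFrame (Fin (n + 3)) P) (lam : Edg (n + 3) → E) (m : ℕ → O) : Prop where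
  ell_third : ∀ k ≤ n, F.ell (c k) (w k) = lam s(c k, w k)
  ell_diag : ∀ k ≤ n, F.ell (c k) (v k) = lam s(c k, v k)
  ell_side : ∀ k ≤ n, F.ell (w k) (v k) = lam s(w k, v k)
  odd : ∀ k ≤ n, F.D (c k) (w k) (v k) =
    ((χ (c k) b * χ (c k) (v k) * χ (c k) (w k) : ℤ) : E) •
      triRoot C F (c k) (w k) (v k) • m k

lemma FanChain.isEdgeOf_sides (h : FanChain n a b D c w v) {k : ℕ} (hk : k ≤ n) :
    isEdgeOf D s(c k, w k) ∧ isEdgeOf D s(w k, v k) ∧ isEdgeOf D s(c k, v k) :=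
  have hne := h.ne k hk
  (isTri_insert hne.1 hne.2.1 hne.2.2).1 (h.tri k hk)

lemma FanChain.exists_chainFrame (h : FanChain n a b D c w v) (C : EvenCone E)
    {lam : Edg (n + 3) → E} (hlam : ∀ e, isEdgeOf D e → lam e ∈ C.Pos) (m : ℕ → O) :
    ∃ F : SuperFrame (Fin (n + 3)) P, ChainFrame n b c w v C F lam m := by
  obtain ⟨x, hx⟩ := h.exists_vectors (P := P) (fun u v => (χ u v : E) * lam s(u, v))
    (fun u v huv => by simp only [χ_swap huv, Sym2.eq_swap (a := v)]; push_cast; ring)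
    (fun k hk => by
      obtain ⟨q, -, hq⟩ := C.exists_inv _ (hlam _ (h.isEdgeOf_sides hk).2.2)
      refine IsUnit.mul ?_ (IsUnit.of_mul_eq_one_right _ hq)
      exact IsUnit.of_mul_eq_one (χ (c k) (v k) : E) (by rw [← Int.cast_mul, χ_sq, Int.cast_one]))
    (fun k => ((χ (c k) b * χ (c k) (v k) * χ (c k) (w k) : ℤ) : E) •
      (C.sqrt (lam s(c k, w k)) * C.sqrt (lam s(w k, v k)) * C.sqrt (lam s(c k, v k))) • m k)
  have hell : ∀ u v, osp P.β (x u) (x v) = (χ u v : E) * lam s(u, v) →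
      (SuperFrame.ofVec P x).ell u v = lam s(u, v) := by
    intro u v huv
    have e := congrArg (Int.cast (R := E)) (χ_sq u v)
    push_cast at e
    rw [SuperFrame.ell, show (SuperFrame.ofVec P x).ν u v = _ from huv]
    linear_combination lam s(u, v) * e
  refine ⟨SuperFrame.ofVec P x, fun k hk => hell _ _ (hx k hk).1,
    fun k hk => hell _ _ (hx k hk).2.1, fun k hk => hell _ _ (hx k hk).2.2.1, fun k hk => ?_⟩
  rw [triRoot, hell _ _ (hx k hk).1, hell _ _ (hx k hk).2.1, hell _ _ (hx k hk).2.2.1]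
  exact (hx k hk).2.2.2

end ChainFrame

section ChainFrame

variable {A : Type*} [Ring A] {n : ℕ} {a b : Fin (n + 3)} {D : Finset (Edg (n + 3))}
  {c w v : ℕ → Fin (n + 3)}
  {E O : Type*} [CommRing E] [AddCommGroup O] [Module E O] {P : OddPairing E O}
  {H : SuperHull A P} {C : EvenCone E} {F : SuperFrame (Fin (n + 3)) P}
  {lam : Edg (n + 3) → E} {m : ℕ → O}

lemma FanChain.χ_consecutive (h : FanChain n a b D c w v) {k : ℕ} (hk : k < n) :
    χ (w k) b * χ (c k) (v k) * (χ (w (k + 1)) b * χ (c (k + 1)) (v (k + 1))) =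
      cycSign (c k) (w k) (v k) * χ (w k) (v (k + 1)) := by
  obtain ⟨e1, e2⟩ := χ_quad (h.opposite hk (Or.inl rfl))
  obtain ⟨e3, e4⟩ := χ_quad (h.opposite hk (Or.inr rfl))
  have s0 := cycSign_sq (c k) (w k) (v k)
  have s2 := χ_sq (c k) b
  have s4 := χ_sq (c k) (v (k + 1))
  rw [e1, e3]
  generalize cycSign (c k) (w k) (v k) = s at *
  rcases h.step k hk with ⟨f1, f2⟩ | ⟨f1, f2⟩ <;> rw [f1, f2]
  · linear_combination s * χ (c k) (w k) * χ (c k) (v (k + 1)) * e2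
  · linear_combination s * χ (c k) (w k) * χ (c k) (v k) * χ (v k) (v (k + 1)) * (s2 - s4)
      + s * χ (c k) (w k) * χ (c k) (v (k + 1)) * e4

lemma FanChain.χ_third (h : FanChain n a b D c w v) {k : ℕ} (hk : k ≤ n) :
    χ (w k) b = cycSign (c k) (w k) (v k) * χ (c k) (w k) * χ (c k) b := by
  rcases Nat.lt_or_eq_of_le hk with hk | rfl
  · exact (χ_quad (h.opposite hk (Or.inl rfl))).1
  have hne := h.ne k le_rfl
  rw [h.last] at *
  have s1 := χ_sq (c k) (w k)
  have s2 := χ_sq (c k) b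
  have s3 := χ_sq (w k) b
  rcases cyc_or hne.1 hne.2.1 hne.2.2 with hc | hc
  · have e := hc.χ_mul
    rw [χ_swap hne.2.2] at e
    rw [cycSign_eq hc]
    linear_combination - χ (w k) b * s1 - χ (w k) b * χ (c k) (w k) * χ (c k) (w k) * s2
      - χ (c k) (w k) * χ (c k) b * e
  · have e := hc.χ_mul
    rw [χ_swap hne.2.1, χ_swap hne.1] at e
    rw [cycSign_eq_neg hc]
    linear_combination - χ (w k) b * s1 - χ (w k) b * χ (c k) (w k) * χ (c k) (w k) * s2
      + χ (c k) (w k) * χ (c k) b * e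

lemma FanChain.exists_signs (h : FanChain n a b D c w v) :
    ∃ η : Finset (Fin (n + 3)) → ℤ,
      (∀ k ≤ n, η {c k, w k, v k} = χ (w k) b * χ (c k) (v k)) ∧ ∀ t, η t * η t = 1 := by
  classical
  refine ⟨fun t => if ht : ∃ k ≤ n, t = {c k, w k, v k} then
    χ (w ht.choose) b * χ (c ht.choose) (v ht.choose) else 1, fun k hk => ?_, fun t => ?_⟩
  · have ht : ∃ j ≤ n, ({c k, w k, v k} : Finset (Fin (n + 3))) = {c j, w j, v j} := ⟨k, hk, rfl⟩
    simp only [dif_pos ht]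
    rw [← h.triangle_inj hk ht.choose_spec.1 ht.choose_spec.2]
  · dsimp only
    split_ifs
    · rw [mul_mul_mul_comm, χ_sq, χ_sq]; rfl
    · rfl

/-- A frame with the side lengths and odd invariants of a chain of triangles realizes a state. -/
lemma ChainFrame.realizes (hF : ChainFrame n b c w v C F lam m) (h : FanChain n a b D c w v)
    (hlam : ∀ e, isEdgeOf D e → lam e ∈ C.Pos) {st : PState A (n + 3)} (hdiag : st.diag = D)
    (hst : ∀ e, isEdgeOf D e → st.lam e = H.ι (lam e))
    (hmu : ∀ k ≤ n, st.mu {c k, w k, v k} = H.κ (m k))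
    (hori : ∀ k < n, sgn st.ori (c k) (v k) = 1) : ∃ η, Realizes H C F η st := by
  obtain ⟨η, hη, hη'⟩ := h.exists_signs
  refine ⟨η, by rw [hdiag]; exact h.noncross, ?_, ?_, hη', ?_⟩
  · intro x y hxy he
    rw [hdiag] at he
    suffices hell : F.ell x y = lam s(x, y) by
      rw [hell]; exact ⟨hlam _ he, hst _ he⟩
    have aux : ∀ {u t : Fin (n + 3)}, u ≠ t → F.ell u t = lam s(u, t) → s(x, y) = s(u, t) →
        F.ell x y = lam s(x, y) := by
      intro u t hut hl e
      rcases Sym2.eq_iff.1 e with ⟨rfl, rfl⟩ | ⟨rfl, rfl⟩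
      · exact hl
      · rw [F.ell_swap hut, hl, Sym2.eq_swap]
    obtain ⟨k, hk, e | e | e⟩ := h.exists_side he
    · exact aux (h.ne k hk).2.2 (hF.ell_diag k hk) e
    · exact aux (h.ne k hk).2.1 (hF.ell_side k hk) e
    · exact aux (h.ne k hk).1 (hF.ell_third k hk) e
  · intro p j r hc ht
    rw [hdiag] at ht
    obtain ⟨k, hk, e⟩ := h.exists_triangle ht
    have hne := h.ne k hk
    have s1 := χ_sq (c k) (w k)
    have s2 := χ_sq (c k) b
    have s3 := χ_sq (c k) (v k)
    have e1 := h.χ_third hk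
    have hD := hF.odd k hk
    rcases cyc_or hne.1 hne.2.1 hne.2.2 with hc' | hc'
    · refine RealizesTri.of_eq (p := c k) (j := w k) (r := v k) hc' hc ⟨m k, hmu k hk, ?_⟩ e
      rw [hη k hk, hD, smul_smul, ← Int.cast_mul, e1, cycSign_eq hc']
      rw [show 1 * χ (c k) (w k) * χ (c k) b * χ (c k) (v k) *
        (χ (c k) b * χ (c k) (v k) * χ (c k) (w k)) = (χ (c k) (w k) * χ (c k) (w k)) *
        (χ (c k) b * χ (c k) b) * (χ (c k) (v k) * χ (c k) (v k)) by ring, s1, s2, s3]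
      simp
    · refine RealizesTri.of_eq (p := c k) (j := v k) (r := w k) hc' hc
        ⟨m k, by rw [← finset_swap, hmu k hk], ?_⟩ (e.trans (finset_swap _ _ _))
      rw [← finset_swap, hη k hk, F.D_swap_right, hD, smul_neg, smul_smul, ← Int.cast_mul, e1,
        cycSign_eq_neg hc']
      rw [show -1 * χ (c k) (w k) * χ (c k) b * χ (c k) (v k) *
        (χ (c k) b * χ (c k) (v k) * χ (c k) (w k)) = - ((χ (c k) (w k) * χ (c k) (w k)) *
        (χ (c k) b * χ (c k) b) * (χ (c k) (v k) * χ (c k) (v k))) by ring, s1, s2, s3]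
      rw [triRoot, triRoot, F.ell_swap hne.2.1]
      push_cast
      module
  · intro p j r l hc hc' hm ht ht'
    rw [hdiag] at hm ht ht'
    obtain ⟨k, hk, e⟩ := h.enum _ hm
    have e2 := h.χ_consecutive hk
    rw [← hη k hk.le, ← hη (k + 1) hk, h.next_triangle hk] at e2
    have hne := h.ne k hk.le
    have ho := h.opposite hk (Or.inr rfl)
    have hwz : w k ≠ v (k + 1) := by
      rintro hw
      rw [← hw] at ho
      rcases ho with ⟨o1, o2⟩ | ⟨o1, o2⟩
      exacts [o1.not_swap o2, o1.not_swap o2]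
    have rel := χ_swap hwz
    have sq := χ_sq (w k) (v (k + 1))
    have hs := sgn_cases st.ori hne.2.2
    rw [hori k hk] at hs
    have hs : sgn st.ori (v k) (c k) = -1 := by omega
    have tri_l : ∀ x, Cyc (c k) x (v k) → IsTri D {c k, x, v k} →
        (x = w k ∧ Cyc (c k) (w k) (v k)) ∨
        (x = v (k + 1) ∧ Cyc (c k) (v (k + 1)) (v k)) := by
      intro x hx htx
      rcases h.eq_of_isTri hk hx.ne.1.symm hx.ne.2.1 htx with rfl | rfl
      · exact Or.inl ⟨rfl, hx⟩
      · exact Or.inr ⟨rfl, hx⟩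
    have tri_r : ∀ x, Cyc (c k) (v k) x → IsTri D {c k, v k, x} →
        (x = w k ∧ Cyc (c k) (v k) (w k)) ∨
        (x = v (k + 1) ∧ Cyc (c k) (v k) (v (k + 1))) := by
      intro x hx htx
      rw [finset_swap] at htx
      rcases h.eq_of_isTri hk hx.ne.2.2.symm hx.ne.2.1.symm htx with rfl | rfl
      · exact Or.inl ⟨rfl, hx⟩
      · exact Or.inr ⟨rfl, hx⟩
    have main : ∀ j l, Cyc (c k) j (v k) → Cyc (c k) (v k) l → IsTri D {c k, j, v k} →
        IsTri D {c k, v k, l} → χ j l * η {c k, j, v k} * η {c k, v k, l} = 1 := by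
      intro j l hj hl tj tl
      rcases tri_l j hj tj with ⟨rfl, g1⟩ | ⟨rfl, g1⟩ <;>
        rcases tri_r l hl tl with ⟨rfl, g2⟩ | ⟨rfl, g2⟩
      · exact (g1.not_swap g2).elim
      · rw [cycSign_eq g1] at e2
        linear_combination χ (w k) (v (k + 1)) * e2 + sq
      · rw [cycSign_eq_neg g2] at e2
        rw [rel, finset_swap (c k) (v (k + 1)), finset_swap (c k) (v k) (w k)]
        linear_combination - χ (w k) (v (k + 1)) * e2 + sq
      · exact (g1.not_swap g2).elim
    rcases Sym2.eq_iff.1 e with ⟨rfl, rfl⟩ | ⟨rfl, rfl⟩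
    · rw [hori k hk, main j l hc hc' ht ht']
    · have hjl : j ≠ l := by
        rintro rfl
        exact hc.not_swap hc'
      have f1 : ({v k, j, c k} : Finset (Fin (n + 3))) = {c k, v k, j} := by ext; simp; tauto
      have f2 : ({v k, c k, l} : Finset (Fin (n + 3))) = {c k, l, v k} := by ext; simp; tauto
      rw [f1] at ht ⊢
      rw [f2] at ht' ⊢
      have := main l j hc'.rot hc.rot.rot ht' ht
      rw [χ_swap hjl] at this
      rw [hs]
      linear_combination this
end ChainFrame

section ChainFrame

variable {n : ℕ} {a b : Fin (n + 3)} {D : Finset (Edg (n + 3))} {c w v : ℕ → Fin (n + 3)}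
  {E O : Type*} [CommRing E] [AddCommGroup O] [Module E O] {P : OddPairing E O}
  {C : EvenCone E} {F : SuperFrame (Fin (n + 3)) P} {lam : Edg (n + 3) → E} {m : ℕ → O}

lemma EvenCone.sqrt_div_mul {x y z q : E} (hx : x ∈ C.Pos) (hy : y ∈ C.Pos) (hz : z ∈ C.Pos)
    (hq : q ∈ C.Pos) (h : q * (x * y) = 1) :
    C.sqrt (z * q) * (x * y) = C.sqrt x * C.sqrt z * C.sqrt y := by
  have e : z * q * (x * y) = z := by rw [mul_assoc, h, mul_one]
  have e' := congrArg C.sqrt e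
  rw [C.sqrt_mul _ (C.mul_mem _ hz _ hq) _ (C.mul_mem _ hx _ hy), C.sqrt_mul _ hx _ hy] at e'
  linear_combination C.sqrt x * C.sqrt y * e' - C.sqrt (z * q) * x * C.sqrt_sq _ hy
    - C.sqrt (z * q) * C.sqrt y * C.sqrt y * C.sqrt_sq _ hx

lemma cast_χ_sq {N : ℕ} (x y : Fin N) : ((χ x y : ℤ) : E) * (χ x y : ℤ) = 1 := by
  rw [← Int.cast_mul, χ_sq, Int.cast_one]

/-- The odd coordinates of the remaining part of a chain relative to its end. -/
lemma ChainFrame.exists_tail (hF : ChainFrame n b c w v C F lam m) (h : FanChain n a b D c w v)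
    (hlam : ∀ e, isEdgeOf D e → lam e ∈ C.Pos) {W : ℕ → E}
    (hW : ∀ k ≤ n, W k * (lam s(c k, w k) * lam s(c k, v k)) = triRoot C F (c k) (w k) (v k)) :
    ∃ t : ℕ → O, t (n + 1) = 0 ∧
      (∀ k ≤ n, t k = (F.ell (c k) b * W k) • m k + t (k + 1)) ∧
      ∀ k < n, F.ν (c k) (v k) • t (k + 1) = F.D (c k) (v k) b := by
  have hinv : ∀ k, ∃ q, k ≤ n → q * lam s(c k, w k) = 1 := by
    intro k
    by_cases hk : k ≤ n
    · obtain ⟨q, -, hq⟩ := C.exists_inv _ (hlam _ (h.isEdgeOf_sides hk).1)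
      exact ⟨q, fun _ => hq⟩
    · exact ⟨0, fun h => (hk h).elim⟩
  choose q hq using hinv
  let t : ℕ → O := fun k => if k ≤ n then ((χ (c k) (w k) : E) * q k) • F.D (c k) (w k) b else 0
  have ht : ∀ k ≤ n, F.ν (c k) (w k) • t k = F.D (c k) (w k) b := by
    intro k hk
    have s := cast_χ_sq (E := E) (c k) (w k)
    have : F.ν (c k) (w k) * ((χ (c k) (w k) : E) * q k) = 1 := by
      rw [F.ν_eq, hF.ell_third k hk]
      linear_combination s + χ (c k) (w k) * χ (c k) (w k) * hq k hk
    simp only [t, if_pos hk]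
    rw [smul_smul, this, one_smul]
  have ht' : ∀ k < n, F.ν (c k) (v k) • t (k + 1) = F.D (c k) (v k) b := by
    intro k hk
    have := ht (k + 1) hk
    rcases h.step k hk with ⟨e1, e2⟩ | ⟨e1, e2⟩ <;> rw [e1, e2] at this
    · exact this
    · rw [F.ν_swap, F.D_swap_left, neg_smul, neg_inj] at this
      exact this
  have hD : ∀ k ≤ n, F.D (c k) (w k) (v k) =
      (F.ν (c k) (w k) * F.ν (c k) (v k) * (χ (c k) b * W k)) • m k := by
    intro k hk
    rw [hF.odd k hk, ← hW k hk, smul_smul, F.ν_eq, F.ν_eq, hF.ell_third k hk, hF.ell_diag k hk]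
    push_cast
    congr 1
    ring
  have hνw : ∀ k ≤ n, ∀ {x y : O}, F.ν (c k) (w k) • x = F.ν (c k) (w k) • y → x = y := by
    intro k hk x y hxy
    rw [F.ν_eq, mul_smul, mul_smul] at hxy
    have := congrArg ((χ (c k) (w k) : E) • ·) hxy
    simp only [smul_smul, cast_χ_sq, ← mul_assoc, one_mul] at this
    rw [hF.ell_third k hk] at this
    exact C.smul_cancel (hlam _ (h.isEdgeOf_sides hk).1) this
  have hνv : ∀ k ≤ n, ∀ {x y : O}, F.ν (c k) (v k) • x = F.ν (c k) (v k) • y → x = y := by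
    intro k hk x y hxy
    rw [F.ν_eq, mul_smul, mul_smul] at hxy
    have := congrArg ((χ (c k) (v k) : E) • ·) hxy
    simp only [smul_smul, cast_χ_sq, ← mul_assoc, one_mul] at this
    rw [hF.ell_diag k hk] at this
    exact C.smul_cancel (hlam _ (h.isEdgeOf_sides hk).2.2) this
  refine ⟨t, by simp [t], ?_, ht'⟩
  intro k hk
  apply hνw k hk
  rw [ht k hk]
  rcases Nat.lt_or_eq_of_le hk with hk' | rfl
  · apply hνv k hk
    rw [F.plucker (c k) (w k) (v k) b, hD k hk, ← ht' k hk', SuperFrame.ell]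
    module
  · have e : t (k + 1) = 0 := by simp [t]
    have e' := hD k le_rfl
    rw [h.last] at e'
    rw [e, e', SuperFrame.ell, add_zero, smul_smul]
    congr 1
    ring

/-- The super Ptolemy relation of the triangle `k` of a chain and the end of the chain. -/
lemma ChainFrame.ell_third_end (hF : ChainFrame n b c w v C F lam m) (h : FanChain n a b D c w v)
    (hlam : ∀ e, isEdgeOf D e → lam e ∈ C.Pos) {k : ℕ} (hk : k < n) {W : E} {t : O}
    (hW : W * (lam s(c k, w k) * lam s(c k, v k)) = triRoot C F (c k) (w k) (v k))
    (ht : F.ν (c k) (v k) • t = F.D (c k) (v k) b) :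
    lam s(c k, v k) * F.ell (w k) b = lam s(c k, w k) * F.ell (v k) b +
      lam s(w k, v k) * F.ell (c k) b -
      cycSign (c k) (w k) (v k) * (lam s(c k, v k) * (lam s(c k, w k) * (W * P.β (m k) t))) := by
  have key := F.ptolemy (c k) (w k) (v k) b
  rw [← ht, hF.odd k hk.le, ← hW] at key
  simp only [map_smul, LinearMap.smul_apply, smul_eq_mul] at key
  have hc : F.ν (c k) (v k) * F.ν (w k) b = F.ν (c k) (w k) * F.ν (v k) b +
      F.ν (c k) b * F.ν (w k) (v k) - ((χ (c k) b * χ (c k) (v k) * χ (c k) (w k) : ℤ) : E) *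
        (W * (lam s(c k, w k) * lam s(c k, v k)) * P.β (m k) t) := by
    have s := cast_χ_sq (E := E) (c k) (v k)
    apply C.smul_cancel (hlam _ (h.isEdgeOf_sides hk.le).2.2)
    rw [smul_eq_mul, smul_eq_mul, ← hF.ell_diag k hk.le, SuperFrame.ell]
    rw [← hF.ell_diag k hk.le, SuperFrame.ell] at key
    linear_combination (χ (c k) (v k) : E) * key
  obtain ⟨e1, e2⟩ := χ_quad (h.opposite hk (Or.inl rfl))
  have e3 : χ (c k) (w k) * χ (w k) (v k) * χ (c k) (v k) = cycSign (c k) (w k) (v k) := by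
    have hne := h.ne k hk.le
    rcases cyc_or hne.1 hne.2.1 hne.2.2 with g | g
    · have := g.χ_mul
      rw [χ_swap hne.2.2] at this
      rw [cycSign_eq g]
      linear_combination - this
    · have := g.χ_mul
      rw [χ_swap hne.1, χ_swap hne.2.1] at this
      rw [cycSign_eq_neg g]
      linear_combination this
  have s1 := cast_χ_sq (E := E) (c k) (v k)
  have s3 := cast_χ_sq (E := E) (c k) b
  have s4 := cast_χ_sq (E := E) (c k) (w k)
  have s5 : (cycSign (c k) (w k) (v k) : E) * cycSign (c k) (w k) (v k) = 1 := by
    rw [← Int.cast_mul, cycSign_sq, Int.cast_one]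
  replace e1 := congrArg (Int.cast (R := E)) e1
  replace e2 := congrArg (Int.cast (R := E)) e2
  replace e3 := congrArg (Int.cast (R := E)) e3
  simp only [F.ν_eq, hF.ell_third k hk.le, hF.ell_diag k hk.le, hF.ell_side k hk.le] at hc
  push_cast at e1 e2 e3 hc
  rw [e1] at hc
  generalize (cycSign (c k) (w k) (v k) : E) = ε at *
  generalize (χ (c k) (v k) : E) = χv at *
  generalize (χ (c k) (w k) : E) = χw at *
  generalize (χ (c k) b : E) = χb at *
  generalize (χ (v k) b : E) = χvb at *
  generalize (χ (w k) (v k) : E) = χwv at *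
  have l1 : χv * χv * (ε * ε) * (χw * χw) * (χb * χb) = 1 := by rw [s1, s5, s4, s3]; ring
  have l2 : ε * χv * χb * χvb * (χw * χw) = 1 := by rw [s4]; linear_combination ε * e2 + s5
  have l3 : ε * χv * χw * χwv * (χb * χb) = 1 := by rw [s3]; linear_combination ε * e3 + s5
  have l4 : χv * χv * (χw * χw) * (χb * χb) = 1 := by rw [s1, s4, s3]; ring
  linear_combination ε * χv * χw * χb * hc - lam s(c k, v k) * F.ell (w k) b * l1 +
    lam s(c k, w k) * F.ell (v k) b * l2 + lam s(w k, v k) * F.ell (c k) b * l3 -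
    ε * (W * (lam s(c k, w k) * lam s(c k, v k)) * P.β (m k) t) * l4

end ChainFrame

namespace FanChain

variable {n : ℕ} {a b : Fin (n + 3)} {D0 : Finset (Edg (n + 3))} {c w v : ℕ → Fin (n + 3)}
  {dsp : Fin n → Fin (n + 3) × Fin (n + 3)} {o : Edg (n + 3) → Bool}

lemma cyc_start_iff (hF : FanChain n a b D0 c w v) {k : ℕ} (hk : k < n) :
    Cyc (c k) a (v k) ↔ Cyc (c k) (w k) (v k) := by
  have hne := hF.ne k hk.le
  have h1 := crossE_iff.1 (hF.cross k hk)
  have h2 := crossE_iff.1 (hF.order k hk k le_rfl (w k) (by simp) hne.1.symm hne.2.1)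
  constructor
  · intro h
    rcases h2 with h2 | h2
    · exact h2.1
    · rcases h1 with h1 | h1
      · exact (h2.1.not_swap h1.2.rot.rot).elim
      · exact (h.not_swap h1.2.rot.rot).elim
  · intro h
    rcases h1 with h1 | h1
    · exact h1.1
    · rcases h2 with h2 | h2
      · exact (h1.1.not_swap h2.2.rot.rot).elim
      · exact (h.not_swap h2.2.rot.rot).elim

lemma rOf_eq_true_iff (hF : FanChain n a b D0 c w v)
    (hdsp : ∀ k : Fin n, s((dsp k).1, (dsp k).2) = s(c k, v k)) (k : Fin n)
    (hlt : (dsp k).1 < (dsp k).2) (ho : o s((dsp k).1, (dsp k).2) = decide ((dsp k).1 = c k)) :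
    rOf o dsp a k = true ↔ ¬ Cyc (c k) (w k) (v k) := by
  have hne := hF.ne k k.isLt.le
  have ha := hF.first_fresh k.isLt.le
  rw [← hF.cyc_start_iff k.isLt, rOf, ho]
  unfold Cyc
  rcases Sym2.eq_iff.1 (hdsp k) with ⟨e1, e2⟩ | ⟨e1, e2⟩ <;> rw [e1, e2] at hlt ⊢
  · simp
    omega
  · have := hlt.ne
    simp [this]
    omega

lemma sgn_diagonal (hdsp : ∀ k : Fin n, s((dsp k).1, (dsp k).2) = s(c k, v k)) (k : Fin n)
    (hlt : (dsp k).1 < (dsp k).2) (ho : o s((dsp k).1, (dsp k).2) = decide ((dsp k).1 = c k)) :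
    sgn o (c k) (v k) = 1 := by
  rw [sgn, ← hdsp k, ho]
  rcases Sym2.eq_iff.1 (hdsp k) with ⟨e1, e2⟩ | ⟨e1, e2⟩ <;> rw [e1, e2] at hlt <;> rw [e1]
  · rcases χ_cases (c k) (v k) with ⟨h, e⟩ | ⟨h, e⟩ <;> rw [e]
    · simp
    · omega
  · have := hlt.ne
    rcases χ_cases (c k) (v k) with ⟨h, e⟩ | ⟨h, e⟩ <;> rw [e]
    · omega
    · simp [this]

end FanChain

section Weight

variable {A : Type*} [Ring A] {n : ℕ} {a b : Fin (n + 3)} {D0 : Finset (Edg (n + 3))}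
  {c w v : ℕ → Fin (n + 3)}
  {ctr : Fin (n + 1) → Fin (n + 3)} {dsp : Fin n → Fin (n + 3) × Fin (n + 3)}
  {tri : Fin (n + 1) → Finset (Fin (n + 3))} {oth : Fin (n + 1) → Fin (n + 3) × Fin (n + 3)}
  {lam0 : Edg (n + 3) → A} {mu0 : Finset (Fin (n + 3)) → A} {Pos : Set A} {sqrt : A → A}

lemma SuperHull.inverse_ι {E O : Type*} [CommRing E] [AddCommGroup O] [Module E O]
    {P : OddPairing E O} (H : SuperHull A P) {p q : E} (h : q * p = 1) :
    Ring.inverse (H.ι p) = H.ι q := by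
  have h1 : H.ι q * H.ι p = 1 := by rw [← map_mul, h, map_one]
  have h2 : H.ι p * H.ι q = 1 := by rw [← map_mul, mul_comm, h, map_one]
  have hu : IsUnit (H.ι p) := ⟨⟨_, _, h2, h1⟩, rfl⟩
  rw [← one_mul (Ring.inverse _), ← h1, mul_assoc, Ring.mul_inverse_cancel _ hu, mul_one]

lemma stepWt_commute (hPosMul : ∀ p ∈ Pos, ∀ q ∈ Pos, p * q ∈ Pos)
    (hPosInv : ∀ p ∈ Pos, Ring.inverse p ∈ Pos)
    (hPosCentral : ∀ p ∈ Pos, ∀ x : A, p * x = x * p) (hsqrtMem : ∀ p ∈ Pos, sqrt p ∈ Pos)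
    (htri : ∀ k, IsTri D0 (tri k)) (htriv : ∀ k, tri k = {ctr k, (oth k).1, (oth k).2})
    (hvdist : ∀ k, ctr k ≠ (oth k).1 ∧ ctr k ≠ (oth k).2 ∧ (oth k).1 ≠ (oth k).2)
    (hlam0 : ∀ e : Edg (n + 3), isEdgeOf D0 e → lam0 e ∈ Pos)
    {par m : ℕ} {x y : VV n} (h : IsStep D0 ctr dsp par m x y) (z : A) :
    Commute (stepWt lam0 sqrt ctr oth par (x, y)) z := by
  have hsig : ∀ k, Commute (sqrt (lam0 s((oth k).1, (oth k).2) *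
      Ring.inverse (lam0 s(ctr k, (oth k).1) * lam0 s(ctr k, (oth k).2)))) z := by
    intro k
    have ht := htri k
    rw [htriv k] at ht
    have hd := hvdist k
    exact hPosCentral _ (hsqrtMem _ (hPosMul _ (hlam0 _ (ht.2 _ (by simp) _ (by simp) hd.2.2)) _
      (hPosInv _ (hPosMul _ (hlam0 _ (ht.2 _ (by simp) _ (by simp) hd.1)) _
        (hlam0 _ (ht.2 _ (by simp) _ (by simp) hd.2.1)))))) z
  rcases x with x | k <;> rcases y with y | k'
  · have he := hlam0 _ h.1.2
    unfold stepWt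
    dsimp only
    split_ifs
    · exact hPosCentral _ he z
    · exact hPosCentral _ (hPosInv _ he) z
  · exact hsig k'
  · exact hsig k
  · exact Commute.one_left z

variable {E O : Type*} [CommRing E] [AddCommGroup O] [Module E O] {P : OddPairing E O}
  {H : SuperHull A P} {C : EvenCone E} {lam : Edg (n + 3) → E}

lemma FanChain.exists_sigHom_eq (hF : FanChain n a b D0 c w v) (hC : C.Lifts H Pos sqrt)
    (hctr : ∀ k : Fin (n + 1), ctr k = c k)
    (hoth : ∀ k : Fin (n + 1), s((oth k).1, (oth k).2) = s(w k, v k))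
    (hlam : ∀ e, isEdgeOf D0 e → lam e ∈ C.Pos) (hlam0 : ∀ e, isEdgeOf D0 e → H.ι (lam e) = lam0 e)
    (r : Fin (n + 1) → Bool) (k : Fin (n + 1)) :
    ∃ W : E, W * (lam s(c k, w k) * lam s(c k, v k)) =
        C.sqrt (lam s(c k, w k)) * C.sqrt (lam s(w k, v k)) * C.sqrt (lam s(c k, v k)) ∧
      ∀ z, FanChain.sigHom ctr lam0 mu0 sqrt tri oth r k z =
        H.ι W * if r k then mu0 (tri k) * z else z * mu0 (tri k) := by
  obtain ⟨h1, h2, h3⟩ := hF.isEdgeOf_sides (Nat.le_of_lt_succ k.isLt)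
  obtain ⟨q, hq, hq'⟩ := C.exists_inv _ (C.mul_mem _ (hlam _ h1) _ (hlam _ h3))
  refine ⟨C.sqrt (lam s(w k, v k) * q),
    C.sqrt_div_mul (hlam _ h1) (hlam _ h3) (hlam _ h2) hq hq', fun z => ?_⟩
  have e : lam0 s(ctr k, (oth k).1) * lam0 s(ctr k, (oth k).2) =
      H.ι (lam s(c k, w k) * lam s(c k, v k)) := by
    rw [map_mul, hlam0 _ h1, hlam0 _ h3, hctr]
    rcases Sym2.eq_iff.1 (hoth k) with ⟨e1, e2⟩ | ⟨e1, e2⟩ <;> rw [e1, e2]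
    rw [← hlam0 _ h1, ← hlam0 _ h3, ← map_mul, ← map_mul, mul_comm]
  rw [FanChain.sigHom, dif_pos k.isLt, hC.map_sqrt _ (C.mul_mem _ (hlam _ h2) _ hq), map_mul,
    ← H.inverse_ι hq', hlam0 _ h2, ← e, ← hoth k]
  simp only [AddMonoidHom.comp_apply, AddMonoidHom.coe_mulLeft, starHom]
  split_ifs <;> rfl

end Weight

lemma ChainFrame.eval {A : Type*} [Ring A] {n : ℕ} {a b : Fin (n + 3)} {D : Finset (Edg (n + 3))}
    {c w v : ℕ → Fin (n + 3)} {E O : Type*} [CommRing E] [AddCommGroup O] [Module E O]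
    {P : OddPairing E O} {H : SuperHull A P} {C : EvenCone E} {F : SuperFrame (Fin (n + 3)) P}
    {lam : Edg (n + 3) → E} {m : ℕ → O} {lam0 : Edg (n + 3) → A}
    {S : ℕ → A →+ A} {U V : ℕ → Fin (n + 3) → A} {G : ℕ → A}
    (hF : ChainFrame n b c w v C F lam m) (h : FanChain n a b D c w v)
    (hlam : ∀ e, isEdgeOf D e → lam e ∈ C.Pos) (hlam0 : ∀ e, isEdgeOf D e → H.ι (lam e) = lam0 e)
    (hcent : ∀ k < n, ∀ x, lam0 s(c k, v k) * x = x * lam0 s(c k, v k))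
    (hS : PathSystem b c v lam0 S U V G) {r : ℕ → Bool}
    (hr : ∀ k < n, r k = true ↔ ¬ Cyc (c k) (w k) (v k)) {W : ℕ → E}
    (hW : ∀ k ≤ n, W k * (lam s(c k, w k) * lam s(c k, v k)) = triRoot C F (c k) (w k) (v k))
    (hSW : ∀ k ≤ n, ∀ z, S k z = H.ι (W k) * if r k then H.κ (m k) * z else z * H.κ (m k)) :
    U 0 a = H.ι (F.ell a b) := by
  obtain ⟨t, ht0, ht1, ht2⟩ := hF.exists_tail h hlam hW
  have hodd : ∀ k ≤ n, S k (H.ι (F.ell (c k) b)) = H.κ ((F.ell (c k) b * W k) • m k) := by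
    intro k hk
    rw [hSW k hk, ← H.smul_left, ← H.smul_right, ite_self, ← H.smul_left, smul_smul, mul_comm]
  have hsum : ∀ i k, k + i = n + 1 →
      ∑ j ∈ Finset.Ico k (n + 1), S j (H.ι (F.ell (c j) b)) = H.κ (t k) := by
    intro i
    induction i with
    | zero =>
      intro k hk
      obtain rfl : k = n + 1 := by omega
      rw [Finset.Ico_self, Finset.sum_empty, ht0, map_zero]
    | succ i ih =>
      intro k hk
      rw [Finset.sum_eq_sum_Ico_succ_bot (by omega), ih (k + 1) (by omega), hodd k (by omega),
        ht1 k (by omega), map_add]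
  have hmem : ∀ k < n, H.ι (lam s(c k, v k)) = lam0 s(c k, v k) := fun k hk =>
    hlam0 _ (h.isEdgeOf_sides hk.le).2.2
  refine hS.eval h (Lb := fun x => H.ι (F.ell x b)) ?_ ?_ ?_ ?_ ?_
  · intro k hk
    obtain ⟨q, -, hq⟩ := C.exists_inv _ (hlam _ (h.isEdgeOf_sides hk.le).2.2)
    rw [← hmem k hk]
    exact (IsUnit.of_mul_eq_one_right _ hq).map H.ι
  · exact hcent
  · have := hF.ell_diag n le_rfl
    have e := hlam0 _ (h.isEdgeOf_sides le_rfl).2.2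
    rw [h.last] at this e
    rw [this, e]
  · have := hF.ell_side n le_rfl
    have e := hlam0 _ (h.isEdgeOf_sides le_rfl).2.1
    rw [h.last] at this e
    rw [this, e]
  · intro k hk
    obtain ⟨e1, e2, e3⟩ := h.isEdgeOf_sides hk.le
    have hpair : S k (H.κ (t (k + 1))) =
        H.ι (- (cycSign (c k) (w k) (v k) * (W k * P.β (m k) (t (k + 1))))) := by
      have hr := hr k hk
      rw [hSW k hk.le]
      have hne := h.ne k hk.le
      rcases cyc_or hne.1 hne.2.1 hne.2.2 with g | g
      · rw [if_neg (by rw [hr]; exact not_not_intro g), H.mul_odd, cycSign_eq g,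
          pairing_swap P.alt, ← map_mul]
        congr 1
        push_cast
        ring
      · rw [if_pos (by rw [hr]; exact g.not_swap), H.mul_odd, cycSign_eq_neg g, ← map_mul]
        congr 1
        push_cast
        ring
    rw [hsum (n - k) (k + 1) (by omega), hpair, Sym2.eq_swap (a := w k) (b := c k), ← hlam0 _ e1,
      ← hlam0 _ e2, ← hlam0 _ e3]
    simp only [← map_mul, ← map_add]
    congr 1
    rw [hF.ell_third_end h hlam hk (hW k hk.le) (ht2 k hk)]
    ring

/-- Theorem 5.10, the main theorem of the paper.  Let `T` be a
triangulation of the `(n+3)`-gon, `a, b` nonadjacent boundary vertices such that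
the arc `(a,b)` crosses every internal diagonal of `T`, equipped with the
default orientation relative to `(a,b)` (each diagonal oriented away from the
center of the fan containing the face on its `a`-side — in particular the
diagonals joining consecutive fan centers are oriented `c₁ → c₂ → ⋯`).  Then the
`λ`-length of `(a,b)`, obtained from the initial `λ`-lengths and `μ`-invariants
by **any** sequence of super Ptolemy flips producing a triangulation containing
`(a,b)`, equals `Σ_{t ∈ 𝒯_{a,b}} wt(t)`, the sum of the weights of all super
`T`-paths from `a` to `b`. -/
theorem super_lambda_length_expansion
    (n : ℕ) (hn : 1 ≤ n)
    (A : Type*) [Ring A] [Algebra ℚ A]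
    (Pos : Set A) (sqrt : A → A)
    (hPosAdd : ∀ p ∈ Pos, ∀ q ∈ Pos, p + q ∈ Pos)
    (hPosMul : ∀ p ∈ Pos, ∀ q ∈ Pos, p * q ∈ Pos)
    (hPosInv : ∀ p ∈ Pos, Ring.inverse p ∈ Pos)
    (hPosCentral : ∀ p ∈ Pos, ∀ x : A, p * x = x * p)
    (hPosUnit : ∀ p ∈ Pos, IsUnit p)
    (hsqrtSq : ∀ p ∈ Pos, sqrt p * sqrt p = p)
    (hsqrtMem : ∀ p ∈ Pos, sqrt p ∈ Pos)
    (hsqrtMul : ∀ p ∈ Pos, ∀ q ∈ Pos, sqrt (p * q) = sqrt p * sqrt q)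
    -- the polygon, the arc, and the initial triangulation
    (a b : Fin (n + 3)) (hab : a ≠ b) (hnadj : ¬ isBnd s(a, b))
    (D0 : Finset (Edg (n + 3))) (hD0 : IsTriangulation D0)
    -- the combinatorial structure of `D0` along the arc `(a, b)`
    (tri : Fin (n + 1) → Finset (Fin (n + 3)))
    (ctr : Fin (n + 1) → Fin (n + 3))
    (oth : Fin (n + 1) → Fin (n + 3) × Fin (n + 3))
    (dsp : Fin n → Fin (n + 3) × Fin (n + 3))
    (htri : ∀ k, IsTri D0 (tri k))
    (htriv : ∀ k, tri k = {ctr k, (oth k).1, (oth k).2})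
    (hvdist : ∀ k, ctr k ≠ (oth k).1 ∧ ctr k ≠ (oth k).2 ∧ (oth k).1 ≠ (oth k).2)
    (ha : a ∈ tri 0) (hb : b ∈ tri (Fin.last n))
    (hdsp : ∀ k : Fin n, (dsp k).1 < (dsp k).2 ∧ s((dsp k).1, (dsp k).2) ∈ D0 ∧
      crossE s((dsp k).1, (dsp k).2) s(a, b))
    (hsep : ∀ k : Fin n, (dsp k).1 ∈ tri k.castSucc ∧ (dsp k).2 ∈ tri k.castSucc ∧
      (dsp k).1 ∈ tri k.succ ∧ (dsp k).2 ∈ tri k.succ)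
    -- the arc `(a,b)` crosses every internal diagonal, and `dsp` enumerates them
    (hall : ∀ e ∈ D0, ∃ k : Fin n, e = s((dsp k).1, (dsp k).2))
    -- the crossings occur in order from `a` to `b`
    (horder : ∀ k : Fin n, ∀ j : Fin (n + 1), j.val ≤ k.val → ∀ w ∈ tri j,
      w ≠ (dsp k).1 → w ≠ (dsp k).2 → w ≠ b →
      crossE s((dsp k).1, (dsp k).2) s(w, b))
    -- the fan centers: `ctr k` is the apex of the face `tri k` for internal
    -- faces, and the first and last faces share the `σ`-edge endpoint of their
    -- neighbouring face
    (hapex : ∀ k : Fin (n + 1), ∀ h0 : 0 < k.val, ∀ h1 : k.val < n,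
      ctr k ∈ s((dsp ⟨k.val - 1, by omega⟩).1, (dsp ⟨k.val - 1, by omega⟩).2) ∧
      ctr k ∈ s((dsp ⟨k.val, h1⟩).1, (dsp ⟨k.val, h1⟩).2))
    (hctr0 : ctr 0 ∈ s((dsp ⟨0, hn⟩).1, (dsp ⟨0, hn⟩).2))
    (hctrN : ctr (Fin.last n) ∈ s((dsp ⟨n - 1, by omega⟩).1, (dsp ⟨n - 1, by omega⟩).2))
    (hctr01 : ∀ _ : 2 ≤ n, ctr 0 = ctr ⟨1, by omega⟩)
    (hctrN1 : ∀ _ : 2 ≤ n, ctr (Fin.last n) = ctr ⟨n - 1, by omega⟩)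
    -- the default orientation: each diagonal `dsp k` is oriented away from the
    -- fan center of the face on its `a`-side
    (o0 : Edg (n + 3) → Bool)
    (hdef : ∀ k : Fin n,
      o0 s((dsp k).1, (dsp k).2) = decide ((dsp k).1 = ctr k.castSucc))
    -- the initial λ-lengths and μ-invariants
    (lam0 : Edg (n + 3) → A) (mu0 : Finset (Fin (n + 3)) → A)
    (hlam0 : ∀ e : Edg (n + 3), isEdgeOf D0 e → lam0 e ∈ Pos)
    (hmu0sq : ∀ t : Finset (Fin (n + 3)), IsTri D0 t → mu0 t * mu0 t = 0)
    (hmu0anti : ∀ t t' : Finset (Fin (n + 3)), IsTri D0 t → IsTri D0 t' →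
      mu0 t * mu0 t' = -(mu0 t' * mu0 t))
    -- a state obtained from the initial data by any sequence of super Ptolemy
    -- flips, whose triangulation contains the arc `(a, b)`
    (st : PState A (n + 3))
    (hreach : Relation.ReflTransGen (Flip Pos sqrt)
      ⟨D0, o0, lam0, mu0⟩ st)
    (hmem : s(a, b) ∈ st.diag) :
    st.lam s(a, b) = ∑ᶠ t : SuperTPath n a b D0 ctr dsp,
      wt lam0 mu0 sqrt o0 tri ctr oth t := by
  classical
  have before : ∀ k : Fin n, ctr k.castSucc ∈ s((dsp k).1, (dsp k).2) := by
    intro k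
    rcases Nat.eq_zero_or_pos k.val with h | h
    · obtain ⟨k, hk⟩ := k
      simp only at h
      subst h
      exact hctr0
    · exact (hapex k.castSucc h k.isLt).2
  have after : ∀ k : Fin n, ctr k.succ ∈ s((dsp k).1, (dsp k).2) := by
    intro k
    rcases Nat.lt_or_ge (k.val + 1) n with h | h
    · exact (hapex k.succ (Nat.succ_pos _) h).1
    · have h1 : k = ⟨n - 1, by omega⟩ := Fin.ext (by have := k.isLt; simp only; omega)
      have h2 : k.succ = Fin.last n :=
        Fin.ext (by have := k.isLt; simp only [Fin.val_succ, Fin.val_last]; omega)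
      rw [h2]
      rw [h1]
      exact hctrN
  obtain ⟨c, w, v, hF, htc, hdc⟩ := exists_fanChain n hn a b hab D0 hD0 tri ctr oth dsp htri htriv
    ha hb hdsp hsep hall horder before after
  have hctr : ∀ k : Fin (n + 1), ctr k = c k := fun k => (htc k).1
  have htri' : ∀ k : Fin (n + 1), tri k = {c k, w k, v k} := fun k => (htc k).2
  have hoth : ∀ k : Fin (n + 1), s((oth k).1, (oth k).2) = s(w k, v k) := by
    intro k
    have e := htri' k
    have hne := hF.ne k (Nat.le_of_lt_succ k.isLt)
    have hd := hvdist k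
    rw [htriv k, hctr k] at e
    rw [hctr k] at hd
    have m1 : (oth k).1 ∈ ({c k, w k, v k} : Finset (Fin (n + 3))) := by rw [← e]; simp
    have m2 : (oth k).2 ∈ ({c k, w k, v k} : Finset (Fin (n + 3))) := by rw [← e]; simp
    simp only [Finset.mem_insert, Finset.mem_singleton] at m1 m2
    rcases m1 with m1 | m1 | m1
    · exact (hd.1 m1.symm).elim
    · rcases m2 with m2 | m2 | m2
      · exact (hd.2.1 m2.symm).elim
      · exact (hd.2.2 (m1.trans m2.symm)).elim
      · rw [m1, m2]
    · rcases m2 with m2 | m2 | m2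
      · exact (hd.2.1 m2.symm).elim
      · rw [m1, m2, Sym2.eq_swap]
      · exact (hd.2.2 (m1.trans m2.symm)).elim
  have hodef : ∀ k : Fin n, o0 s((dsp k).1, (dsp k).2) = decide ((dsp k).1 = c k) := by
    intro k
    rw [hdef k, hctr]
    rfl
  obtain ⟨E, O, _, _, _, P, H, hθ⟩ := exists_superHull (A := A)
    (Θ := {x | ∃ t, IsTri D0 t ∧ mu0 t = x})
    (by rintro _ ⟨t, ht, rfl⟩ _ ⟨t', ht', rfl⟩; exact hmu0anti t t' ht ht')
  obtain ⟨C, hC⟩ := exists_evenCone H Pos sqrt hPosAdd hPosMul hPosInv hPosCentral hPosUnit hsqrtSq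
    hsqrtMem hsqrtMul
  have exl : ∀ e, ∃ x, isEdgeOf D0 e → x ∈ C.Pos ∧ H.ι x = lam0 e := by
    intro e
    by_cases he : isEdgeOf D0 e
    · obtain ⟨x, hx⟩ := hC.exists_lift _ (hlam0 e he)
      exact ⟨x, fun _ => hx⟩
    · exact ⟨0, fun h => (he h).elim⟩
  choose lam hlam using exl
  have exm : ∀ k, ∃ x, k ≤ n → H.κ x = mu0 {c k, w k, v k} := by
    intro k
    by_cases hk : k ≤ n
    · obtain ⟨x, hx⟩ := hθ (mu0 {c k, w k, v k}) ⟨_, hF.tri k hk, rfl⟩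
      exact ⟨x, fun _ => hx⟩
    · exact ⟨0, fun h => (hk h).elim⟩
  choose m hm using exm
  have hlamP := fun e he => (hlam e he).1
  have hlamE := fun e he => (hlam e he).2
  obtain ⟨F, hCF⟩ := hF.exists_chainFrame C hlamP m
  obtain ⟨η, hR⟩ := hCF.realizes (H := H) hF hlamP (st := ⟨D0, o0, lam0, mu0⟩) rfl
    (fun e he => (hlamE e he).symm) (fun k hk => (hm k hk).symm)
    (fun k hk => FanChain.sgn_diagonal hdc ⟨k, hk⟩ (hdsp _).1 (hodef _))
  obtain ⟨η', hR'⟩ := hR.of_flips hC hreach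
  rw [(hR'.lam a b hab (Or.inr hmem)).2,
    finsum_wt lam0 mu0 sqrt tri ctr oth o0 (hF.injDsp hdc) (hF.precedes hctr hdc)]
  let r : ℕ → Bool := fun k => if h : k < n then rOf o0 dsp a ⟨k, h⟩ else true
  have hcent : ∀ par m x y, IsStep D0 ctr dsp par m x y → ∀ z,
      Commute (stepWt lam0 sqrt ctr oth par (x, y)) z := fun par m x y h z =>
    stepWt_commute hPosMul hPosInv hPosCentral hsqrtMem htri htriv hvdist hlam0 h z
  have hS := hF.pathSystem (lam0 := lam0) (mu0 := mu0) (sqrt := sqrt) (le := posB o0 dsp a)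
    (tri := tri) (oth := oth) (r := fun k => r k) hctr hdc (fun k k' hkk => by
      have hk : k.val < n := by have := k'.isLt; rw [Fin.lt_def] at hkk; omega
      simp only [posB, r, dif_pos hk]
      exact dif_pos hkk) hcent
  have exW : ∀ k, ∃ W : E, k ≤ n →
      W * (lam s(c k, w k) * lam s(c k, v k)) = triRoot C F (c k) (w k) (v k) ∧
      ∀ z, FanChain.sigHom ctr lam0 mu0 sqrt tri oth (fun k => r k) k z =
        H.ι W * if r k then H.κ (m k) * z else z * H.κ (m k) := by
    intro k
    by_cases hk : k ≤ n
    · obtain ⟨W, h1, h2⟩ := hF.exists_sigHom_eq (mu0 := mu0) (tri := tri) hC hctr hoth hlamP hlamE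
        (fun k => r k) ⟨k, Nat.lt_succ_of_le hk⟩
      refine ⟨W, fun _ => ⟨?_, fun z => ?_⟩⟩
      · rw [h1, triRoot, hCF.ell_third k hk, hCF.ell_side k hk, hCF.ell_diag k hk]
      · rw [hm k hk, h2, htri']
    · exact ⟨0, fun h => (hk h).elim⟩
  choose W hW using exW
  refine (hCF.eval hF hlamP hlamE (fun k hk => hPosCentral _ (hlam0 _ (Or.inr (hF.mem k hk)))) hS
    (r := r) ?_ (fun k hk => (hW k hk).1) (fun k hk => (hW k hk).2)).symm
  intro k hk
  simp only [r, dif_pos hk]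
  exact hF.rOf_eq_true_iff hdc ⟨k, hk⟩ (hdsp _).1 (hodef _)

end SuperTeich
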